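/- Let f be a fake μ. Suppose ℓ ≥ 1 is an integer, a_1,…,a_{2ℓ} are integers with a_j ≥ 0 for 1 ≤ j ≤ ℓ−1 and a_ℓ < 0, and (η_j)_{j≥2ℓ+1} are real numbers with |η_j| ≤ (A j)^B for some constants A, B > 0, such that for all s with Re s > 1: D_f(s) = (∏_p (1 + Σ_{j≥2ℓ+1} η_j p^{−js})) · ∏_{j=1}^{2ℓ} ζ(js)^{a_j}. Then there exist real polynomials P_1,…,P_{2ℓ}, with P_j = 0 whenever a_j ≤ 0 and deg P_j ≤ a_j − 1 whenever a_j ≥ 1, such that the function E(x) = F_f(x) − Σ_{j=1}^{2ℓ} P_j(log x) x^{1/j} satisfies E(x) = Ω_±(x^{1/(2ℓ)} (log x)^{|a_ℓ|−1}). -/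

import Mathlib

open Complex

/-- `OmegaPM E g` means `E(x) = Ω_±(g(x))`: there are positive constants `c`
such that `E(x) ≥ c g(x)` for arbitrarily large `x` and `E(x) ≤ -c g(x)` for
arbitrarily large `x` (equivalently `limsup E/g > 0` and `liminf E/g < 0`). -/
def OmegaPM (E g : ℝ → ℝ) : Prop :=
  (∃ c : ℝ, 0 < c ∧ ∀ x₀ : ℝ, ∃ x : ℝ, x₀ ≤ x ∧ c * g x ≤ E x) ∧
  (∃ c : ℝ, 0 < c ∧ ∀ x₀ : ℝ, ∃ x : ℝ, x₀ ≤ x ∧ E x ≤ -(c * g x))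

namespace FakeMu

/-! ### The alternating zeta function -/

/-- The alternating zeta function, `∑ (-1) ^ n (n + 1) ^ (-s)`, as an entire function. -/
noncomputable def altZeta (s : ℂ) : ℂ :=
  -HurwitzZeta.cosZeta (((1 / 2 : ℝ)) : UnitAddCircle) s

lemma half_ne_zero : (((1 / 2 : ℝ)) : UnitAddCircle) ≠ 0 := by
  intro h
  rw [AddCircle.coe_eq_zero_iff] at h
  obtain ⟨n, hn⟩ := h
  simp only [zsmul_eq_mul, mul_one] at hn
  have h2 : ((2 * n : ℤ) : ℝ) = ((1 : ℤ) : ℝ) := by push_cast; linarith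
  have h3 : 2 * n = 1 := by exact_mod_cast h2
  omega

lemma differentiable_altZeta : Differentiable ℂ altZeta :=
  (HurwitzZeta.differentiable_cosZeta_of_ne_zero half_ne_zero).neg

lemma hasSum_altZeta {s : ℂ} (hs : 1 < s.re) :
    HasSum (fun n : ℕ => (-1 : ℂ) ^ n * ((n : ℂ) + 1) ^ (-s)) (altZeta s) := by
  have h := (HurwitzZeta.hasSum_nat_cosZeta (1 / 2) hs).neg
  have hs0 : s ≠ 0 := by rintro rfl; simp at hs; linarith
  rw [← hasSum_nat_add_iff' 1] at h
  simp only [Finset.range_one, Finset.sum_singleton, Nat.cast_zero, Complex.zero_cpow hs0, div_zero,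
    neg_zero, sub_zero] at h
  refine h.congr_fun ?_ |> fun h' => h'
  intro n
  have : Real.cos (2 * Real.pi * (1 / 2) * ((n + 1 : ℕ) : ℝ)) = (-1) ^ (n + 1) := by
    rw [show 2 * Real.pi * (1 / 2) * ((n + 1 : ℕ) : ℝ) = ((n + 1 : ℕ) : ℝ) * Real.pi by ring]
    exact Real.cos_nat_mul_pi (n + 1)
  rw [this, Complex.cpow_neg]
  push_cast
  rw [pow_succ]
  ring

lemma altZeta_eq_of_one_lt {s : ℂ} (hs : 1 < s.re) :
    altZeta s = (1 - 2 ^ (1 - s)) * riemannZeta s := by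
  set g : ℕ → ℂ := fun n => 1 / ((n : ℂ) + 1) ^ s with hg
  set b : ℕ → ℂ := fun n : ℕ => (-1 : ℂ) ^ n * ((n : ℂ) + 1) ^ (-s) with hb
  have hsum : Summable g := by
    have := (Complex.summable_one_div_nat_cpow (p := s)).mpr hs
    simpa [hg] using (summable_nat_add_iff 1).mpr this
  have hz : riemannZeta s = ∑' n, g n := zeta_eq_tsum_one_div_nat_add_one_cpow hs
  have ha : ∑' n, b n = altZeta s := (hasSum_altZeta hs).tsum_eq
  have i0 : Function.Injective (fun k : ℕ => 2 * k) := fun a b h => by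
    simp only at h; omega
  have i1 : Function.Injective (fun k : ℕ => 2 * k + 1) := fun a b h => by
    simp only at h; omega
  have he : Summable (fun k : ℕ => g (2 * k)) := hsum.comp_injective i0
  have ho : Summable (fun k : ℕ => g (2 * k + 1)) := hsum.comp_injective i1
  have e1 : ∀ k : ℕ, b (2 * k) = g (2 * k) := fun k => by
    simp only [hb, hg, pow_mul, Complex.cpow_neg]
    norm_num
  have e2 : ∀ k : ℕ, b (2 * k + 1) = -g (2 * k + 1) := fun k => by
    simp only [hb, hg, pow_succ, pow_mul, Complex.cpow_neg]
    norm_num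
  have h1 : ∑' k, g (2 * k) + ∑' k, g (2 * k + 1) = ∑' k, g k := tsum_even_add_odd he ho
  have h2 : ∑' k, b (2 * k) + ∑' k, b (2 * k + 1) = ∑' k, b k := by
    refine tsum_even_add_odd ?_ ?_
    · simpa only [e1] using he
    · simpa only [e2] using ho.neg
  have e3 : ∀ k : ℕ, g (2 * k + 1) = 2 ^ (-s) * g k := by
    intro k
    have h := Complex.natCast_mul_natCast_cpow 2 (k + 1) s
    simp only [hg]
    rw [show (((2 * k + 1 : ℕ) : ℂ) + 1) = ((2 : ℕ) : ℂ) * ((k + 1 : ℕ) : ℂ) by push_cast; ring,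
      h, Complex.cpow_neg]
    push_cast
    rw [one_div, mul_inv, one_div]
  have e4 : ∑' k : ℕ, g (2 * k + 1) = 2 ^ (-s) * riemannZeta s := by
    rw [hz, ← tsum_mul_left]
    exact tsum_congr e3
  simp only [e1, e2, tsum_neg] at h2
  rw [← hz, e4] at h1
  rw [ha, e4] at h2
  have e5 : (2 : ℂ) ^ (1 - s) = 2 * 2 ^ (-s) := by
    rw [sub_eq_add_neg, Complex.cpow_add _ _ two_ne_zero, Complex.cpow_one]
  rw [e5, ← h2]
  linear_combination h1

lemma differentiable_one_sub_two_cpow : Differentiable ℂ (fun s : ℂ => 1 - (2 : ℂ) ^ (1 - s)) := by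
  intro s
  refine DifferentiableAt.const_sub ?_ _
  exact DifferentiableAt.const_cpow (by fun_prop) (Or.inl two_ne_zero)

lemma altZeta_eq {s : ℂ} (hs : s ≠ 1) :
    altZeta s = (1 - 2 ^ (1 - s)) * riemannZeta s := by
  have h1 : AnalyticOnNhd ℂ altZeta {1}ᶜ :=
    differentiable_altZeta.differentiableOn.analyticOnNhd isOpen_compl_singleton
  have h2 : AnalyticOnNhd ℂ (fun s : ℂ => (1 - (2 : ℂ) ^ (1 - s)) * riemannZeta s) {1}ᶜ := by
    refine DifferentiableOn.analyticOnNhd (fun z hz => ?_) isOpen_compl_singleton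
    exact ((differentiable_one_sub_two_cpow z).mul
      (differentiableAt_riemannZeta hz)).differentiableWithinAt
  refine h1.eqOn_of_preconnected_of_eventuallyEq h2
    (isConnected_compl_singleton_of_one_lt_rank (by simp) 1).isPreconnected (z₀ := 2)
    (by simp) ?_ hs
  filter_upwards [(isOpen_lt continuous_const Complex.continuous_re).mem_nhds
    (show (1 : ℝ) < (2 : ℂ).re by simp)] with z hz
  exact altZeta_eq_of_one_lt hz

/-! ### Iterated differences of `x ↦ x ^ (-s)` -/

/-- The `k`-fold backward difference of `x ↦ x ^ (-s)`. -/
noncomputable def iterDiff (s : ℂ) : ℕ → ℝ → ℂ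
  | 0, x => (x : ℂ) ^ (-s)
  | k + 1, x => iterDiff s k x - iterDiff s k (x + 1)

lemma continuousOn_iterDiff (s : ℂ) (k : ℕ) : ContinuousOn (iterDiff s k) (Set.Ioi 0) := by
  induction k with
  | zero =>
    intro x hx
    refine ContinuousAt.continuousWithinAt ?_
    simp only [iterDiff]
    exact (continuousAt_cpow_const (Or.inl (by simpa using hx))).comp
      Complex.continuous_ofReal.continuousAt
  | succ k ih =>
    simp only [iterDiff]
    refine ih.sub (ih.comp (by fun_prop) ?_)
    intro x hx
    simp only [Set.mem_Ioi] at *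
    linarith

lemma differentiable_iterDiff (k : ℕ) {x : ℝ} (hx : 0 < x) :
    Differentiable ℂ (fun s => iterDiff s k x) := by
  induction k generalizing x with
  | zero =>
    intro s
    simp only [iterDiff]
    exact DifferentiableAt.const_cpow (by fun_prop) (Or.inl (by exact_mod_cast hx.ne'))
  | succ k ih =>
    simp only [iterDiff]
    exact (ih hx).sub (ih (by linarith))

lemma iterDiff_succ_eq_integral (k : ℕ) (s : ℂ) {x : ℝ} (hx : 0 < x) :
    iterDiff s (k + 1) x = s * ∫ u in (0 : ℝ)..1, iterDiff (s + 1) k (x + u) := by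
  induction k generalizing x with
  | zero =>
    have hd : ∀ u ∈ Set.uIcc (0 : ℝ) 1, HasDerivAt (fun u : ℝ => -(((x + u : ℝ)) : ℂ) ^ (-s))
        (s * (((x + u : ℝ)) : ℂ) ^ (-(s + 1))) u := by
      intro u hu
      rw [Set.uIcc_of_le zero_le_one] at hu
      have hpos : 0 < x + u := by linarith [hu.1]
      have h1 : HasDerivAt (fun z : ℂ => z ^ (-s)) (-s * ((x + u : ℝ) : ℂ) ^ (-s - 1))
          ((x + u : ℝ) : ℂ) :=
        by simpa using (hasDerivAt_id ((x + u : ℝ) : ℂ)).cpow_const (c := -s)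
            (Or.inl (by simpa using hpos))
      have h2 : HasDerivAt (fun u : ℝ => ((x + u : ℝ) : ℂ)) 1 u := by
        have := ((hasDerivAt_id u).const_add x).ofReal_comp
        simpa using this
      have h3 := (h1.comp u h2).neg
      have e : -(s + 1) = -s - 1 := by ring
      rw [e]
      exact h3.congr_deriv (by ring)
    have hi : IntervalIntegrable (fun u : ℝ => s * (((x + u : ℝ)) : ℂ) ^ (-(s + 1)))
        MeasureTheory.volume 0 1 := by
      apply ContinuousOn.intervalIntegrable
      refine continuousOn_const.mul ?_
      refine (continuousOn_iterDiff (s + 1) 0).comp (f := fun u : ℝ => x + u) (by fun_prop) ?_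
      intro u hu
      rw [Set.uIcc_of_le zero_le_one] at hu
      simp only [Set.mem_Ioi]
      linarith [hu.1]
    have := intervalIntegral.integral_eq_sub_of_hasDerivAt hd hi
    simp only [iterDiff]
    rw [← intervalIntegral.integral_const_mul, this]
    simp
    ring
  | succ k ih =>
    have h_int : ∀ y : ℝ, 0 < y → IntervalIntegrable (fun u : ℝ => iterDiff (s + 1) k (y + u))
        MeasureTheory.volume 0 1 := by
      intro y hy
      apply ContinuousOn.intervalIntegrable
      refine (continuousOn_iterDiff (s + 1) k).comp (f := fun u : ℝ => y + u) (by fun_prop) ?_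
      intro u hu
      rw [Set.uIcc_of_le zero_le_one] at hu
      simp only [Set.mem_Ioi]
      linarith [hu.1]
    rw [show iterDiff s (k + 1 + 1) x = iterDiff s (k + 1) x - iterDiff s (k + 1) (x + 1) from rfl,
      ih hx, ih (by linarith : 0 < x + 1), ← mul_sub,
      ← intervalIntegral.integral_sub (h_int x hx) (h_int (x + 1) (by linarith))]
    congr 1
    refine intervalIntegral.integral_congr fun u _ => ?_
    simp only [iterDiff]
    rw [show x + 1 + u = x + u + 1 by ring]

lemma norm_iterDiff_le (k : ℕ) (s : ℂ) {x : ℝ} (hx : 0 < x) (hk : k = 0 ∨ 0 ≤ s.re + k) :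
    ‖iterDiff s k x‖ ≤ (‖s‖ + k) ^ k * x ^ (-s.re - k) := by
  induction k generalizing s x with
  | zero =>
    simp [iterDiff, Complex.norm_cpow_eq_rpow_re_of_pos hx]
  | succ k ih =>
    have hk' : 0 ≤ s.re + k + 1 := by
      rcases hk with h | h
      · omega
      · push_cast at h; linarith
    rw [iterDiff_succ_eq_integral k s hx, norm_mul]
    have hb : ∀ u ∈ Set.uIoc (0 : ℝ) 1, ‖iterDiff (s + 1) k (x + u)‖
        ≤ (‖s‖ + (k + 1)) ^ k * x ^ (-s.re - (k + 1)) := by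
      intro u hu
      rw [Set.uIoc_of_le zero_le_one] at hu
      have h1 := ih (s + 1) (x := x + u) (by linarith [hu.1]) (Or.inr (by simp; linarith))
      refine h1.trans ?_
      have h2 : ‖s + 1‖ ≤ ‖s‖ + 1 := (norm_add_le _ _).trans (by simp)
      have h3 : (x + u) ^ (-(s + 1).re - k) ≤ x ^ (-s.re - (k + 1)) := by
        have : -(s + 1).re - (k : ℝ) = -s.re - (k + 1) := by simp; ring
        rw [this]
        exact Real.rpow_le_rpow_of_nonpos hx (by linarith [hu.1]) (by linarith)
      have h4 : ‖s + 1‖ + k ≤ ‖s‖ + (k + 1) := by linarith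
      exact mul_le_mul (pow_le_pow_left₀ (by positivity) h4 k) h3
        (Real.rpow_nonneg (by linarith [hu.1]) _) (by positivity)
    have h4 := intervalIntegral.norm_integral_le_of_norm_le_const hb
    simp only [sub_zero, abs_one, mul_one] at h4
    calc ‖s‖ * ‖∫ u in (0 : ℝ)..1, iterDiff (s + 1) k (x + u)‖
        ≤ (‖s‖ + (k + 1)) * ((‖s‖ + (k + 1)) ^ k * x ^ (-s.re - (k + 1))) := by
          gcongr
          have : (0 : ℝ) ≤ k := Nat.cast_nonneg k
          linarith
      _ = _ := by push_cast; ring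

end FakeMu

namespace FakeMu

/-! ### The Euler transform of the alternating zeta series -/

/-- The alternating tail `∑ (-1) ^ m Δ^K (N + m) ^ (-s)`. -/
noncomputable def altTail (s : ℂ) (K N : ℕ) : ℂ :=
  ∑' m : ℕ, (-1 : ℂ) ^ m * iterDiff s K ((N : ℝ) + m)

lemma norm_altTail_term_le {s : ℂ} {K N : ℕ} (hN : 1 ≤ N) (hK : 1 < s.re + K) (m : ℕ) :
    ‖(-1 : ℂ) ^ m * iterDiff s K ((N : ℝ) + m)‖
      ≤ (‖s‖ + K) ^ K * ((N : ℝ) + m) ^ (-s.re - K) := by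
  have hN' : (1 : ℝ) ≤ N := by exact_mod_cast hN
  rw [norm_mul, norm_pow, norm_neg, norm_one, one_pow, one_mul]
  exact norm_iterDiff_le K s (by positivity) (Or.inr (by linarith))

lemma summable_add_rpow (N : ℕ) {b : ℝ} (hb : b < -1) :
    Summable (fun m : ℕ => ((N : ℝ) + m) ^ b) := by
  have h := (summable_nat_add_iff N).mpr (Real.summable_nat_rpow.mpr hb)
  refine h.congr fun m => ?_
  push_cast
  rw [add_comm]

lemma summable_altTail {s : ℂ} {K N : ℕ} (hN : 1 ≤ N) (hK : 1 < s.re + K) :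
    Summable (fun m : ℕ => (-1 : ℂ) ^ m * iterDiff s K ((N : ℝ) + m)) :=
  Summable.of_norm_bounded ((summable_add_rpow N (by linarith)).mul_left _)
    (norm_altTail_term_le hN hK)

lemma norm_altTail_le {s : ℂ} {K N : ℕ} (hN : 1 ≤ N) (hK : 1 < s.re + K) :
    ‖altTail s K N‖ ≤ (‖s‖ + K) ^ K * ∑' m : ℕ, ((N : ℝ) + m) ^ (-s.re - K) := by
  rw [← tsum_mul_left]
  exact tsum_of_norm_bounded (((summable_add_rpow N (by linarith)).mul_left _).hasSum)
    (norm_altTail_term_le hN hK)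

lemma altTail_eq_add_succ {s : ℂ} {K N : ℕ} (hN : 1 ≤ N) (hK : 1 < s.re + K) :
    altTail s K N = iterDiff s K N / 2 + altTail s (K + 1) N / 2 := by
  have hs := summable_altTail hN hK
  have h0 : altTail s K N = iterDiff s K N
      + ∑' m : ℕ, (-1 : ℂ) ^ (m + 1) * iterDiff s K ((N : ℝ) + (m + 1 : ℕ)) := by
    rw [altTail, hs.tsum_eq_zero_add]
    simp
  have h1 : altTail s (K + 1) N = altTail s K N
      + ∑' m : ℕ, (-1 : ℂ) ^ (m + 1) * iterDiff s K ((N : ℝ) + (m + 1 : ℕ)) := by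
    rw [altTail, altTail, ← hs.tsum_add ((summable_nat_add_iff 1).mpr hs)]
    refine tsum_congr fun m => ?_
    simp only [iterDiff]
    push_cast
    rw [pow_succ, ← add_assoc]
    ring
  rw [h1]
  linear_combination (1 / 2) * h0

lemma altTail_zero_eq {s : ℂ} {N : ℕ} (hN : 1 ≤ N) (hs : 1 < s.re) (K : ℕ) :
    altTail s 0 N = ∑ k ∈ Finset.range K, iterDiff s k N / 2 ^ (k + 1) + altTail s K N / 2 ^ K := by
  induction K with
  | zero => simp
  | succ K ih =>
    have hK : (0 : ℝ) ≤ K := Nat.cast_nonneg K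
    rw [ih, altTail_eq_add_succ (K := K) hN (by linarith), Finset.sum_range_succ]
    field_simp
    ring

lemma altZeta_eq_partial_of_one_lt {s : ℂ} (hs : 1 < s.re) (M : ℕ) :
    altZeta s = ∑ n ∈ Finset.range M, (-1 : ℂ) ^ n * ((n : ℂ) + 1) ^ (-s)
      + (-1) ^ M * altTail s 0 (M + 1) := by
  have h := hasSum_altZeta hs
  rw [← h.tsum_eq, ← h.summable.sum_add_tsum_nat_add M, altTail, ← tsum_mul_left]
  congr 1
  refine tsum_congr fun m => ?_
  simp only [iterDiff]
  rw [pow_add]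
  push_cast
  rw [show (m : ℂ) + M + 1 = M + 1 + m by ring]
  ring

lemma differentiableOn_altTail (K : ℕ) {N : ℕ} (hN : 1 ≤ N) :
    DifferentiableOn ℂ (fun s => altTail s K N) {s | 1 < s.re + K} := by
  intro s hs
  simp only [Set.mem_ofPred_eq] at hs
  obtain ⟨b, hb1, hb2⟩ := exists_between hs
  have hopen : IsOpen ({z : ℂ | b < z.re + K} ∩ Metric.ball 0 (‖s‖ + 1)) :=
    (isOpen_lt continuous_const (by fun_prop)).inter Metric.isOpen_ball
  have hN' : (1 : ℝ) ≤ N := by exact_mod_cast hN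
  have hd : DifferentiableOn ℂ (fun s => altTail s K N)
      ({z : ℂ | b < z.re + K} ∩ Metric.ball 0 (‖s‖ + 1)) := by
    refine differentiableOn_tsum_of_summable_norm
      (u := fun m : ℕ => (‖s‖ + 1 + K) ^ K * ((N : ℝ) + m) ^ (-b))
      ((summable_add_rpow N (by linarith)).mul_left _) ?_ hopen ?_
    · intro m
      exact ((differentiable_iterDiff K (by positivity)).const_mul _).differentiableOn
    · rintro m w ⟨hw1, hw2⟩
      simp only [Set.mem_ofPred_eq, Metric.mem_ball, dist_zero_right] at hw1 hw2
      refine (norm_altTail_term_le hN (by linarith) m).trans ?_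
      have h1 : ((N : ℝ) + m) ^ (-w.re - K) ≤ ((N : ℝ) + m) ^ (-b) :=
        Real.rpow_le_rpow_of_exponent_le (by linarith [(Nat.cast_nonneg m : (0 : ℝ) ≤ m)])
          (by linarith)
      exact mul_le_mul (pow_le_pow_left₀ (by positivity) (by linarith) K) h1
        (by positivity) (by positivity)
  refine (hd.differentiableAt (hopen.mem_nhds ⟨hb2, ?_⟩)).differentiableWithinAt
  simp

lemma altZeta_eq_euler (M K : ℕ) {s : ℂ} (hs : 1 < s.re + K) :
    altZeta s = ∑ n ∈ Finset.range M, (-1 : ℂ) ^ n * ((n : ℂ) + 1) ^ (-s)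
      + (-1) ^ M * (∑ k ∈ Finset.range K, iterDiff s k ((M + 1 : ℕ) : ℝ) / 2 ^ (k + 1)
        + altTail s K (M + 1) / 2 ^ K) := by
  have hopen : IsOpen {s : ℂ | 1 < s.re + K} := isOpen_lt continuous_const (by fun_prop)
  have hconv : Convex ℝ {s : ℂ | 1 < s.re + K} := by
    have : {s : ℂ | 1 < s.re + K} = {s : ℂ | 1 - (K : ℝ) < s.re} := by
      ext z; simp only [Set.mem_ofPred_eq]; constructor <;> intro h <;> linarith
    rw [this]
    exact convex_halfSpace_re_gt _
  have h1 : AnalyticOnNhd ℂ altZeta {s : ℂ | 1 < s.re + K} :=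
    differentiable_altZeta.differentiableOn.analyticOnNhd hopen
  have h2 : AnalyticOnNhd ℂ (fun s => ∑ n ∈ Finset.range M, (-1 : ℂ) ^ n * ((n : ℂ) + 1) ^ (-s)
      + (-1) ^ M * (∑ k ∈ Finset.range K, iterDiff s k ((M + 1 : ℕ) : ℝ) / 2 ^ (k + 1)
        + altTail s K (M + 1) / 2 ^ K)) {s : ℂ | 1 < s.re + K} := by
    refine DifferentiableOn.analyticOnNhd ?_ hopen
    have ht := differentiableOn_altTail K (N := M + 1) (by omega)
    refine DifferentiableOn.add (Differentiable.differentiableOn ?_)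
      (DifferentiableOn.const_mul (DifferentiableOn.add (Differentiable.differentiableOn ?_)
        (ht.div_const _)) _)
    · refine Differentiable.fun_sum fun n _ => Differentiable.const_mul ?_ _
      intro s
      exact DifferentiableAt.const_cpow (by fun_prop) (Or.inl (by exact_mod_cast n.succ_ne_zero))
    · refine Differentiable.fun_sum fun k _ => Differentiable.div_const ?_ _
      exact differentiable_iterDiff k (by positivity)
  refine h1.eqOn_of_preconnected_of_eventuallyEq h2 hconv.isPreconnected (z₀ := 2)
    ?_ ?_ hs
  · simp only [Set.mem_ofPred_eq]
    have : (0 : ℝ) ≤ K := Nat.cast_nonneg K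
    norm_num
    linarith
  filter_upwards [(isOpen_lt continuous_const Complex.continuous_re).mem_nhds
    (show (1 : ℝ) < (2 : ℂ).re by simp)] with z hz
  rw [altZeta_eq_partial_of_one_lt hz M, altTail_zero_eq (by omega) hz K]

/-! ### Polynomial growth -/

lemma norm_iterDiff_le_crude (k : ℕ) {s : ℂ} (hs : -2 ≤ s.re) {x : ℝ} (hx : 1 ≤ x) :
    ‖iterDiff s k x‖ ≤ 2 ^ k * (x + k) ^ 2 := by
  induction k generalizing x with
  | zero =>
    simp only [iterDiff]
    rw [Complex.norm_cpow_eq_rpow_re_of_pos (by linarith)]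
    have : x ^ (-s).re ≤ x ^ (2 : ℝ) := Real.rpow_le_rpow_of_exponent_le hx (by simp; linarith)
    simpa using this
  | succ k ih =>
    simp only [iterDiff]
    refine (norm_sub_le _ _).trans ((add_le_add (ih hx) (ih (by linarith : 1 ≤ x + 1))).trans ?_)
    have h0 : (0 : ℝ) ≤ k := Nat.cast_nonneg k
    have h1 : (x + k) ^ 2 ≤ (x + 1 + k) ^ 2 := pow_le_pow_left₀ (by linarith) (by linarith) 2
    have h2 : x + ((k + 1 : ℕ) : ℝ) = x + 1 + k := by push_cast; ring
    rw [h2, pow_succ (2 : ℝ) k]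
    have := mul_le_mul_of_nonneg_left h1 (pow_pos (two_pos (α := ℝ)) k).le
    linarith

lemma exists_norm_altZeta_le :
    ∃ C : ℝ, 1 ≤ C ∧ ∀ s : ℂ, -2 ≤ s.re → ‖altZeta s‖ ≤ C * (1 + ‖s‖) ^ 4 := by
  set S : ℝ := ∑' m : ℕ, (((1 : ℕ) : ℝ) + m) ^ (-2 : ℝ) with hS
  have hS0 : 0 ≤ S := tsum_nonneg fun m => by positivity
  refine ⟨1 + ∑ k ∈ Finset.range 4, (2 : ℝ) ^ k * (1 + k) ^ 2 + 4 ^ 4 * S, ?_, ?_⟩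
  · have : 0 ≤ ∑ k ∈ Finset.range 4, (2 : ℝ) ^ k * (1 + k) ^ 2 :=
      Finset.sum_nonneg fun k _ => by positivity
    have : 0 ≤ 4 ^ 4 * S := by positivity
    linarith
  intro s hs
  have hs4 : 1 < s.re + (4 : ℕ) := by push_cast; linarith
  rw [altZeta_eq_euler 0 4 hs4]
  simp only [Finset.range_zero, Finset.sum_empty, zero_add, pow_zero, one_mul, Nat.cast_one]
  have h1 : ‖∑ k ∈ Finset.range 4, iterDiff s k 1 / 2 ^ (k + 1)‖
      ≤ ∑ k ∈ Finset.range 4, (2 : ℝ) ^ k * (1 + k) ^ 2 := by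
    refine norm_sum_le_of_le _ fun k _ => ?_
    rw [norm_div, norm_pow, Complex.norm_ofNat]
    exact (div_le_self (norm_nonneg _) (one_le_pow₀ (by norm_num))).trans
      (norm_iterDiff_le_crude k hs le_rfl)
  have h2 : ‖altTail s 4 1 / 2 ^ 4‖ ≤ (‖s‖ + 4) ^ 4 * S := by
    rw [norm_div, norm_pow, Complex.norm_ofNat]
    refine (div_le_self (norm_nonneg _) (by norm_num)).trans
      ((norm_altTail_le le_rfl hs4).trans ?_)
    push_cast
    refine mul_le_mul_of_nonneg_left ?_ (by positivity)
    have ha := summable_add_rpow 1 (b := -s.re - 4) (by linarith)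
    have hb := summable_add_rpow 1 (b := -2) (by norm_num)
    simp only [Nat.cast_one] at ha hb hS
    rw [hS]
    refine ha.tsum_le_tsum (fun m => ?_) hb
    exact Real.rpow_le_rpow_of_exponent_le (by linarith [(Nat.cast_nonneg m : (0 : ℝ) ≤ m)])
      (by linarith)
  have h3 : (‖s‖ + 4) ^ 4 ≤ 4 ^ 4 * (1 + ‖s‖) ^ 4 := by
    rw [← mul_pow]
    exact pow_le_pow_left₀ (by positivity) (by linarith [norm_nonneg s]) 4
  have h4 : (1 : ℝ) ≤ (1 + ‖s‖) ^ 4 := one_le_pow₀ (by linarith [norm_nonneg s])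
  have h5 : 0 ≤ ∑ k ∈ Finset.range 4, (2 : ℝ) ^ k * (1 + k) ^ 2 :=
    Finset.sum_nonneg fun k _ => by positivity
  refine (norm_add_le _ _).trans ((add_le_add h1 h2).trans ?_)
  have h6 := mul_le_mul_of_nonneg_right h3 hS0
  nlinarith

/-! ### Approximation by Dirichlet polynomials -/

lemma exists_norm_altZeta_sub_le :
    ∃ C : ℝ, 0 ≤ C ∧ ∀ (M : ℕ) (s : ℂ), 1 ≤ M → 0 ≤ s.re → 2 * ‖s‖ ≤ M →
      ‖altZeta s - ∑ n ∈ Finset.range M, (-1 : ℂ) ^ n * ((n : ℂ) + 1) ^ (-s)‖ ≤ C := by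
  obtain ⟨C0, hC0⟩ := (tendsto_pow_const_mul_const_pow_of_lt_one 2 (r := (3 / 4 : ℝ))
    (by norm_num) (by norm_num)).bddAbove_range
  set S : ℝ := ∑' m : ℕ, (((1 : ℕ) : ℝ) + m) ^ (-2 : ℝ) with hS
  have hS0 : 0 ≤ S := tsum_nonneg fun m => by positivity
  have hC0' : ∀ n : ℕ, (n : ℝ) ^ 2 * (3 / 4) ^ n ≤ C0 := fun n => hC0 ⟨n, rfl⟩
  have hC00 : 0 ≤ C0 := (by positivity : (0 : ℝ) ≤ ((0 : ℕ) : ℝ) ^ 2 * (3 / 4) ^ 0).trans (hC0' 0)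
  refine ⟨4 + C0 * S, by positivity, ?_⟩
  intro M s hM hs hsM
  set N : ℕ := M + 1 with hN
  have hN2 : (2 : ℝ) ≤ N := by
    have : 2 ≤ N := by omega
    exact_mod_cast this
  have hN0 : (0 : ℝ) < N := by linarith
  have hsN : 2 * ‖s‖ ≤ N := by
    refine hsM.trans ?_
    rw [hN]; push_cast; linarith
  rw [altZeta_eq_euler M N (by linarith), add_sub_cancel_left, norm_mul, norm_pow, norm_neg,
    norm_one, one_pow, one_mul]
  have h1 : ‖∑ k ∈ Finset.range N, iterDiff s k (N : ℝ) / 2 ^ (k + 1)‖ ≤ 4 := by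
    have : ∀ k ∈ Finset.range N, ‖iterDiff s k (N : ℝ) / 2 ^ (k + 1)‖ ≤ (3 / 4 : ℝ) ^ k := by
      intro k hk
      have hk' : (k : ℝ) ≤ N := by exact_mod_cast (Finset.mem_range.mp hk).le
      have hk0 : (0 : ℝ) ≤ k := Nat.cast_nonneg k
      rw [norm_div, norm_pow, Complex.norm_ofNat]
      have h := norm_iterDiff_le k s hN0 (Or.inr (by linarith))
      have h' : ((N : ℝ)) ^ (-s.re - k) ≤ ((N : ℝ) ^ k)⁻¹ := by
        rw [← Real.rpow_natCast, ← Real.rpow_neg hN0.le]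
        exact Real.rpow_le_rpow_of_exponent_le (by linarith) (by linarith)
      have h2 : (‖s‖ + k) ^ k ≤ ((3 / 2) * N) ^ k :=
        pow_le_pow_left₀ (by positivity) (by linarith) k
      rw [div_le_iff₀ (by positivity)]
      calc ‖iterDiff s k (N : ℝ)‖ ≤ ((3 / 2) * N) ^ k * ((N : ℝ) ^ k)⁻¹ :=
            h.trans (mul_le_mul h2 h' (by positivity) (by positivity))
        _ = (3 / 2) ^ k := by rw [mul_pow]; field_simp
        _ = (3 / 4) ^ k * 2 ^ k := by rw [← mul_pow]; norm_num
        _ ≤ (3 / 4) ^ k * 2 ^ (k + 1) := by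
            refine mul_le_mul_of_nonneg_left ?_ (by positivity)
            exact pow_le_pow_right₀ (by norm_num) (by omega)
    refine (norm_sum_le_of_le _ this).trans ?_
    have hg := (summable_geometric_of_lt_one (r := (3 / 4 : ℝ)) (by norm_num)
      (by norm_num)).sum_le_tsum (Finset.range N) (fun _ _ => by positivity)
    rw [tsum_geometric_of_lt_one (by norm_num) (by norm_num)] at hg
    norm_num at hg ⊢
    exact hg
  have h2 : ‖altTail s N N / 2 ^ N‖ ≤ C0 * S := by
    rw [norm_div, norm_pow, Complex.norm_ofNat, div_le_iff₀ (by positivity)]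
    refine (norm_altTail_le (by omega) (by linarith)).trans ?_
    have ha := summable_add_rpow N (b := -s.re - N) (by linarith)
    have hb := summable_add_rpow 1 (b := -2) (by norm_num)
    have hterm : ∀ m : ℕ, ((N : ℝ) + m) ^ (-s.re - N)
        ≤ ((N : ℝ) ^ 2 * ((N : ℝ) ^ N)⁻¹) * (((1 : ℕ) : ℝ) + m) ^ (-2 : ℝ) := by
      intro m
      have hm : (0 : ℝ) ≤ m := Nat.cast_nonneg m
      have e1 : ((N : ℝ) + m) ^ (-s.re - N) ≤ ((N : ℝ) + m) ^ (-2 + (-(N : ℝ) + 2)) :=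
        Real.rpow_le_rpow_of_exponent_le (by linarith) (by linarith)
      rw [Real.rpow_add (by positivity)] at e1
      have e2 : ((N : ℝ) + m) ^ (-(N : ℝ) + 2) ≤ (N : ℝ) ^ (-(N : ℝ) + 2) :=
        Real.rpow_le_rpow_of_nonpos hN0 (by linarith) (by linarith)
      have e3 : ((N : ℝ) + m) ^ (-2 : ℝ) ≤ (((1 : ℕ) : ℝ) + m) ^ (-2 : ℝ) :=
        Real.rpow_le_rpow_of_nonpos (by positivity) (by push_cast; linarith) (by norm_num)
      have e4 : (N : ℝ) ^ (-(N : ℝ) + 2) = (N : ℝ) ^ 2 * ((N : ℝ) ^ N)⁻¹ := by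
        rw [Real.rpow_add hN0, Real.rpow_neg hN0.le, Real.rpow_natCast, mul_comm]
        norm_num
      rw [e4] at e2
      refine e1.trans ?_
      rw [mul_comm]
      exact mul_le_mul e2 e3 (by positivity) (by positivity)
    have h3 : ∑' m : ℕ, ((N : ℝ) + m) ^ (-s.re - N) ≤ ((N : ℝ) ^ 2 * ((N : ℝ) ^ N)⁻¹) * S := by
      rw [hS, ← tsum_mul_left]
      exact ha.tsum_le_tsum hterm (hb.mul_left _)
    have h4 : (‖s‖ + N) ^ N ≤ ((3 / 2) * N) ^ N :=
      pow_le_pow_left₀ (by positivity) (by linarith) N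
    calc (‖s‖ + N) ^ N * ∑' m : ℕ, ((N : ℝ) + m) ^ (-s.re - N)
        ≤ ((3 / 2) * N) ^ N * (((N : ℝ) ^ 2 * ((N : ℝ) ^ N)⁻¹) * S) :=
          mul_le_mul h4 h3 (tsum_nonneg fun m => by positivity) (by positivity)
      _ = ((N : ℝ) ^ 2 * (3 / 2) ^ N) * S := by rw [mul_pow]; field_simp
      _ = ((N : ℝ) ^ 2 * (3 / 4) ^ N) * S * 2 ^ N := by
          rw [show (3 / 2 : ℝ) = 3 / 4 * 2 by norm_num, mul_pow]; ring
      _ ≤ C0 * S * 2 ^ N := by gcongr; exact hC0' N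
  exact (norm_add_le _ _).trans (add_le_add h1 h2)

end FakeMu

namespace FakeMu

/-! ### Mean squares -/

lemma integral_gauss_mul_cexp {b : ℝ} (hb : 0 < b) (l : ℝ) :
    ∫ t : ℝ, cexp (-(b : ℂ) * t ^ 2 + (l * I) * t + 0)
      = ((Real.sqrt (Real.pi / b) * Real.exp (-l ^ 2 / (4 * b)) : ℝ) : ℂ) := by
  rw [integral_cexp_quadratic (by simpa using hb)]
  have h1 : ((Real.pi : ℂ) / - -(b : ℂ)) ^ (1 / 2 : ℂ) = ((Real.sqrt (Real.pi / b) : ℝ) : ℂ) := by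
    rw [Real.sqrt_eq_rpow, Complex.ofReal_cpow (by positivity)]
    push_cast
    rw [neg_neg]
  rw [h1]
  push_cast
  congr 2
  have : (b : ℂ) ≠ 0 := by exact_mod_cast hb.ne'
  rw [mul_pow, Complex.I_sq]
  field_simp
  ring

/-- Gaussian-weighted mean square of an exponential sum. -/
lemma integral_gauss_norm_sq_le {b : ℝ} (hb : 0 < b) (S : Finset ℕ) (c : ℕ → ℂ) (l : ℕ → ℝ) :
    ∫ t : ℝ, Real.exp (-b * t ^ 2) * ‖∑ n ∈ S, c n * cexp (l n * I * t)‖ ^ 2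
      ≤ Real.sqrt (Real.pi / b) * ∑ m ∈ S, ∑ n ∈ S,
        ‖c m‖ * ‖c n‖ * Real.exp (-(l m - l n) ^ 2 / (4 * b)) := by
  have hpt : ∀ t : ℝ, ((Real.exp (-b * t ^ 2) * ‖∑ n ∈ S, c n * cexp (l n * I * t)‖ ^ 2 : ℝ) : ℂ)
      = ∑ m ∈ S, ∑ n ∈ S, (c m * (starRingEnd ℂ) (c n)) *
        cexp (-(b : ℂ) * t ^ 2 + (((l m - l n : ℝ) : ℂ) * I) * t + 0) := by
    intro t
    push_cast
    rw [← Complex.mul_conj', map_sum, Finset.sum_mul_sum, Finset.mul_sum]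
    refine Finset.sum_congr rfl fun m _ => ?_
    rw [Finset.mul_sum]
    refine Finset.sum_congr rfl fun n _ => ?_
    rw [map_mul, ← Complex.exp_conj]
    simp only [map_mul, Complex.conj_ofReal, Complex.conj_I]
    rw [show -(b : ℂ) * t ^ 2 + ((l m - l n : ℂ) * I) * t + 0
      = -(b : ℂ) * t ^ 2 + l m * I * t + l n * -I * t by ring, Complex.exp_add, Complex.exp_add]
    ring
  have h_int : ∀ m n : ℕ, MeasureTheory.Integrable (fun t : ℝ => (c m * (starRingEnd ℂ) (c n)) *
        cexp (-(b : ℂ) * t ^ 2 + (((l m - l n : ℝ) : ℂ) * I) * t + 0)) := fun m n =>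
    (integrable_cexp_quadratic (by simpa using hb) _ _).const_mul _
  have h1 : ((∫ t : ℝ, Real.exp (-b * t ^ 2) * ‖∑ n ∈ S, c n * cexp (l n * I * t)‖ ^ 2 : ℝ) : ℂ)
      = ∑ m ∈ S, ∑ n ∈ S, (c m * (starRingEnd ℂ) (c n)) *
        ((Real.sqrt (Real.pi / b) * Real.exp (-(l m - l n) ^ 2 / (4 * b)) : ℝ) : ℂ) := by
    rw [← integral_complex_ofReal]
    simp_rw [hpt]
    rw [MeasureTheory.integral_finsetSum _
      (fun m _ => MeasureTheory.integrable_finsetSum _ (fun n _ => h_int m n))]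
    refine Finset.sum_congr rfl fun m _ => ?_
    rw [MeasureTheory.integral_finsetSum _ (fun n _ => h_int m n)]
    refine Finset.sum_congr rfl fun n _ => ?_
    rw [MeasureTheory.integral_const_mul, integral_gauss_mul_cexp hb]
  refine (le_abs_self _).trans ?_
  rw [← Real.norm_eq_abs, ← Complex.norm_real, h1, Finset.mul_sum]
  refine norm_sum_le_of_le _ fun m _ => ?_
  rw [Finset.mul_sum]
  refine norm_sum_le_of_le _ fun n _ => ?_
  rw [norm_mul, norm_mul, RCLike.norm_conj, Complex.norm_real, Real.norm_eq_abs,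
    abs_of_nonneg (by positivity)]
  apply le_of_eq
  ring

lemma sum_sum_mul_le (S : Finset ℕ) (a : ℕ → ℝ) (w : ℕ → ℕ → ℝ) (K : ℝ)
    (hw : ∀ m n, 0 ≤ w m n) (hsymm : ∀ m n, w m n = w n m)
    (hK : ∀ m ∈ S, ∑ n ∈ S, w m n ≤ K) :
    ∑ m ∈ S, ∑ n ∈ S, a m * a n * w m n ≤ K * ∑ m ∈ S, a m ^ 2 := by
  have h1 : ∑ m ∈ S, ∑ n ∈ S, a m * a n * w m n
      ≤ ∑ m ∈ S, ∑ n ∈ S, (a m ^ 2 * w m n / 2 + a n ^ 2 * w m n / 2) := by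
    refine Finset.sum_le_sum fun m _ => Finset.sum_le_sum fun n _ => ?_
    nlinarith [hw m n, mul_nonneg (sq_nonneg (a m - a n)) (hw m n)]
  have h2 : ∑ m ∈ S, ∑ n ∈ S, a n ^ 2 * w m n / 2 = ∑ m ∈ S, ∑ n ∈ S, a m ^ 2 * w m n / 2 := by
    rw [Finset.sum_comm]
    simp_rw [hsymm]
  simp_rw [Finset.sum_add_distrib] at h1
  rw [h2, ← Finset.sum_add_distrib] at h1
  refine h1.trans ?_
  rw [Finset.mul_sum]
  refine Finset.sum_le_sum fun m hm => ?_
  rw [← Finset.sum_add_distrib]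
  calc ∑ n ∈ S, (a m ^ 2 * w m n / 2 + a m ^ 2 * w m n / 2) = a m ^ 2 * ∑ n ∈ S, w m n := by
        rw [Finset.mul_sum]
        exact Finset.sum_congr rfl fun n _ => by ring
    _ ≤ K * a m ^ 2 := by
        rw [mul_comm]
        exact mul_le_mul_of_nonneg_right (hK m hm) (sq_nonneg _)

lemma sum_exp_neg_abs_sub_le {q : ℝ} (hq : 0 < q) (M m : ℕ) :
    ∑ n ∈ Finset.range M, Real.exp (-(q * |(m : ℝ) - n|)) ≤ 2 * (1 - Real.exp (-q))⁻¹ := by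
  have hr1 : Real.exp (-q) < 1 := by rw [Real.exp_lt_one_iff]; linarith
  have hr0 : 0 ≤ Real.exp (-q) := (Real.exp_pos _).le
  have hgeo : ∀ F : Finset ℕ, ∑ d ∈ F, Real.exp (-q) ^ d ≤ (1 - Real.exp (-q))⁻¹ := by
    intro F
    rw [← tsum_geometric_of_lt_one hr0 hr1]
    exact (summable_geometric_of_lt_one hr0 hr1).sum_le_tsum F (fun _ _ => by positivity)
  rw [← Finset.sum_filter_add_sum_filter_not _ (fun n => n ≤ m), two_mul]
  refine add_le_add ?_ ?_
  · have : ∑ n ∈ (Finset.range M).filter (fun n => n ≤ m), Real.exp (-(q * |(m : ℝ) - n|))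
        = ∑ d ∈ ((Finset.range M).filter (fun n => n ≤ m)).image (fun n => m - n),
          Real.exp (-q) ^ d := by
      rw [Finset.sum_image]
      · refine Finset.sum_congr rfl fun n hn => ?_
        have hnm := (Finset.mem_filter.mp hn).2
        rw [← Real.exp_nat_mul, Nat.cast_sub hnm, abs_of_nonneg (by
          have : (n : ℝ) ≤ m := by exact_mod_cast hnm
          linarith)]
        congr 1; ring
      · intro x hx y hy hxy
        have hx' := (Finset.mem_filter.mp (Finset.mem_coe.mp hx)).2
        have hy' := (Finset.mem_filter.mp (Finset.mem_coe.mp hy)).2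
        simp only at hxy
        omega
    rw [this]
    exact hgeo _
  · have : ∑ n ∈ (Finset.range M).filter (fun n => ¬ n ≤ m), Real.exp (-(q * |(m : ℝ) - n|))
        = ∑ d ∈ ((Finset.range M).filter (fun n => ¬ n ≤ m)).image (fun n => n - m),
          Real.exp (-q) ^ d := by
      rw [Finset.sum_image]
      · refine Finset.sum_congr rfl fun n hn => ?_
        have hnm := (not_le.mp (Finset.mem_filter.mp hn).2).le
        rw [← Real.exp_nat_mul, Nat.cast_sub hnm, abs_sub_comm, abs_of_nonneg (by
          have : (m : ℝ) ≤ n := by exact_mod_cast hnm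
          linarith)]
        congr 1; ring
      · intro x hx y hy hxy
        have hx' := (Finset.mem_filter.mp (Finset.mem_coe.mp hx)).2
        have hy' := (Finset.mem_filter.mp (Finset.mem_coe.mp hy)).2
        simp only at hxy
        omega
    rw [this]
    exact hgeo _

lemma abs_sub_div_le_abs_log_sub {M m n : ℕ} (hm : m < M) (hn : n < M) :
    |(m : ℝ) - n| / M ≤ |Real.log (m + 1) - Real.log (n + 1)| := by
  wlog h : n ≤ m generalizing m n
  · rw [abs_sub_comm, abs_sub_comm (Real.log _)]
    exact this hn hm (by omega)
  have h' : (n : ℝ) ≤ m := by exact_mod_cast h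
  have hm' : (m : ℝ) + 1 ≤ M := by exact_mod_cast hm
  have hn0 : (0 : ℝ) ≤ n := Nat.cast_nonneg n
  have hl : Real.log (n + 1) ≤ Real.log (m + 1) := Real.log_le_log (by linarith) (by linarith)
  rw [abs_of_nonneg (by linarith), abs_of_nonneg (by linarith),
    ← Real.log_div (by positivity) (by positivity)]
  have := Real.one_sub_inv_le_log_of_pos (x := ((m : ℝ) + 1) / (n + 1)) (by positivity)
  refine le_trans ?_ this
  rw [inv_div, one_sub_div (by positivity)]
  rw [show (m : ℝ) + 1 - (n + 1) = m - n by ring]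
  exact div_le_div_of_nonneg_left (by linarith) (by positivity) hm'

lemma exists_integral_dirichletPoly_le {σ₀ : ℝ} (hσ₀ : 1 / 2 < σ₀) :
    ∃ C : ℝ, 0 ≤ C ∧ ∀ (T σ : ℝ) (M : ℕ), 1 ≤ T → (M : ℝ) ≤ 11 * T → σ₀ ≤ σ →
      ∫ t in (-T)..T, ‖∑ n ∈ Finset.range M, (-1 : ℂ) ^ n * ((n : ℂ) + 1) ^ (-(σ + t * I : ℂ))‖ ^ 2
        ≤ C * T := by
  set q : ℝ := 1 / 484 with hq
  set K : ℝ := 2 * (1 - Real.exp (-q))⁻¹ with hK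
  have hr1 : Real.exp (-q) < 1 := by rw [Real.exp_lt_one_iff]; norm_num [hq]
  have hK0 : 0 ≤ K := by
    rw [hK]; exact mul_nonneg zero_le_two (inv_nonneg.mpr (by linarith))
  set Z : ℝ := ∑' n : ℕ, (((1 : ℕ) : ℝ) + n) ^ (-2 * σ₀) with hZ
  have hsumm := summable_add_rpow 1 (b := -2 * σ₀) (by linarith)
  have hZ0 : 0 ≤ Z := tsum_nonneg fun m => by positivity
  refine ⟨Real.exp 1 * (Real.sqrt Real.pi * (K * Z)), by positivity, ?_⟩
  intro T σ M hT hM hσ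
  have hT0 : 0 < T := by linarith
  set b : ℝ := 1 / T ^ 2 with hb
  have hb0 : 0 < b := by positivity
  set c : ℕ → ℂ := fun n => (-1 : ℂ) ^ n * ((n : ℂ) + 1) ^ (-(σ : ℂ)) with hc
  set l : ℕ → ℝ := fun n => -Real.log (n + 1) with hl
  have hterm : ∀ t : ℝ, ∑ n ∈ Finset.range M, (-1 : ℂ) ^ n * ((n : ℂ) + 1) ^ (-(σ + t * I : ℂ))
      = ∑ n ∈ Finset.range M, c n * cexp (l n * I * t) := by
    intro t
    refine Finset.sum_congr rfl fun n _ => ?_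
    have hn0 : ((n : ℂ) + 1) ≠ 0 := by exact_mod_cast n.succ_ne_zero
    have hlog : Complex.log ((n : ℂ) + 1) = (Real.log (n + 1) : ℝ) := by
      rw [Complex.ofReal_log (by positivity)]
      push_cast; rfl
    simp only [hc, hl]
    rw [neg_add, Complex.cpow_add _ _ hn0, Complex.cpow_def_of_ne_zero hn0 (-(t * I)), hlog]
    push_cast
    rw [mul_assoc]
    congr 3
    ring
  have hcont : Continuous (fun t : ℝ => ‖∑ n ∈ Finset.range M, c n * cexp (l n * I * t)‖ ^ 2) := by
    fun_prop
  have hnc : ∀ n, ‖c n‖ = (((1 : ℕ) : ℝ) + n) ^ (-σ) := by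
    intro n
    simp only [hc]
    rw [norm_mul, norm_pow, norm_neg, norm_one, one_pow, one_mul]
    have := Complex.norm_cpow_eq_rpow_re_of_pos (x := (n : ℝ) + 1) (by positivity) (-(σ : ℂ))
    push_cast at this
    rw [this]
    simp [add_comm]
  simp_rw [hterm]
  have hgi : MeasureTheory.Integrable
      (fun t : ℝ => Real.exp (-b * t ^ 2) * ‖∑ n ∈ Finset.range M, c n * cexp (l n * I * t)‖ ^ 2) := by
    refine ((integrable_exp_neg_mul_sq hb0).mul_const ((∑ n ∈ Finset.range M, ‖c n‖) ^ 2)).mono'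
      (by fun_prop) (Filter.Eventually.of_forall fun t => ?_)
    rw [Real.norm_eq_abs, abs_of_nonneg (by positivity)]
    refine mul_le_mul_of_nonneg_left (pow_le_pow_left₀ (norm_nonneg _) ?_ 2) (Real.exp_pos _).le
    refine norm_sum_le_of_le _ fun n _ => ?_
    rw [norm_mul, show (l n : ℂ) * I * t = ((l n * t : ℝ) : ℂ) * I by push_cast; ring,
      Complex.norm_exp_ofReal_mul_I, mul_one]
  have h1 : ∫ t in (-T)..T, ‖∑ n ∈ Finset.range M, c n * cexp (l n * I * t)‖ ^ 2
      ≤ Real.exp 1 * ∫ t : ℝ, Real.exp (-b * t ^ 2) *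
        ‖∑ n ∈ Finset.range M, c n * cexp (l n * I * t)‖ ^ 2 := by
    have ha : ∫ t in (-T)..T, ‖∑ n ∈ Finset.range M, c n * cexp (l n * I * t)‖ ^ 2
        ≤ ∫ t in (-T)..T, Real.exp 1 * (Real.exp (-b * t ^ 2) *
        ‖∑ n ∈ Finset.range M, c n * cexp (l n * I * t)‖ ^ 2) := by
      refine intervalIntegral.integral_mono_on (by linarith) (hcont.intervalIntegrable _ _)
        ((hgi.const_mul _).intervalIntegrable) ?_
      intro t ht
      rw [← mul_assoc, ← Real.exp_add]
      refine le_mul_of_one_le_left (by positivity) (Real.one_le_exp ?_)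
      have : t ^ 2 ≤ T ^ 2 := sq_le_sq' ht.1 ht.2
      have h2 : b * t ^ 2 ≤ 1 := by
        rw [hb, div_mul_eq_mul_div, one_mul, div_le_one (by positivity)]
        exact this
      linarith
    refine ha.trans ?_
    rw [intervalIntegral.integral_const_mul]
    refine mul_le_mul_of_nonneg_left ?_ (Real.exp_pos _).le
    rw [intervalIntegral.integral_of_le (by linarith)]
    exact MeasureTheory.setIntegral_le_integral hgi
      (Filter.Eventually.of_forall fun t => by positivity)
  refine h1.trans ?_
  rw [mul_assoc]
  refine mul_le_mul_of_nonneg_left ?_ (Real.exp_pos _).le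
  refine (integral_gauss_norm_sq_le hb0 _ c l).trans ?_
  have hsq : Real.sqrt (Real.pi / b) = Real.sqrt Real.pi * T := by
    rw [hb, div_div_eq_mul_div, div_one, Real.sqrt_mul Real.pi_pos.le, Real.sqrt_sq hT0.le]
  rw [hsq]
  have h2 := sum_sum_mul_le (Finset.range M) (fun n => ‖c n‖)
    (fun m n => Real.exp (-(l m - l n) ^ 2 / (4 * b))) K (fun _ _ => (Real.exp_pos _).le)
    (fun m n => by rw [← neg_sub (l n), neg_sq]) (by
      intro m hm
      refine (Finset.sum_le_sum fun n hn => ?_).trans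
        (sum_exp_neg_abs_sub_le (q := q) (by norm_num [hq]) M m)
      rw [Real.exp_le_exp, neg_div, neg_le_neg_iff]
      have hm' := Finset.mem_range.mp hm
      have hn' := Finset.mem_range.mp hn
      have hlog := abs_sub_div_le_abs_log_sub hm' hn'
      have hM0 : (0 : ℝ) < M := by exact_mod_cast (by omega : 0 < M)
      have e1 : (l m - l n) ^ 2 = |Real.log (m + 1) - Real.log (n + 1)| ^ 2 := by
        rw [sq_abs]; simp only [hl]; ring
      rw [e1]
      have e2 : (|(m : ℝ) - n| / M) ^ 2 ≤ |Real.log (m + 1) - Real.log (n + 1)| ^ 2 :=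
        pow_le_pow_left₀ (by positivity) hlog 2
      have e3 : |(m : ℝ) - n| ≤ |(m : ℝ) - n| ^ 2 := by
        rcases eq_or_ne m n with h | h
        · simp [h]
        · have : (1 : ℝ) ≤ |(m : ℝ) - n| := by
            have h' : (m : ℤ) - n ≠ 0 := by omega
            have := Int.one_le_abs h'
            exact_mod_cast this
          nlinarith
      have e4 : |(m : ℝ) - n| ^ 2 / (11 * T) ^ 2 ≤ (|(m : ℝ) - n| / M) ^ 2 := by
        rw [div_pow]
        exact div_le_div_of_nonneg_left (by positivity) (by positivity)
          (pow_le_pow_left₀ hM0.le hM 2)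
      calc q * |(m : ℝ) - n| ≤ q * |(m : ℝ) - n| ^ 2 := by
            exact mul_le_mul_of_nonneg_left e3 (by norm_num [hq])
        _ = (|(m : ℝ) - n| ^ 2 / (11 * T) ^ 2) / (4 * b) := by
            rw [hq, hb]; field_simp; norm_num; ring
        _ ≤ _ := by gcongr; exact e4.trans e2)
  have h3 : ∑ m ∈ Finset.range M, ‖c m‖ ^ 2 ≤ Z := by
    refine le_trans (Finset.sum_le_sum fun n _ => ?_)
      (hsumm.sum_le_tsum (Finset.range M) (fun _ _ => by positivity))
    rw [hnc, ← Real.rpow_natCast, ← Real.rpow_mul (by positivity)]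
    refine Real.rpow_le_rpow_of_exponent_le ?_ ?_
    · push_cast; linarith [(Nat.cast_nonneg n : (0 : ℝ) ≤ n)]
    · push_cast; linarith
  calc Real.sqrt Real.pi * T * ∑ m ∈ Finset.range M, ∑ n ∈ Finset.range M,
        ‖c m‖ * ‖c n‖ * Real.exp (-(l m - l n) ^ 2 / (4 * b))
      ≤ Real.sqrt Real.pi * T * (K * Z) := by
        refine mul_le_mul_of_nonneg_left ?_ (by positivity)
        exact h2.trans (mul_le_mul_of_nonneg_left h3 hK0)
    _ = _ := by ring

/-- Mean square of the alternating zeta function to the right of the critical line. -/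
lemma exists_integral_altZeta_le {σ₀ : ℝ} (hσ₀ : 1 / 2 < σ₀) :
    ∃ C : ℝ, 0 ≤ C ∧ ∀ T σ : ℝ, 1 ≤ T → σ₀ ≤ σ → σ ≤ 4 →
      ∫ t in (-T)..T, ‖altZeta (σ + t * I)‖ ^ 2 ≤ C * T := by
  obtain ⟨C1, hC1, h1⟩ := exists_integral_dirichletPoly_le hσ₀
  obtain ⟨C2, hC2, h2⟩ := exists_norm_altZeta_sub_le
  refine ⟨2 * C1 + 4 * C2 ^ 2, by positivity, ?_⟩
  intro T σ hT hσ hσ4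
  set M : ℕ := ⌈2 * (T + 4)⌉₊ with hM
  have hM1 : 2 * (T + 4) ≤ M := Nat.le_ceil _
  have hM2 : (M : ℝ) ≤ 11 * T := by
    have := (Nat.ceil_lt_add_one (by linarith : 0 ≤ 2 * (T + 4))).le
    rw [← hM] at this
    linarith
  have hM3 : 1 ≤ M := by
    have : (1 : ℝ) ≤ M := by linarith
    exact_mod_cast this
  set P : ℝ → ℂ := fun t =>
    ∑ n ∈ Finset.range M, (-1 : ℂ) ^ n * ((n : ℂ) + 1) ^ (-(σ + t * I : ℂ)) with hP
  have hPc : Continuous P := by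
    refine continuous_finsetSum _ fun n _ => continuous_const.mul ?_
    refine Continuous.const_cpow (by fun_prop) (Or.inl (by exact_mod_cast n.succ_ne_zero))
  have hac : Continuous (fun t : ℝ => altZeta (σ + t * I)) :=
    differentiable_altZeta.continuous.comp (by fun_prop)
  have hle : ∫ t in (-T)..T, ‖altZeta (σ + t * I)‖ ^ 2
      ≤ ∫ t in (-T)..T, (2 * ‖P t‖ ^ 2 + 2 * C2 ^ 2) := by
    refine intervalIntegral.integral_mono_on (by linarith)
      ((hac.norm.pow 2).intervalIntegrable _ _) ?_ ?_
    · exact Continuous.intervalIntegrable (by fun_prop) _ _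
    intro t ht
    have hn : ‖(σ + t * I : ℂ)‖ ≤ 4 + T := by
      refine (norm_add_le _ _).trans (add_le_add ?_ ?_)
      · rw [Complex.norm_real, Real.norm_eq_abs, abs_le]; constructor <;> linarith
      · rw [norm_mul, Complex.norm_I, mul_one, Complex.norm_real, Real.norm_eq_abs]
        exact abs_le.mpr ⟨ht.1, ht.2⟩
    have h3 := h2 M (σ + t * I) hM3 (by simp; linarith) (by linarith)
    have h4 : ‖altZeta (σ + t * I)‖ ≤ ‖P t‖ + C2 := by
      have := norm_sub_norm_le (altZeta (σ + t * I)) (P t)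
      linarith
    calc ‖altZeta (σ + t * I)‖ ^ 2 ≤ (‖P t‖ + C2) ^ 2 :=
          pow_le_pow_left₀ (norm_nonneg _) h4 2
      _ ≤ _ := by nlinarith [sq_nonneg (‖P t‖ - C2)]
  refine hle.trans ?_
  rw [intervalIntegral.integral_add (Continuous.intervalIntegrable (by fun_prop) _ _)
    (by simp), intervalIntegral.integral_const_mul, intervalIntegral.integral_const]
  have := h1 T σ M hT hM2 hσ
  simp only [smul_eq_mul]
  nlinarith

end FakeMu

namespace FakeMu

/-! ### Counting zeros through mean squares -/

lemma card_mul_log_le_circleAverage {F : ℂ → ℂ} {c : ℂ} {r R : ℝ} (hr : 0 < r) (hrR : r < R)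
    (hF : AnalyticOnNhd ℂ F (Metric.closedBall c R)) (hc : F c ≠ 0) (S : Finset ℂ)
    (hS : ∀ u ∈ S, F u = 0 ∧ ‖c - u‖ ≤ r) :
    S.card * Real.log (R / r) + Real.log ‖F c‖
      ≤ Real.circleAverage (fun z => ‖F z‖ ^ 2) c R := by
  have hR : 0 < R := hr.trans hrR
  have hF' : AnalyticOnNhd ℂ F (Metric.closedBall c |R|) := by rwa [abs_of_pos hR]
  have hJ := hF'.circleAverage_log_norm hR.ne' hc
  rw [abs_of_pos hR] at hJ
  set D := MeromorphicOn.divisor F (Metric.closedBall c R) with hD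
  have hfin : (Function.support D).Finite := D.finiteSupport (isCompact_closedBall c R)
  have hlogR : 0 < Real.log (R / r) := Real.log_pos (by rwa [one_lt_div hr])
  have hne : ∀ u ∈ Metric.closedBall c R, analyticOrderAt F u ≠ ⊤ := fun u hu =>
    hF.analyticOrderAt_ne_top_of_isPreconnected (convex_closedBall c R).isPreconnected
      (Metric.mem_closedBall_self hR.le) hu (by rw [analyticOrderAt_eq_zero.mpr (Or.inr hc)]; simp)
  have hnonneg : ∀ u, 0 ≤ (D u : ℝ) * Real.log (R * ‖c - u‖⁻¹) := by
    intro u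
    by_cases hu : u ∈ Metric.closedBall c R
    · refine mul_nonneg (by exact_mod_cast (MeromorphicOn.AnalyticOnNhd.divisor_nonneg hF) u) ?_
      rcases eq_or_ne u c with h | h
      · simp [h]
      · refine Real.log_nonneg ?_
        have : 0 < ‖c - u‖ := norm_pos_iff.mpr (sub_ne_zero.mpr h.symm)
        rw [← div_eq_mul_inv, one_le_div this, ← dist_eq_norm']
        exact hu
    · simp [hD, hu]
  have hsum : (S.card : ℝ) * Real.log (R / r) ≤ ∑ᶠ u, (D u : ℝ) * Real.log (R * ‖c - u‖⁻¹) := by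
    have hsupp : (Function.support fun u => (D u : ℝ) * Real.log (R * ‖c - u‖⁻¹))
        ⊆ ((hfin.toFinset ∪ S : Finset ℂ) : Set ℂ) := by
      intro u hu
      simp only [Function.mem_support, ne_eq, mul_eq_zero, not_or, Int.cast_eq_zero] at hu
      simp [hu.1]
    rw [finsum_eq_sum_of_support_subset _ hsupp]
    refine le_trans ?_ (Finset.sum_le_sum_of_subset_of_nonneg Finset.subset_union_right
      (fun u _ _ => hnonneg u))
    rw [← nsmul_eq_mul]
    refine Finset.card_nsmul_le_sum _ _ _ fun u hu => ?_
    obtain ⟨hu0, hur⟩ := hS u hu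
    have huB : u ∈ Metric.closedBall c R := by
      rw [Metric.mem_closedBall, dist_eq_norm']; linarith
    have hcu : 0 < ‖c - u‖ := by
      refine norm_pos_iff.mpr (sub_ne_zero.mpr ?_)
      rintro rfl
      exact hc hu0
    have h1 : (1 : ℝ) ≤ D u := by
      have h0 : analyticOrderAt F u ≠ 0 := (hF u huB).analyticOrderAt_ne_zero.mpr hu0
      obtain ⟨n, hn⟩ := ENat.ne_top_iff_exists.mp (hne u huB)
      have : D u = n := by
        rw [hD, MeromorphicOn.AnalyticOnNhd.divisor_apply hF huB, ← hn]
        simp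
      rw [this]
      rw [← hn] at h0
      have : n ≠ 0 := by simpa using h0
      exact_mod_cast Nat.one_le_iff_ne_zero.mpr this
    have h2 : Real.log (R / r) ≤ Real.log (R * ‖c - u‖⁻¹) := by
      rw [← div_eq_mul_inv]
      exact Real.log_le_log (by positivity) (div_le_div_of_nonneg_left hR.le hcu hur)
    nlinarith
  have hF2 : ContinuousOn (fun z => ‖F z‖ ^ 2) (Metric.sphere c R) :=
    ((hF.continuousOn.mono Metric.sphere_subset_closedBall).norm).pow 2
  have hmono : Real.circleAverage (Real.log ‖F ·‖) c R
      ≤ Real.circleAverage (fun z => ‖F z‖ ^ 2) c R := by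
    refine Real.circleAverage_mono ?_ (hF2.circleIntegrable hR.le) fun z _ => ?_
    · have := (hF'.mono Metric.sphere_subset_closedBall).meromorphicOn.circleIntegrable_log_norm
      exact this
    · rcases eq_or_ne (F z) 0 with h | h
      · simp [h]
      · have := Real.log_le_sub_one_of_pos (norm_pos_iff.mpr h)
        nlinarith [sq_nonneg (‖F z‖ - 1), norm_nonneg (F z)]
  linarith

set_option maxHeartbeats 1600000 in
/-- A function with bounded mean squares has `O(T)` zeros up to height `T`. -/
lemma exists_card_zeros_le {F : ℂ → ℂ} {σ₁ σ₀ c κ C₀ : ℝ} (h10 : σ₁ < σ₀) (h0c : σ₀ < c)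
    (hF : AnalyticOnNhd ℂ F {s | σ₁ < s.re}) (hκ : 0 < κ) (hFκ : ∀ t : ℝ, κ ≤ ‖F (c + t * I)‖)
    (hne : ∀ s : ℂ, c ≤ s.re → F s ≠ 0)
    (hms : ∀ T σ : ℝ, 1 ≤ T → (σ₁ + σ₀) / 2 ≤ σ → σ ≤ 2 * c - (σ₁ + σ₀) / 2 →
      ∫ t in (-T)..T, ‖F (σ + t * I)‖ ^ 2 ≤ C₀ * T) :
    ∃ C : ℝ, 0 ≤ C ∧ ∀ T : ℝ, 1 ≤ T → ∀ S : Finset ℂ,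
      (∀ s ∈ S, F s = 0 ∧ σ₀ ≤ s.re ∧ |s.im| ≤ T) → (S.card : ℝ) ≤ C * T := by
  set R : ℝ := c - (σ₁ + σ₀) / 2 with hR
  set r : ℝ := (R + (c - σ₀)) / 2 with hr
  have hd0 : 0 < c - σ₀ := by linarith
  have hr0 : 0 < r := by rw [hr, hR]; linarith
  have hrR : r < R := by rw [hr, hR]; linarith
  have hdr : c - σ₀ < r := by rw [hr, hR]; linarith
  have hR0 : 0 < R := hr0.trans hrR
  set w : ℝ := r - (c - σ₀) with hw
  have hw0 : 0 < w := by rw [hw]; linarith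
  set L : ℝ := Real.log (R / r) with hL
  have hL0 : 0 < L := Real.log_pos (by rwa [one_lt_div hr0])
  have hms0 : 0 ≤ C₀ := by
    have h := hms 1 c le_rfl (by linarith) (by linarith)
    have h' : 0 ≤ ∫ t in (-1 : ℝ)..1, ‖F (c + t * I)‖ ^ 2 :=
      intervalIntegral.integral_nonneg (by norm_num) (fun t _ => by positivity)
    linarith
  set C : ℝ := (|Real.log κ| * (2 * (1 + w)) + C₀ * (1 + w + R)) / (L * (2 * w)) with hC
  refine ⟨C, by positivity, ?_⟩
  intro T hT S hS
  set V : ℝ := T + w with hV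
  have hV0 : 0 < V := by linarith
  -- the function on the rectangle
  set G : ℝ → ℝ → ℝ := fun t θ => ‖F (circleMap (c + t * I) R θ)‖ ^ 2 with hG
  have hmaps : ∀ p : ℝ × ℝ, circleMap ((c : ℂ) + p.1 * I) R p.2 ∈ {s : ℂ | σ₁ < s.re} := by
    intro p
    have : R * |Real.cos p.2| ≤ R := by
      have := Real.abs_cos_le_one p.2
      nlinarith
    have h2 := neg_abs_le (Real.cos p.2)
    have hre : (circleMap ((c : ℂ) + p.1 * I) R p.2).re = c + R * Real.cos p.2 := by
      simp [circleMap, Complex.exp_ofReal_mul_I_re, Complex.exp_ofReal_mul_I_im]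
    simp only [Set.mem_ofPred_eq, hre]
    have : -R ≤ R * Real.cos p.2 := by nlinarith
    have : σ₁ < c - R := by rw [hR]; linarith
    linarith
  have hGc : Continuous (Function.uncurry G) := by
    have h1 : Continuous (fun p : ℝ × ℝ => circleMap ((c : ℂ) + p.1 * I) R p.2) := by
      simp only [circleMap]; fun_prop
    exact ((hF.continuousOn.comp_continuous h1 hmaps).norm).pow 2
  have hball : ∀ t : ℝ, AnalyticOnNhd ℂ F (Metric.closedBall (c + t * I) R) := by
    intro t
    refine hF.mono fun z hz => ?_
    rw [Metric.mem_closedBall, dist_eq_norm] at hz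
    have h1 := (Complex.abs_re_le_norm (z - (c + t * I))).trans hz
    simp only [Complex.sub_re, Complex.add_re, Complex.ofReal_re, Complex.mul_re, Complex.I_re,
      Complex.ofReal_im, Complex.I_im, mul_zero, zero_mul, sub_zero, add_zero] at h1
    have := (abs_le.mp h1).1
    have : σ₁ < c - R := by rw [hR]; linarith
    simp only [Set.mem_ofPred_eq]
    linarith
  set n : ℝ → ℝ := fun t => ∑ s ∈ S, Set.indicator (Set.Icc (s.im - w) (s.im + w)) (fun _ => (1 : ℝ)) t
    with hn
  have hpt : ∀ t : ℝ, n t * L ≤ |Real.log κ| + (2 * Real.pi)⁻¹ * ∫ θ in (0)..(2 * Real.pi), G t θ := by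
    intro t
    have hcard : n t = ((S.filter fun s => t ∈ Set.Icc (s.im - w) (s.im + w)).card : ℝ) := by
      simp only [hn, Set.indicator_apply]
      rw [Finset.sum_boole]
    have hj := card_mul_log_le_circleAverage (F := F) (c := c + t * I) hr0 hrR (hball t)
      (hne _ (by simp)) (S.filter fun s => t ∈ Set.Icc (s.im - w) (s.im + w)) (by
        intro s hs
        obtain ⟨hsS, hst⟩ := Finset.mem_filter.mp hs
        obtain ⟨h1, h2, h3⟩ := hS s hsS
        refine ⟨h1, ?_⟩
        have hsc : s.re < c := by
          by_contra h
          exact hne s (not_lt.mp h) h1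
        refine (Complex.norm_le_abs_re_add_abs_im _).trans ?_
        have e1 : |(c + t * I - s : ℂ).re| ≤ c - σ₀ := by
          simp only [Complex.sub_re, Complex.add_re, Complex.ofReal_re, Complex.mul_re,
            Complex.I_re, Complex.ofReal_im, Complex.I_im, mul_zero, zero_mul, sub_zero, add_zero]
          rw [abs_le]; constructor <;> linarith
        have e2 : |(c + t * I - s : ℂ).im| ≤ w := by
          simp only [Complex.sub_im, Complex.add_im, Complex.ofReal_re, Complex.mul_im,
            Complex.I_re, Complex.ofReal_im, Complex.I_im, mul_zero, mul_one, zero_add, add_zero]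
          rw [abs_le]; constructor <;> linarith [hst.1, hst.2]
        rw [hw] at e2
        linarith)
    rw [← hcard, Real.circleAverage_def, smul_eq_mul] at hj
    have h4 : Real.log κ ≤ Real.log ‖F (c + t * I)‖ := Real.log_le_log hκ (hFκ t)
    have := neg_abs_le (Real.log κ)
    linarith
  have hnint : ∫ t in (-V)..V, n t = 2 * w * S.card := by
    have hsub : ∀ s ∈ S, Set.Icc (s.im - w) (s.im + w) ⊆ Set.Icc (-V) V := by
      intro s hs
      have := abs_le.mp (hS s hs).2.2
      exact Set.Icc_subset_Icc (by linarith) (by linarith)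
    simp only [hn]
    rw [intervalIntegral.integral_of_le (by linarith), ← MeasureTheory.integral_Icc_eq_integral_Ioc,
      MeasureTheory.integral_finsetSum]
    · rw [Finset.sum_congr rfl (g := fun _ => 2 * w)]
      · simp; ring
      intro s hs
      rw [MeasureTheory.setIntegral_indicator measurableSet_Icc,
        Set.inter_eq_right.mpr (hsub s hs)]
      simp [hw0.le]
      ring
    · intro s _
      exact (MeasureTheory.integrable_indicator_iff measurableSet_Icc).mpr
        ((MeasureTheory.integrable_const _).integrableOn)
  have hni : IntervalIntegrable (fun t => n t * L) MeasureTheory.volume (-V) V := by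
    refine IntervalIntegrable.mul_const ?_ _
    have : n = ∑ s ∈ S, Set.indicator (Set.Icc (s.im - w) (s.im + w)) (fun _ => (1 : ℝ)) := by
      ext t; simp [hn]
    rw [this]
    refine IntervalIntegrable.sum _ fun s _ => ?_
    refine MeasureTheory.Integrable.intervalIntegrable ?_
    rw [MeasureTheory.integrable_indicator_iff measurableSet_Icc]
    simp
  have hGi : Continuous (fun t => ∫ θ in (0)..(2 * Real.pi), G t θ) :=
    intervalIntegral.continuous_parametric_intervalIntegral_of_continuous' hGc _ _
  have h_int := intervalIntegral.integral_mono_on (by linarith : -V ≤ V) hni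
    (Continuous.intervalIntegrable (by fun_prop) (-V) V) (fun t _ => hpt t)
  rw [intervalIntegral.integral_mul_const, hnint, intervalIntegral.integral_add (by simp)
    (Continuous.intervalIntegrable (by fun_prop) _ _), intervalIntegral.integral_const_mul,
    intervalIntegral.integral_const, smul_eq_mul,
    MeasureTheory.intervalIntegral_intervalIntegral_swap ?_] at h_int
  swap
  · refine (hGc.continuousOn.integrableOn_compact (K := Set.uIcc (-V) V ×ˢ Set.uIcc 0 (2 * Real.pi))
      (isCompact_uIcc.prod isCompact_uIcc)).mono_set ?_
    exact Set.prod_mono Set.uIoc_subset_uIcc Set.uIoc_subset_uIcc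
  have hθ : ∀ θ ∈ Set.Icc (0 : ℝ) (2 * Real.pi), ∫ t in (-V)..V, G t θ ≤ C₀ * (V + R) := by
    intro θ _
    set x : ℝ := R * Real.cos θ with hx
    set y : ℝ := R * Real.sin θ with hy
    have hxR : |x| ≤ R := by
      rw [hx, abs_mul, abs_of_pos hR0]
      nlinarith [Real.abs_cos_le_one θ]
    have hyR : |y| ≤ R := by
      rw [hy, abs_mul, abs_of_pos hR0]
      nlinarith [Real.abs_sin_le_one θ]
    have e1 : ∀ t : ℝ, G t θ = (fun u : ℝ => ‖F (((c + x : ℝ) : ℂ) + u * I)‖ ^ 2) (t + y) := by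
      intro t
      simp only [hG, circleMap, hx, hy]
      congr 3
      rw [Complex.exp_mul_I]
      push_cast
      ring
    simp_rw [e1]
    rw [intervalIntegral.integral_comp_add_right (fun u : ℝ => ‖F (((c + x : ℝ) : ℂ) + u * I)‖ ^ 2)]
    have hx' := abs_le.mp hxR
    have hy' := abs_le.mp hyR
    have hre : σ₁ < c + x := by
      have : σ₁ < c - R := by rw [hR]; linarith
      linarith
    have hcont : Continuous (fun u : ℝ => ‖F (((c + x : ℝ) : ℂ) + u * I)‖ ^ 2) := by
      refine ((hF.continuousOn.comp_continuous (by fun_prop) fun u => ?_).norm).pow 2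
      simpa using hre
    refine le_trans ?_ (hms (V + R) (c + x) (by linarith) (by linarith) (by linarith))
    refine intervalIntegral.integral_mono_interval (by linarith) (by linarith) (by linarith)
      (Filter.Eventually.of_forall fun u => by positivity) (hcont.intervalIntegrable _ _)
  have h5 : ∫ θ in (0)..(2 * Real.pi), ∫ t in (-V)..V, G t θ
      ≤ ∫ θ in (0)..(2 * Real.pi), C₀ * (V + R) := by
    refine intervalIntegral.integral_mono_on (by positivity) ?_ (by simp) hθ
    refine Continuous.intervalIntegrable ?_ _ _
    exact intervalIntegral.continuous_parametric_intervalIntegral_of_continuous'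
      (f := fun θ t => G t θ) (hGc.comp continuous_swap) _ _
  rw [intervalIntegral.integral_const, smul_eq_mul, sub_zero] at h5
  have h6 : (2 * Real.pi)⁻¹ * ∫ θ in (0)..(2 * Real.pi), ∫ t in (-V)..V, G t θ ≤ C₀ * (V + R) := by
    rw [inv_mul_le_iff₀ (by positivity)]
    exact h5
  rw [hC, div_mul_eq_mul_div, le_div_iff₀ (by positivity)]
  have h7 : V ≤ (1 + w) * T := by
    have := mul_le_mul_of_nonneg_left hT hw0.le
    linarith
  have h8 : V + R ≤ (1 + w + R) * T := by
    have := mul_le_mul_of_nonneg_left hT hR0.le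
    linarith
  have h9 := mul_le_mul_of_nonneg_left h7 (abs_nonneg (Real.log κ))
  have h10 := mul_le_mul_of_nonneg_left h8 hms0
  have e1 : (V - -V) * |Real.log κ| = 2 * (|Real.log κ| * V) := by ring
  have e2 : (S.card : ℝ) * (L * (2 * w)) = 2 * w * S.card * L := by ring
  have e3 : (|Real.log κ| * (2 * (1 + w)) + C₀ * (1 + w + R)) * T
    = 2 * (|Real.log κ| * ((1 + w) * T)) + C₀ * ((1 + w + R) * T) := by ring
  linarith

end FakeMu

namespace FakeMu

lemma norm_altZeta_sub_one_le {s : ℂ} (hs : 2 ≤ s.re) : ‖altZeta s - 1‖ ≤ 2 / 3 := by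
  have h := hasSum_altZeta (s := s) (by linarith)
  rw [← hasSum_nat_add_iff' 1] at h
  simp only [Finset.sum_range_one, pow_zero, Nat.cast_zero, zero_add, one_cpow, mul_one] at h
  have h2 := (hasSum_nat_add_iff' 2).mpr hasSum_zeta_two
  simp only [Finset.sum_range_succ, Finset.sum_range_zero] at h2
  have hpi : Real.pi ^ 2 / 6 - 1 ≤ 2 / 3 := by
    nlinarith [Real.pi_lt_d2, Real.pi_pos]
  refine (h.norm_le_of_bounded h2 fun n => ?_).trans (by norm_num; linarith)
  rw [norm_mul, norm_pow, norm_neg, norm_one, one_pow, one_mul]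
  have e : (((n + 1 : ℕ) : ℂ) + 1) = (((n + 2 : ℕ) : ℝ) : ℂ) := by push_cast; ring
  rw [e, Complex.norm_cpow_eq_rpow_re_of_pos (by positivity), neg_re, one_div, ← Real.rpow_natCast,
    ← Real.rpow_neg (by positivity)]
  refine Real.rpow_le_rpow_of_exponent_le (by norm_cast; omega) ?_
  push_cast
  linarith

lemma norm_altZeta_le {s : ℂ} (hs : 2 ≤ s.re) : ‖altZeta s‖ ≤ 2 := by
  have h := norm_altZeta_sub_one_le hs
  calc ‖altZeta s‖ = ‖(altZeta s - 1) + 1‖ := by ring_nf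
    _ ≤ ‖altZeta s - 1‖ + ‖(1 : ℂ)‖ := norm_add_le _ _
    _ ≤ 2 := by rw [norm_one]; linarith

lemma third_le_norm_altZeta {s : ℂ} (hs : 2 ≤ s.re) : 1 / 3 ≤ ‖altZeta s‖ := by
  have h := norm_altZeta_sub_one_le hs
  have : ‖(1 : ℂ)‖ ≤ ‖altZeta s‖ + ‖altZeta s - 1‖ := by
    calc ‖(1 : ℂ)‖ = ‖altZeta s - (altZeta s - 1)‖ := by ring_nf
      _ ≤ _ := norm_sub_le _ _
  rw [norm_one] at this
  linarith

lemma altZeta_ne_zero {s : ℂ} (hs : 2 ≤ s.re) : altZeta s ≠ 0 := by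
  intro h
  have := third_le_norm_altZeta hs
  rw [h, norm_zero] at this
  linarith

lemma exists_card_altZeta_zeros_le {σ₀ : ℝ} (h : 1 / 2 < σ₀) :
    ∃ C : ℝ, 0 ≤ C ∧ ∀ T : ℝ, 1 ≤ T → ∀ S : Finset ℂ,
      (∀ s ∈ S, altZeta s = 0 ∧ σ₀ ≤ s.re ∧ |s.im| ≤ T) → (S.card : ℝ) ≤ C * T := by
  wlog h2 : σ₀ < 2 generalizing σ₀
  · obtain ⟨C, hC, hC'⟩ := this (σ₀ := 1) (by norm_num) (by norm_num)
    exact ⟨C, hC, fun T hT S hS => hC' T hT S fun s hs =>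
      ⟨(hS s hs).1, by linarith [(hS s hs).2.1], (hS s hs).2.2⟩⟩
  obtain ⟨C₀, hC₀, hms⟩ := exists_integral_altZeta_le (σ₀ := (1 / 2 + σ₀) / 2) (by linarith)
  refine exists_card_zeros_le (σ₁ := 1 / 2) (c := 2) (κ := 1 / 3) (C₀ := C₀) h h2
    ((analyticOnNhd_univ_iff_differentiable.mpr differentiable_altZeta).mono (Set.subset_univ _)) (by norm_num) ?_ ?_ ?_
  · intro t
    exact third_le_norm_altZeta (by simp)
  · intro s hs
    exact altZeta_ne_zero hs
  · intro T σ hT h1 h2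
    exact hms T σ hT h1 (by linarith)

/-- A bounded analytic function on a half plane has `O(T)` zeros up to height `T`. -/
lemma exists_card_zeros_le_of_bounded {F : ℂ → ℂ} {σ₁ σ₀ c κ M : ℝ} (h10 : σ₁ < σ₀) (h0c : σ₀ < c)
    (hF : AnalyticOnNhd ℂ F {s | σ₁ < s.re}) (hκ : 0 < κ) (hFκ : ∀ s : ℂ, c ≤ s.re → κ ≤ ‖F s‖)
    (hM : ∀ s : ℂ, (σ₁ + σ₀) / 2 ≤ s.re → ‖F s‖ ≤ M) :
    ∃ C : ℝ, 0 ≤ C ∧ ∀ T : ℝ, 1 ≤ T → ∀ S : Finset ℂ,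
      (∀ s ∈ S, F s = 0 ∧ σ₀ ≤ s.re ∧ |s.im| ≤ T) → (S.card : ℝ) ≤ C * T := by
  refine exists_card_zeros_le (σ₁ := σ₁) (c := c) (κ := κ) (C₀ := M ^ 2 * 2) h10 h0c hF hκ ?_ ?_ ?_
  · intro t
    exact hFκ _ (by simp)
  · intro s hs h
    have := hFκ s hs
    rw [h, norm_zero] at this
    linarith
  · intro T σ hT h1 _
    have hb := intervalIntegral.norm_integral_le_of_norm_le_const (a := -T) (b := T)
      (f := fun t : ℝ => ‖F (σ + t * I)‖ ^ 2) (C := M ^ 2) fun t _ => by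
        rw [Real.norm_of_nonneg (by positivity)]
        exact pow_le_pow_left₀ (norm_nonneg _) (hM _ (by simpa using h1)) 2
    rw [sub_neg_eq_add, abs_of_nonneg (by linarith)] at hb
    calc _ ≤ _ := Real.le_norm_self _
      _ ≤ _ := hb
      _ = _ := by ring

end FakeMu

namespace FakeMu

lemma one_le_norm_Gamma_mul_cos {t : ℝ} (ht : 1 ≤ t) :
    1 ≤ ‖Gamma (1 - t * I)‖ * ‖Complex.cos (Real.pi * t / 2 * I)‖ := by
  have ht0 : (t : ℂ) * I ≠ 0 := by
    simp only [ne_eq, mul_eq_zero, I_ne_zero, or_false, ofReal_eq_zero]; linarith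
  have h1 : ‖Gamma (1 - t * I)‖ = t * ‖Gamma (t * I)‖ := by
    have : (1 - t * I : ℂ) = (starRingEnd ℂ) (t * I + 1) := by simp [sub_eq_add_neg, add_comm]
    rw [this, Gamma_conj, Complex.norm_conj, Gamma_add_one _ ht0, norm_mul, norm_mul, norm_I,
      mul_one, Complex.norm_real, Real.norm_of_nonneg (by linarith)]
  set y : ℝ := Real.pi * t / 2 with hy
  have hy0 : 0 < y := by have := Real.pi_pos; positivity
  have h2 : Gamma (t * I) * Gamma (1 - t * I) = Real.pi / Complex.sin (2 * (y * I)) := by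
    rw [Gamma_mul_Gamma_one_sub, hy]
    congr 2
    push_cast
    ring
  have hyc : (Real.pi * t / 2 * I : ℂ) = y * I := by rw [hy]; push_cast; ring
  rw [hyc]
  have hS : 0 < Real.sinh y := Real.sinh_pos_iff.mpr hy0
  have hC := Real.sinh_lt_cosh y
  have e1 : ‖Complex.sin (y * I)‖ = Real.sinh y := by
    rw [Complex.sin_mul_I, norm_mul, norm_I, mul_one, ← ofReal_sinh, Complex.norm_real,
      Real.norm_of_nonneg hS.le]
  have e2 : ‖Complex.cos (y * I)‖ = Real.cosh y := by
    rw [Complex.cos_mul_I, ← ofReal_cosh, Complex.norm_real,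
      Real.norm_of_nonneg (hS.trans hC).le]
  have h3 : ‖Gamma (t * I)‖ * ‖Gamma (1 - t * I)‖ = Real.pi / (2 * Real.sinh y * Real.cosh y) := by
    rw [← norm_mul, h2, Complex.sin_two_mul, norm_div, norm_mul, norm_mul, e1, e2,
      Complex.norm_real, Real.norm_of_nonneg Real.pi_pos.le]
    simp
  rw [e2]
  have h4 : (‖Gamma (1 - t * I)‖ * Real.cosh y) ^ 2
      = t * Real.pi / 2 * (Real.cosh y / Real.sinh y) := by
    have hC0 := hS.trans hC
    calc _ = t * (‖Gamma (t * I)‖ * ‖Gamma (1 - t * I)‖) * Real.cosh y ^ 2 := by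
          rw [mul_pow, ← mul_assoc, ← h1]; ring
      _ = _ := by rw [h3]; field_simp
  have h5 : (1 : ℝ) ≤ (‖Gamma (1 - t * I)‖ * Real.cosh y) ^ 2 := by
    rw [h4]
    have : 1 ≤ Real.cosh y / Real.sinh y := by rw [one_le_div hS]; exact hC.le
    have h6 : 1 ≤ t * Real.pi / 2 := by nlinarith [Real.pi_gt_three]
    exact one_le_mul_of_one_le_of_one_le h6 this
  exact (one_le_sq_iff₀ (mul_nonneg (norm_nonneg _) (hS.trans hC).le)).mp h5

lemma exists_le_norm_altZeta_neg_one :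
    ∃ c : ℝ, 0 < c ∧ ∀ t : ℝ, 1 ≤ t → c * t ≤ ‖altZeta (-1 + t * I)‖ := by
  refine ⟨3 * (2 * ((2 * Real.pi) ^ (-2 : ℝ)) * (2 / 9)), by positivity, fun t ht => ?_⟩
  set s : ℂ := 2 - t * I with hs
  have hsre : s.re = 2 := by simp [hs]
  have hs1 : s ≠ 1 := by intro h; rw [h] at hsre; norm_num at hsre
  have hfe := riemannZeta_one_sub (s := s) (fun n h => by
    rw [h] at hsre; simp at hsre
    have : (0 : ℝ) ≤ n := n.cast_nonneg
    linarith) hs1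
  have e1 : (1 - s) = -1 + t * I := by rw [hs]; ring
  have hne : (-1 + t * I : ℂ) ≠ 1 := by
    intro h
    have := congrArg Complex.re h
    simp at this
    norm_num at this
  have hz : 2 / 9 ≤ ‖riemannZeta s‖ := by
    have h1 := third_le_norm_altZeta (s := s) hsre.ge
    rw [altZeta_eq hs1, norm_mul] at h1
    have h2 : ‖(1 - 2 ^ (1 - s) : ℂ)‖ ≤ 3 / 2 := by
      refine (norm_sub_le _ _).trans ?_
      have := Complex.norm_cpow_eq_rpow_re_of_pos (x := 2) two_pos (1 - s)
      rw [show ((2 : ℝ) : ℂ) = 2 by norm_num] at this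
      rw [this, sub_re, hsre, norm_one, one_re]
      norm_num [Real.rpow_neg_one]
    nlinarith [norm_nonneg (riemannZeta s)]
  have hG : t ≤ ‖Gamma s‖ * ‖Complex.cos (Real.pi * s / 2)‖ := by
    have h1 := one_le_norm_Gamma_mul_cos ht
    have hn : (1 - t * I : ℂ) ≠ 0 := by
      intro h; have := congrArg Complex.re h; simp at this
    have h2 : Gamma s = (1 - t * I) * Gamma (1 - t * I) := by
      rw [← Gamma_add_one _ hn]; congr 1; rw [hs]; ring
    have h3 : Complex.cos (Real.pi * s / 2) = -Complex.cos (Real.pi * t / 2 * I) := by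
      rw [← Complex.cos_pi_sub]; congr 1; rw [hs]; ring
    rw [h2, h3, norm_neg, norm_mul, mul_assoc]
    have h4 : t ≤ ‖(1 - t * I : ℂ)‖ := by
      have := Complex.abs_im_le_norm (1 - t * I : ℂ)
      simp only [sub_im, one_im, mul_im, ofReal_re, I_im, mul_one, ofReal_im, I_re, mul_zero,
        add_zero, zero_sub, abs_neg] at this
      exact (le_abs_self t).trans this
    calc t = t * 1 := (mul_one t).symm
      _ ≤ _ := mul_le_mul h4 h1 zero_le_one (norm_nonneg _)
  have h2 : 3 ≤ ‖(1 - 2 ^ (1 - (-1 + t * I)) : ℂ)‖ := by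
    have h3 : ‖(2 : ℂ) ^ (1 - (-1 + t * I) : ℂ)‖ = 4 := by
      have := Complex.norm_cpow_eq_rpow_re_of_pos (x := 2) two_pos (1 - (-1 + t * I))
      rw [show ((2 : ℝ) : ℂ) = 2 by norm_num] at this
      rw [this]
      have : (1 - (-1 + t * I) : ℂ).re = 2 := by simp; norm_num
      rw [this]; norm_num
    have h4 := norm_sub_norm_le ((2 : ℂ) ^ (1 - (-1 + t * I) : ℂ)) 1
    rw [h3, norm_one, norm_sub_rev] at h4
    linarith
  rw [altZeta_eq hne, norm_mul, ← e1, hfe, norm_mul, norm_mul, norm_mul, norm_mul, e1]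
  have h5 : ‖(2 * Real.pi : ℂ) ^ (-s)‖ = (2 * Real.pi) ^ (-2 : ℝ) := by
    have := Complex.norm_cpow_eq_rpow_re_of_pos (x := 2 * Real.pi) (by positivity) (-s)
    push_cast at this
    rw [this, neg_re, hsre]
  rw [h5, Complex.norm_ofNat]
  have hp : (0 : ℝ) < (2 * Real.pi) ^ (-2 : ℝ) := by positivity
  calc _ = 3 * ((2 * (2 * Real.pi) ^ (-2 : ℝ)) * t * (2 / 9)) := by ring
    _ ≤ 3 * ((2 * (2 * Real.pi) ^ (-2 : ℝ)) * (‖Gamma s‖ * ‖Complex.cos (Real.pi * s / 2)‖)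
        * ‖riemannZeta s‖) := by gcongr
    _ ≤ ‖(1 - 2 ^ (1 - (-1 + t * I)) : ℂ)‖ * ((2 * (2 * Real.pi) ^ (-2 : ℝ))
        * (‖Gamma s‖ * ‖Complex.cos (Real.pi * s / 2)‖) * ‖riemannZeta s‖) := by gcongr
    _ = _ := by ring

end FakeMu

namespace FakeMu

/-- A form of the three circles theorem for functions with bounded real part. -/
lemma exists_norm_le_of_re_le {p w R A δ : ℝ} (hp : 0 < p) (hpw : p < w) (hwR : w < R)
    (hA : 0 < A) (hδ : 0 < δ) :
    ∃ ε : ℝ, 0 < ε ∧ ∀ q : ℂ → ℂ, DifferentiableOn ℂ q (Metric.ball 0 R) → q 0 = 0 →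
      (∀ z ∈ Metric.ball (0 : ℂ) R, (q z).re ≤ A) →
      (∀ z ∈ Metric.ball (0 : ℂ) p, (q z).re ≤ ε) → ‖q w‖ ≤ δ := by
  obtain ⟨R', hwR', hR'R⟩ := exists_between hwR
  have hw0 : 0 < w := hp.trans hpw
  have hR0 : 0 < R := hw0.trans hwR
  set l : ℝ := Real.log (p / 2) with hl
  set u : ℝ := Real.log R' with hu
  set x : ℝ := Real.log w with hx
  have hlx : l < x := Real.log_lt_log (by linarith) (by linarith)
  have hxu : x < u := Real.log_lt_log hw0 hwR'
  set θ : ℝ := (x - l) / (u - l) with hθ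
  have hθ1 : θ < 1 := by rw [hθ, div_lt_one (by linarith)]; linarith
  set M : ℝ := 2 * A * R' / (R - R') with hM
  have hM0 : 0 < M := div_pos (by nlinarith) (by linarith)
  have hlim : Filter.Tendsto (fun ε : ℝ => (2 * ε) ^ (1 - θ) * M ^ θ) (nhdsWithin 0 (Set.Ioi 0))
      (nhds 0) := by
    have h1 : ContinuousAt (fun ε : ℝ => (2 * ε) ^ (1 - θ) * M ^ θ) 0 := by
      refine ContinuousAt.mul ?_ continuousAt_const
      exact ContinuousAt.rpow_const (by fun_prop) (Or.inr (by linarith))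
    have h2 := h1.tendsto
    simp only [mul_zero, Real.zero_rpow (by linarith : 1 - θ ≠ 0), zero_mul] at h2
    exact h2.mono_left nhdsWithin_le_nhds
  obtain ⟨ε, hε1, hε0⟩ := ((hlim.eventually_lt_const hδ).and self_mem_nhdsWithin).exists
  have hε0 : 0 < ε := hε0
  refine ⟨ε, hε0, fun q hq hq0 hqA hqε => ?_⟩
  have hbig : ∀ z : ℂ, ‖z‖ ≤ R' → ‖q z‖ ≤ M := by
    intro z hz
    refine (Complex.borelCaratheodory_zero hA hq hqA hR0
      (by rw [mem_ball_zero_iff]; linarith) hq0).trans ?_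
    rw [hM]
    have : 0 < R - R' := by linarith
    have : 0 < R' := hw0.trans hwR'
    gcongr
  have hsmall : ∀ z : ℂ, ‖z‖ = p / 2 → ‖q z‖ ≤ 2 * ε := by
    intro z hz
    refine (Complex.borelCaratheodory_zero hε0 (hq.mono (Metric.ball_subset_ball (by linarith)))
      hqε hp (by rw [mem_ball_zero_iff]; linarith) hq0).trans (le_of_eq ?_)
    rw [hz]
    field_simp
    norm_num
  have hexp : ∀ z : ℂ, z.re ≤ u → ‖Complex.exp z‖ ≤ R' := by
    intro z hz
    rw [Complex.norm_exp, ← Real.exp_log (hw0.trans hwR')]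
    exact Real.exp_le_exp.mpr hz
  have h3 := HadamardThreeLines.norm_le_interp_of_mem_verticalClosedStrip' (f := fun z => q (Complex.exp z))
    (z := (x : ℂ)) (a := 2 * ε) (b := M) (l := l) (u := u) (hlx.trans hxu)
    ⟨by simpa using hlx.le, by simpa using hxu.le⟩ ?_ ?_ ?_ ?_
  · simp only [ofReal_re] at h3
    rw [← hθ, hx, ← Complex.ofReal_exp, Real.exp_log hw0] at h3
    exact h3.trans hε1.le
  · have hd : DifferentiableOn ℂ (fun z => q (Complex.exp z)) {z | z.re ≤ u} := by
      refine hq.comp Complex.differentiable_exp.differentiableOn fun z hz => ?_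
      rw [mem_ball_zero_iff]
      exact (hexp z hz).trans_lt hR'R
    refine DifferentiableOn.diffContOnCl (hd.mono ?_)
    refine (closure_minimal (t := {z : ℂ | z.re ≤ u}) ?_ ?_)
    · intro z hz
      exact hz.2.le
    · exact isClosed_le Complex.continuous_re continuous_const
  · refine ⟨M, ?_⟩
    rintro _ ⟨z, hz, rfl⟩
    exact hbig _ (hexp z hz.2)
  · intro z hz
    refine hsmall _ ?_
    rw [Complex.norm_exp, Set.mem_singleton_iff.mp hz, Real.exp_log (by linarith)]
  · intro z hz
    exact hbig _ (hexp z (Set.mem_singleton_iff.mp hz).le)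

/-- A zero free holomorphic function on a disc has a holomorphic logarithm. -/
lemma exists_log_on_ball {g : ℂ → ℂ} {R : ℝ} (hR : 0 < R)
    (hg : DifferentiableOn ℂ g (Metric.ball 0 R))
    (hne : ∀ z ∈ Metric.ball (0 : ℂ) R, g z ≠ 0) :
    ∃ L : ℂ → ℂ, DifferentiableOn ℂ L (Metric.ball 0 R) ∧ L 0 = 0 ∧
      ∀ z ∈ Metric.ball (0 : ℂ) R, g z = g 0 * Complex.exp (L z) := by
  have hd : DifferentiableOn ℂ (fun z => deriv g z / g z) (Metric.ball 0 R) :=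
    (hg.deriv Metric.isOpen_ball).div hg hne
  obtain ⟨L, hL0, hL⟩ := hd.isExactOn_ball.with_val_at 0 0
  refine ⟨L, fun z hz => (hL z hz).differentiableAt.differentiableWithinAt, hL0, ?_⟩
  have hgd : ∀ z ∈ Metric.ball (0 : ℂ) R, HasDerivAt g (deriv g z) z := fun z hz =>
    (hg.differentiableAt (Metric.isOpen_ball.mem_nhds hz)).hasDerivAt
  have hder : ∀ z ∈ Metric.ball (0 : ℂ) R,
      HasDerivAt (fun z => g z * Complex.exp (-L z)) 0 z := by
    intro z hz
    refine ((hgd z hz).mul (hL z hz).neg.cexp).congr_deriv ?_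
    have := hne z hz
    field_simp
    ring
  intro z hz
  have hc := (convex_ball (0 : ℂ) R).is_const_of_fderivWithin_eq_zero (𝕜 := ℂ)
    (f := fun z => g z * Complex.exp (-L z))
    (fun y hy => (hder y hy).differentiableAt.differentiableWithinAt)
    (fun y hy => by
      rw [fderivWithin_of_isOpen Metric.isOpen_ball hy]
      ext
      simp [(hder y hy).deriv])
    (Metric.mem_ball_self hR) hz
  simp only [hL0, neg_zero, Complex.exp_zero, mul_one] at hc
  rw [hc, mul_assoc, ← Complex.exp_add]
  simp

end FakeMu

namespace FakeMu

lemma re_add_mul_log (t b : ℝ) (z : ℂ) :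
    (3 + t * I + b * Complex.log (1 - z)).re = 3 + b * Real.log ‖1 - z‖ := by
  simp [Complex.log_re]

lemma im_add_mul_log (t b : ℝ) (z : ℂ) :
    (3 + t * I + b * Complex.log (1 - z)).im = t + b * Complex.arg (1 - z) := by
  simp [Complex.log_im]

lemma neg_div_le_log_norm {b k : ℝ} {z : ℂ} (hz : ‖z‖ < 1 - Real.exp (-k / b)) :
    -k / b ≤ Real.log ‖1 - z‖ := by
  have h1 : 1 - ‖z‖ ≤ ‖1 - z‖ := by
    have := norm_sub_norm_le (1 : ℂ) z
    rwa [norm_one] at this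
  rw [← Real.log_exp (-k / b)]
  exact Real.log_le_log (Real.exp_pos _) (by linarith)

/-- The imaginary parts of the zeros leave no gaps of fixed positive length. -/
lemma exists_zero_near {h : ℝ} (hh : 0 < h) :
    ∃ t₀ : ℝ, ∀ t : ℝ, t₀ ≤ t → ∃ s : ℂ, altZeta s = 0 ∧ |s.im - t| ≤ h := by
  set b : ℝ := 2 * h / Real.pi with hb
  have hπ := Real.pi_pos
  have hb0 : 0 < b := by positivity
  have hbh : b * (Real.pi / 2) = h := by rw [hb]; field_simp
  set E : ℝ → ℝ := fun k => 1 - Real.exp (-k / b) with hE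
  have hEmono : ∀ {j k : ℝ}, j < k → E j < E k := by
    intro j k hjk
    have : -k / b < -j / b := by gcongr
    have := Real.exp_lt_exp.mpr this
    simp only [hE]
    linarith
  have hE0 : E 0 = 0 := by simp [hE]
  have hE1 : ∀ k, E k < 1 := fun k => by
    have := Real.exp_pos (-k / b)
    simp only [hE]; linarith
  obtain ⟨ε, hε, hq⟩ := exists_norm_le_of_re_le (p := E 1) (w := E 4) (R := E 5) (A := 5)
    (δ := 1 / 2) (by rw [← hE0]; exact hEmono one_pos) (hEmono (by norm_num))
    (hEmono (by norm_num)) (by norm_num) (by norm_num)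
  have hR0 : 0 < E 5 := by rw [← hE0]; exact hEmono (by norm_num)
  obtain ⟨C, hC1, hC⟩ := exists_norm_altZeta_le
  obtain ⟨c, hc0, hc⟩ := exists_le_norm_altZeta_neg_one
  set K : ℝ := 5 + b + h with hK
  refine ⟨max (max (1 + K) (48 * C)) (max (4 / c ^ 2 + 1) (Real.exp (Real.log 6 / ε))), ?_⟩
  intro t ht
  simp only [max_le_iff] at ht
  obtain ⟨⟨ht1, ht2⟩, ht3, ht4⟩ := ht
  by_contra! hcon
  have ht6 : 6 ≤ t := by linarith
  have ht0 : 0 < t := by linarith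
  have hlogt : 0 < Real.log t := Real.log_pos (by linarith)
  have hlog6 : Real.log 6 ≤ ε * Real.log t := by
    have := Real.log_le_log (Real.exp_pos _) ht4
    rw [Real.log_exp, div_le_iff₀ hε] at this
    linarith
  set m : ℂ → ℂ := fun z => 3 + t * I + b * Complex.log (1 - z) with hm
  set g : ℂ → ℂ := fun z => altZeta (m z) with hg
  have hz1 : ∀ z ∈ Metric.ball (0 : ℂ) (E 5), 0 < (1 - z).re := by
    intro z hz
    rw [mem_ball_zero_iff] at hz
    have := (Complex.re_le_norm z)
    have := hE1 5
    simp only [sub_re, one_re]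
    linarith
  have him : ∀ z ∈ Metric.ball (0 : ℂ) (E 5), |(m z).im - t| ≤ h := by
    intro z hz
    rw [hm, im_add_mul_log, add_sub_cancel_left, abs_mul, abs_of_pos hb0, ← hbh]
    have := Complex.abs_arg_le_pi_div_two_iff.mpr (hz1 z hz).le
    gcongr
  have hre : ∀ z ∈ Metric.ball (0 : ℂ) (E 5), -2 ≤ (m z).re ∧ (m z).re ≤ 3 + b := by
    intro z hz
    have hz0 := hz1 z hz
    rw [mem_ball_zero_iff] at hz
    have h1 := neg_div_le_log_norm hz
    have h2 : Real.log ‖1 - z‖ ≤ 1 := by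
      have h3 : ‖1 - z‖ ≤ 2 := by
        refine (norm_sub_le _ _).trans ?_
        rw [norm_one]; linarith [hE1 5]
      have h4 : 0 < ‖1 - z‖ := norm_pos_iff.mpr (by rintro h; simp [h] at hz0)
      have := Real.log_le_sub_one_of_pos h4
      linarith
    rw [hm, re_add_mul_log]
    rw [div_le_iff₀ hb0] at h1
    constructor
    · linarith
    · nlinarith
  have hgd : DifferentiableOn ℂ g (Metric.ball 0 (E 5)) := by
    refine differentiable_altZeta.comp_differentiableOn ?_
    refine DifferentiableOn.const_add _ (DifferentiableOn.const_mul ?_ _)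
    exact DifferentiableOn.clog (by fun_prop) fun z hz => Or.inl (hz1 z hz)
  have hgne : ∀ z ∈ Metric.ball (0 : ℂ) (E 5), g z ≠ 0 := fun z hz h0 =>
    absurd (him z hz) (not_le.mpr (hcon _ h0))
  obtain ⟨L, hLd, hL0, hL⟩ := exists_log_on_ball hR0 hgd hgne
  have hg0 : 1 / 3 ≤ ‖g 0‖ := third_le_norm_altZeta (by simp [hm]; norm_num)
  have hg0' : ‖g 0‖ ≤ 2 := norm_altZeta_le (by simp [hm]; norm_num)
  have hLn : ∀ z ∈ Metric.ball (0 : ℂ) (E 5), ‖g z‖ = ‖g 0‖ * Real.exp (L z).re := by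
    intro z hz
    rw [hL z hz, norm_mul, Complex.norm_exp]
  have hLle : ∀ z ∈ Metric.ball (0 : ℂ) (E 5), ∀ B : ℝ, 0 < B → 3 * ‖g z‖ ≤ B →
      (L z).re ≤ Real.log B := by
    intro z hz B hB hgB
    rw [Real.le_log_iff_exp_le hB]
    have := hLn z hz
    have := Real.exp_pos (L z).re
    nlinarith
  set q : ℂ → ℂ := fun z => L z / (Real.log t : ℂ) with hqdef
  have hqre : ∀ z, (q z).re = (L z).re / Real.log t := fun z => by
    rw [hqdef, Complex.div_ofReal_re]
  have hfin := hq q (hLd.div_const _) (by simp [hqdef, hL0]) ?_ ?_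
  · have hw : ((E 4 : ℝ) : ℂ) ∈ Metric.ball (0 : ℂ) (E 5) := by
      have h40 : 0 < E 4 := by rw [← hE0]; exact hEmono (by norm_num)
      rw [mem_ball_zero_iff, Complex.norm_real, Real.norm_of_nonneg h40.le]
      exact hEmono (by norm_num)
    have h1 := (Complex.re_le_norm _).trans hfin
    rw [hqre, div_le_iff₀ hlogt] at h1
    have h2 : ‖g (E 4 : ℝ)‖ ≤ 2 * Real.sqrt t := by
      rw [hLn _ hw]
      have : Real.exp (L (E 4 : ℝ)).re ≤ Real.sqrt t := by
        refine (Real.exp_le_exp.mpr h1).trans (le_of_eq ?_)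
        rw [Real.sqrt_eq_rpow, Real.rpow_def_of_pos ht0]
        ring_nf
      gcongr
    have h3 : m (E 4 : ℝ) = -1 + t * I := by
      have e1 : (1 - ((E 4 : ℝ) : ℂ)) = ((Real.exp (-4 / b) : ℝ) : ℂ) := by
        simp only [hE]; push_cast; ring
      have e2 : Complex.log ((Real.exp (-4 / b) : ℝ) : ℂ) = ((-4 / b : ℝ) : ℂ) := by
        rw [← Complex.ofReal_log (Real.exp_pos _).le, Real.log_exp]
      have e3 : (b : ℂ) ≠ 0 := by exact_mod_cast hb0.ne'
      simp only [hm]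
      rw [e1, e2]
      push_cast
      field_simp
      ring
    have h4 : c * t ≤ 2 * Real.sqrt t := by
      refine (hc t (by linarith)).trans ?_
      rw [← h3]
      exact h2
    have h5 : c ^ 2 * t ≤ 4 := by
      have hs := Real.mul_self_sqrt ht0.le
      have hs0 : 0 < Real.sqrt t := Real.sqrt_pos.mpr ht0
      have h6 : c * Real.sqrt t ≤ 2 := by
        by_contra! h7
        nlinarith
      nlinarith [mul_nonneg hc0.le hs0.le]
    have h6 : 4 / c ^ 2 < t := by linarith
    rw [div_lt_iff₀ (by positivity)] at h6
    linarith
  · intro z hz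
    rw [hqre, div_le_iff₀ hlogt]
    have h1 : 5 * Real.log t = Real.log (t ^ 5) := by rw [Real.log_pow]; norm_num
    rw [h1]
    refine hLle z hz _ (by positivity) ?_
    have h2 : ‖m z‖ ≤ K + t := by
      refine (Complex.norm_le_abs_re_add_abs_im _).trans ?_
      have h3 := abs_le.mp (him z hz)
      have h4 := hre z hz
      have h5 : |(m z).re| ≤ 5 + b := by rw [abs_le]; constructor <;> linarith
      have h6 : |(m z).im| ≤ t + h := by rw [abs_le]; constructor <;> linarith
      linarith
    have h3 : ‖g z‖ ≤ C * (2 * t) ^ 4 := by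
      refine (hC _ (hre z hz).1).trans ?_
      have : 1 + ‖m z‖ ≤ 2 * t := by linarith
      gcongr
    calc 3 * ‖g z‖ ≤ 3 * (C * (2 * t) ^ 4) := by gcongr
      _ = (48 * C) * t ^ 4 := by ring
      _ ≤ t * t ^ 4 := by gcongr
      _ = t ^ 5 := by ring
  · intro z hz
    have hz' : z ∈ Metric.ball (0 : ℂ) (E 5) :=
      Metric.ball_subset_ball (hEmono (by norm_num)).le hz
    rw [hqre, div_le_iff₀ hlogt]
    refine le_trans (hLle z hz' 6 (by norm_num) ?_) hlog6
    have : ‖g z‖ ≤ 2 := by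
      refine norm_altZeta_le ?_
      rw [mem_ball_zero_iff] at hz
      have h1 := neg_div_le_log_norm hz
      rw [div_le_iff₀ hb0] at h1
      rw [hm, re_add_mul_log]
      linarith
    linarith

end FakeMu

namespace FakeMu

lemma altZeta_eq_zero {s : ℂ} (hs : s.im ≠ 0) (h : riemannZeta s = 0) : altZeta s = 0 := by
  rw [altZeta_eq (by rintro rfl; simp at hs), h, mul_zero]

lemma riemannZeta_eq_zero {s : ℂ} (hs : s.re ≠ 1) (h : altZeta s = 0) : riemannZeta s = 0 := by
  rw [altZeta_eq (by rintro rfl; simp at hs)] at h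
  refine (mul_eq_zero.mp h).resolve_left fun h1 => hs ?_
  have h2 : ‖(2 : ℂ) ^ (1 - s)‖ = 1 := by rw [← sub_eq_zero.mp h1, norm_one]
  have h3 := Complex.norm_cpow_eq_rpow_re_of_pos (x := 2) two_pos (1 - s)
  rw [show ((2 : ℝ) : ℂ) = 2 by norm_num, h2] at h3
  have h4 := congrArg Real.log h3
  rw [Real.log_one, Real.log_rpow two_pos] at h4
  have h5 := (mul_eq_zero.mp h4.symm).resolve_right (Real.log_pos one_lt_two).ne'
  rw [sub_re, one_re] at h5
  linarith

/-- Nonreal zeros of zeta are symmetric about the critical line. -/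
lemma riemannZeta_one_sub_conj_eq_zero {s : ℂ} (hs : s.im ≠ 0) (h : riemannZeta s = 0) :
    riemannZeta (1 - (starRingEnd ℂ) s) = 0 := by
  have h1 : riemannZeta (1 - s) = 0 := by
    rw [riemannZeta_one_sub (fun n hn => hs (by rw [hn]; simp)) (by rintro rfl; simp at hs), h,
      mul_zero]
  have h2 : (1 - (starRingEnd ℂ) s) = (starRingEnd ℂ) (1 - s) := by simp
  rw [h2, riemannZeta_conj, h1, map_zero]

/-- If every candidate fails, every zero of `altZeta` produces an exceptional zero. -/
lemma exists_exceptional {ℓ : ℕ} (hℓ : 1 ≤ ℓ) {U : ℂ → ℂ}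
    (hbad : ∀ s : ℂ, s.im ≠ 0 → 1 / (2 * ℓ : ℝ) ≤ s.re → riemannZeta (ℓ * s) = 0 →
      (∀ j ∈ Finset.Icc 1 (2 * ℓ), j ≠ ℓ → riemannZeta (j * s) ≠ 0) → U s = 0)
    {z : ℂ} (hz : altZeta z = 0) (hzi : 1 ≤ z.im) :
    (∃ w : ℂ, U w = 0 ∧ 1 / (2 * ℓ : ℝ) ≤ w.re ∧ w.im = z.im / ℓ) ∨
    ∃ j ∈ Finset.Icc 1 (2 * ℓ), ∃ w : ℂ, altZeta w = 0 ∧ 1 / 2 + 1 / (4 * ℓ : ℝ) ≤ w.re ∧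
      w.im = j * (z.im / ℓ) := by
  have hℓ' : (1 : ℝ) ≤ ℓ := by exact_mod_cast hℓ
  have hℓ0 : (ℓ : ℝ) ≠ 0 := by positivity
  set δ : ℝ := 1 / (4 * ℓ : ℝ) with hδ
  have hδℓ : δ * ℓ = 1 / 4 := by rw [hδ]; field_simp
  have hδ0 : 0 < δ := by positivity
  have hδ1 : δ ≤ 1 / 4 := by nlinarith
  have hℓmem : ℓ ∈ Finset.Icc 1 (2 * ℓ) := Finset.mem_Icc.mpr ⟨hℓ, by omega⟩
  have himℓ : z.im = ℓ * (z.im / ℓ) := by field_simp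
  rcases le_or_gt (1 / 2 + δ) z.re with hA | hA
  · exact Or.inr ⟨ℓ, hℓmem, z, hz, hA, himℓ⟩
  have hζ : riemannZeta z = 0 := riemannZeta_eq_zero (by linarith) hz
  have hzi0 : z.im ≠ 0 := by linarith
  have hζ' := riemannZeta_one_sub_conj_eq_zero hzi0 hζ
  rcases le_or_gt z.re (1 / 2 - δ) with hB | hB
  · refine Or.inr ⟨ℓ, hℓmem, 1 - (starRingEnd ℂ) z, altZeta_eq_zero (by simpa using hzi0) hζ',
      by simp; linarith, by simpa using himℓ⟩
  obtain ⟨r, hr0, hri, hr1, hr2⟩ : ∃ r : ℂ, riemannZeta r = 0 ∧ r.im = z.im ∧ 1 / 2 ≤ r.re ∧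
      r.re < 1 / 2 + δ := by
    rcases le_or_gt (1 / 2) z.re with h | h
    · exact ⟨z, hζ, rfl, h, hA⟩
    · exact ⟨1 - (starRingEnd ℂ) z, hζ', by simp, by simp; linarith, by simp; linarith⟩
  have hℓC : (ℓ : ℂ) ≠ 0 := by exact_mod_cast hℓ0
  set s : ℂ := r / ℓ with hs
  have hsre : s.re = r.re / ℓ := by rw [hs, Complex.div_natCast_re]
  have hsim : s.im = z.im / ℓ := by rw [hs, Complex.div_natCast_im, hri]
  have hsi0 : 0 < s.im := by rw [hsim]; positivity
  have hsα : 1 / (2 * ℓ : ℝ) ≤ s.re := by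
    rw [hsre, div_le_div_iff₀ (by positivity) (by positivity)]
    nlinarith
  have hℓs : riemannZeta (ℓ * s) = 0 := by
    rw [hs, mul_div_cancel₀ _ hℓC]
    exact hr0
  by_cases hU : U s = 0
  · exact Or.inl ⟨s, hU, hsα, hsim⟩
  have hnot := mt (hbad s hsi0.ne' hsα hℓs) hU
  push Not at hnot
  obtain ⟨j, hj, hjℓ, hjs⟩ := hnot
  have hj1 : 1 ≤ j := (Finset.mem_Icc.mp hj).1
  have hjR : (1 : ℝ) ≤ j := by exact_mod_cast hj1
  have hjim : (j * s : ℂ).im = j * (z.im / ℓ) := by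
    simp [hsim]
  have hjre : (j * s : ℂ).re * ℓ = j * r.re := by
    have : (j * s : ℂ).re = j * s.re := by simp
    rw [this, hsre]; field_simp
  have hjim0 : (j * s : ℂ).im ≠ 0 := by
    rw [hjim, ← hsim]; positivity
  refine Or.inr ⟨j, hj, ?_⟩
  rcases lt_or_gt_of_ne hjℓ with h | h
  · have h' : (j : ℝ) + 1 ≤ ℓ := by exact_mod_cast h
    refine ⟨1 - (starRingEnd ℂ) (j * s), altZeta_eq_zero (by rwa [sub_im, one_im, conj_im, zero_sub, neg_neg])
      (riemannZeta_one_sub_conj_eq_zero hjim0 hjs), ?_, ?_⟩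
    · rw [sub_re, one_re, conj_re]
      have : (j * s : ℂ).re * ℓ ≤ (1 / 2 - δ) * ℓ := by
        rw [hjre]
        nlinarith
      have := le_of_mul_le_mul_right this (by linarith)
      linarith
    · rw [sub_im, one_im, conj_im, zero_sub, neg_neg, hjim]
  · have h' : (ℓ : ℝ) + 1 ≤ j := by exact_mod_cast h
    refine ⟨j * s, altZeta_eq_zero hjim0 hjs, ?_, hjim⟩
    have : (1 / 2 + δ) * ℓ ≤ (j * s : ℂ).re * ℓ := by
      rw [hjre]
      nlinarith
    exact le_of_mul_le_mul_right this (by linarith)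

end FakeMu

namespace FakeMu

/-- There is a nonreal zero of `ζ(ℓ s)` at which the remaining factors do not vanish. -/
lemma exists_good_zero {ℓ : ℕ} (hℓ : 1 ≤ ℓ) {U : ℂ → ℂ}
    (hU : ∃ C : ℝ, 0 ≤ C ∧ ∀ T : ℝ, 1 ≤ T → ∀ S : Finset ℂ,
      (∀ s ∈ S, U s = 0 ∧ 1 / (2 * ℓ : ℝ) ≤ s.re ∧ |s.im| ≤ T) → (S.card : ℝ) ≤ C * T) :
    ∃ s : ℂ, s.im ≠ 0 ∧ 1 / (2 * ℓ : ℝ) ≤ s.re ∧ riemannZeta (ℓ * s) = 0 ∧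
      (∀ j ∈ Finset.Icc 1 (2 * ℓ), j ≠ ℓ → riemannZeta (j * s) ≠ 0) ∧ U s ≠ 0 := by
  by_contra! hbad
  have hℓ' : (1 : ℝ) ≤ ℓ := by exact_mod_cast hℓ
  obtain ⟨C₁, hC₁, hU⟩ := hU
  obtain ⟨C₂, hC₂, hη⟩ := exists_card_altZeta_zeros_le (σ₀ := 1 / 2 + 1 / (4 * ℓ : ℝ))
    (by have : 0 < 1 / (4 * ℓ : ℝ) := by positivity
        linarith)
  set C : ℝ := C₁ + 2 * ℓ * C₂ with hC
  have hC0 : 0 ≤ C := by positivity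
  set h : ℝ := 1 / (12 * (C + 1)) with hh
  have hh0 : 0 < h := by positivity
  have hhC : 6 * h * C ≤ 1 / 2 := by
    rw [hh]
    have : 6 * (1 / (12 * (C + 1))) * C = (1 / 2) * (C / (C + 1)) := by field_simp; ring
    rw [this]
    have : C / (C + 1) ≤ 1 := by rw [div_le_one (by positivity)]; linarith
    linarith
  obtain ⟨t₁, ht₁⟩ := exists_zero_near hh0
  set t₀ : ℝ := max t₁ (1 + h) with ht₀
  have ht₀1 : 1 + h ≤ t₀ := le_max_right _ _
  have hz : ∀ n : ℕ, ∃ s : ℂ, altZeta s = 0 ∧ |s.im - (t₀ + 3 * h * n)| ≤ h := fun n =>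
    ht₁ _ ((le_max_left _ _).trans (by
      have : (0 : ℝ) ≤ 3 * h * n := by positivity
      linarith))
  choose z hz0 hzi using hz
  have hzmono : StrictMono fun n => (z n).im := by
    refine strictMono_nat_of_lt_succ fun n => ?_
    have h1 := abs_le.mp (hzi n)
    have h2 := abs_le.mp (hzi (n + 1))
    push_cast at h2
    linarith
  have hz1 : ∀ n, 1 ≤ (z n).im := fun n => by
    have h1 := abs_le.mp (hzi n)
    have : (0 : ℝ) ≤ 3 * h * n := by positivity
    linarith
  have hexc : ∀ n, ∃ j ∈ Finset.range (2 * ℓ + 1), ∃ w : ℂ,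
      (j = 0 ∧ U w = 0 ∧ 1 / (2 * ℓ : ℝ) ≤ w.re ∧ w.im = (z n).im / ℓ) ∨
      (j ≠ 0 ∧ altZeta w = 0 ∧ 1 / 2 + 1 / (4 * ℓ : ℝ) ≤ w.re ∧ w.im = j * ((z n).im / ℓ)) := by
    intro n
    rcases exists_exceptional hℓ (U := U) hbad (hz0 n) (hz1 n) with ⟨w, hw⟩ | ⟨j, hj, w, hw⟩
    · exact ⟨0, by simp, w, Or.inl ⟨rfl, hw⟩⟩
    · rw [Finset.mem_Icc] at hj
      exact ⟨j, by simp; omega, w, Or.inr ⟨by omega, hw⟩⟩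
  choose j hj w hw using hexc
  have hinj : ∀ m n : ℕ, j m = j n → w m = w n → m = n := by
    intro m n hjmn hwmn
    refine hzmono.injective ?_
    show (z m).im = (z n).im
    have hℓ0 : (ℓ : ℝ) ≠ 0 := by positivity
    rcases hw m with ⟨h1, -, -, h2⟩ | ⟨h1, -, -, h2⟩ <;>
      rcases hw n with ⟨h3, -, -, h4⟩ | ⟨h3, -, -, h4⟩
    · rw [hwmn, h4] at h2
      exact ((div_left_inj' hℓ0).mp h2).symm
    · exact absurd (hjmn ▸ h1) h3
    · exact absurd (hjmn ▸ h3) h1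
    · rw [hwmn, h4, hjmn] at h2
      have : (j n : ℝ) ≠ 0 := by exact_mod_cast h3
      exact ((div_left_inj' hℓ0).mp (mul_left_cancel₀ this h2)).symm
  have hcount : ∀ N : ℕ, (N : ℝ) ≤ C * (2 * (t₀ + 3 * h * N + h)) := by
    intro N
    set T : ℝ := 2 * (t₀ + 3 * h * N + h) with hT
    have hhN : 0 ≤ 3 * h * N := by positivity
    have hT1 : 1 ≤ T := by linarith
    have him : ∀ n < N, |(w n).im| ≤ T := by
      intro n hn
      have h1 := abs_le.mp (hzi n)
      have hn' : (n : ℝ) ≤ N := by exact_mod_cast hn.le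
      have hb : (z n).im ≤ t₀ + 3 * h * N + h := by
        have : 3 * h * n ≤ 3 * h * N := by gcongr
        linarith
      have hzn := hz1 n
      rcases hw n with ⟨h1, -, -, h2⟩ | ⟨h1, -, -, h2⟩
      · rw [h2, abs_of_nonneg (by positivity), div_le_iff₀ (by linarith)]
        nlinarith
      · rw [h2, abs_of_nonneg (by positivity), mul_div_assoc', div_le_iff₀ (by linarith)]
        have hj2 : (j n : ℝ) ≤ 2 * ℓ := by
          have := Finset.mem_range.mp (hj n)
          exact_mod_cast Nat.lt_succ_iff.mp this
        calc (j n : ℝ) * (z n).im ≤ 2 * ℓ * (t₀ + 3 * h * N + h) := by gcongr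
          _ = T * ℓ := by rw [hT]; ring
    have hcard := Finset.card_eq_sum_card_fiberwise (s := Finset.range N)
      (t := Finset.range (2 * ℓ + 1)) (f := j) (fun n _ => hj n)
    have himg : ∀ i, ((Finset.range N).filter fun n => j n = i).card
        = (((Finset.range N).filter fun n => j n = i).image w).card := by
      intro i
      refine (Finset.card_image_of_injOn ?_).symm
      intro m hm n hn hmn
      simp only [Finset.coe_filter, Set.mem_ofPred_eq] at hm hn
      exact hinj m n (hm.2.trans hn.2.symm) hmn
    rw [Finset.card_range, Finset.sum_range_succ'] at hcard
    have h0 : (((Finset.range N).filter fun n => j n = 0).card : ℝ) ≤ C₁ * T := by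
      rw [himg]
      refine hU T hT1 _ fun s hs => ?_
      obtain ⟨n, hn, rfl⟩ := Finset.mem_image.mp hs
      obtain ⟨hnN, hjn⟩ := Finset.mem_filter.mp hn
      rcases hw n with ⟨-, h2, h3, -⟩ | ⟨h1, -⟩
      · exact ⟨h2, h3, him n (Finset.mem_range.mp hnN)⟩
      · exact absurd hjn h1
    have hi : ∀ i ∈ Finset.range (2 * ℓ),
        (((Finset.range N).filter fun n => j n = i + 1).card : ℝ) ≤ C₂ * T := by
      intro i _
      rw [himg]
      refine hη T hT1 _ fun s hs => ?_
      obtain ⟨n, hn, rfl⟩ := Finset.mem_image.mp hs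
      obtain ⟨hnN, hjn⟩ := Finset.mem_filter.mp hn
      rcases hw n with ⟨h1, -⟩ | ⟨-, h2, h3, -⟩
      · omega
      · exact ⟨h2, h3, him n (Finset.mem_range.mp hnN)⟩
    have hsum := Finset.sum_le_sum hi
    rw [Finset.sum_const, Finset.card_range, nsmul_eq_mul] at hsum
    have hcard' : (N : ℝ) = ∑ i ∈ Finset.range (2 * ℓ),
        (((Finset.range N).filter fun n => j n = i + 1).card : ℝ)
        + (((Finset.range N).filter fun n => j n = 0).card : ℝ) := by exact_mod_cast hcard
    rw [hcard', hC]
    push_cast at hsum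
    linarith
  obtain ⟨N, hN⟩ := exists_nat_gt (4 * C * (t₀ + h))
  have h1 := hcount N
  have h2 : C * (2 * (t₀ + 3 * h * N + h)) = 2 * C * (t₀ + h) + 6 * h * C * N := by ring
  have h3 : 6 * h * C * N ≤ 1 / 2 * N := by gcongr
  linarith

end FakeMu

namespace FakeMu

/-- The tail `∑_{j ≥ J} v_{j - J} p^{-js}` of a local factor. -/
noncomputable def localTail (v : ℕ → ℝ) (J p : ℕ) (s : ℂ) : ℂ :=
  ∑' j : ℕ, (v j : ℂ) * (p : ℂ) ^ (-((j + J : ℕ) : ℂ) * s)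

/-- The Euler product with local factors `1 + localTail v J p`. -/
noncomputable def eulerTail (v : ℕ → ℝ) (J : ℕ) (s : ℂ) : ℂ :=
  ∏' p : Nat.Primes, (1 + localTail v J p s)

lemma summable_rpow_mul_pow {A B r : ℝ} (J : ℕ) (hA : 0 < A) (hr : 0 < r) (hr1 : r < 1)
    (hJ : 1 ≤ J) : Summable fun j : ℕ => (A * ((j + J : ℕ) : ℝ)) ^ B * r ^ j := by
  have h1 := summable_pow_mul_geometric_of_norm_lt_one (R := ℝ) ⌈B⌉₊ (r := r)
    (by rwa [Real.norm_of_nonneg hr.le])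
  have h2 := ((summable_nat_add_iff J).mpr h1).mul_left (A ^ B * r⁻¹ ^ J)
  refine Summable.of_nonneg_of_le (fun j => by positivity) (fun j => ?_) h2
  have h3 : (1 : ℝ) ≤ ((j + J : ℕ) : ℝ) := by exact_mod_cast (by omega)
  rw [Real.mul_rpow hA.le (by positivity), pow_add r j J]
  have h4 : ((j + J : ℕ) : ℝ) ^ B ≤ ((j + J : ℕ) : ℝ) ^ ⌈B⌉₊ := by
    rw [← Real.rpow_natCast]
    exact Real.rpow_le_rpow_of_exponent_le h3 (Nat.le_ceil B)
  have h5 : r⁻¹ ^ J * r ^ J = 1 := by rw [← mul_pow, inv_mul_cancel₀ hr.ne', one_pow]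
  calc A ^ B * ((j + J : ℕ) : ℝ) ^ B * r ^ j
      ≤ A ^ B * ((j + J : ℕ) : ℝ) ^ ⌈B⌉₊ * r ^ j := by gcongr
    _ = A ^ B * ((j + J : ℕ) : ℝ) ^ ⌈B⌉₊ * r ^ j * (r⁻¹ ^ J * r ^ J) := by rw [h5, mul_one]
    _ = _ := by ring

variable {v : ℕ → ℝ} {J : ℕ} {A B : ℝ}

lemma norm_localTail_term_le (hA : 0 < A)
    (hv : ∀ j, |v j| ≤ (A * ((j + J : ℕ) : ℝ)) ^ B) {σ₀ : ℝ} (hσ : 0 < σ₀) {s : ℂ}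
    (hs : σ₀ ≤ s.re) {p : ℕ} (hp : 2 ≤ p) (j : ℕ) :
    ‖(v j : ℂ) * (p : ℂ) ^ (-((j + J : ℕ) : ℂ) * s)‖
      ≤ (A * ((j + J : ℕ) : ℝ)) ^ B * ((2 : ℝ) ^ (-σ₀)) ^ j * (p : ℝ) ^ (-(J * s.re)) := by
  have hp0 : (0 : ℝ) < p := by positivity
  have hp2 : (2 : ℝ) ≤ p := by exact_mod_cast hp
  have e1 : ‖(p : ℂ) ^ (-((j + J : ℕ) : ℂ) * s)‖ = (p : ℝ) ^ (-(j * s.re)) * (p : ℝ) ^ (-(J * s.re)) := by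
    have := Complex.norm_cpow_eq_rpow_re_of_pos hp0 (-((j + J : ℕ) : ℂ) * s)
    rw [Complex.ofReal_natCast] at this
    rw [this, ← Real.rpow_add hp0]
    congr 1
    have : (-((j + J : ℕ) : ℂ) * s) = ((-((j + J : ℕ) : ℝ) : ℝ) : ℂ) * s := by push_cast; ring
    rw [this, Complex.re_ofReal_mul]
    push_cast
    ring
  have e2 : (p : ℝ) ^ (-(j * s.re)) ≤ ((2 : ℝ) ^ (-σ₀)) ^ j := by
    rw [← Real.rpow_natCast, ← Real.rpow_mul (by norm_num)]
    have h1 : -(j * s.re) ≤ -σ₀ * j := by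
      have : (j : ℝ) * σ₀ ≤ j * s.re := by gcongr
      linarith
    calc (p : ℝ) ^ (-(j * s.re)) ≤ (p : ℝ) ^ (-σ₀ * j) :=
          Real.rpow_le_rpow_of_exponent_le (by linarith) h1
      _ ≤ (2 : ℝ) ^ (-σ₀ * j) := Real.rpow_le_rpow_of_nonpos (by norm_num) hp2 (by
          have : 0 ≤ σ₀ * j := by positivity
          linarith)
  rw [norm_mul, e1, Complex.norm_real, Real.norm_eq_abs, ← mul_assoc]
  have := hv j
  gcongr

lemma two_rpow_neg_lt_one {σ₀ : ℝ} (hσ : 0 < σ₀) : (2 : ℝ) ^ (-σ₀) < 1 :=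
  Real.rpow_lt_one_of_one_lt_of_neg one_lt_two (by linarith)

lemma exists_norm_localTail_le (hA : 0 < A) (hJ : 1 ≤ J)
    (hv : ∀ j, |v j| ≤ (A * ((j + J : ℕ) : ℝ)) ^ B) {σ₀ : ℝ} (hσ : 0 < σ₀) :
    ∃ K : ℝ, 0 ≤ K ∧ ∀ s : ℂ, σ₀ ≤ s.re → ∀ p : ℕ, 2 ≤ p →
      ‖localTail v J p s‖ ≤ K * (p : ℝ) ^ (-(J * s.re)) := by
  have hsum := summable_rpow_mul_pow (A := A) (B := B) (r := (2 : ℝ) ^ (-σ₀)) J hA (by positivity)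
    (two_rpow_neg_lt_one hσ) hJ
  refine ⟨∑' j : ℕ, (A * ((j + J : ℕ) : ℝ)) ^ B * ((2 : ℝ) ^ (-σ₀)) ^ j,
    tsum_nonneg fun j => by positivity, fun s hs p hp => ?_⟩
  exact tsum_of_norm_bounded (hsum.hasSum.mul_right _) (norm_localTail_term_le hA hv hσ hs hp)

lemma differentiableOn_localTail (hA : 0 < A) (hJ : 1 ≤ J)
    (hv : ∀ j, |v j| ≤ (A * ((j + J : ℕ) : ℝ)) ^ B) {σ₀ : ℝ} (hσ : 0 < σ₀) {p : ℕ} (hp : 2 ≤ p) :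
    DifferentiableOn ℂ (localTail v J p) {s | σ₀ < s.re} := by
  have hsum := summable_rpow_mul_pow (A := A) (B := B) (r := (2 : ℝ) ^ (-σ₀)) J hA (by positivity)
    (two_rpow_neg_lt_one hσ) hJ
  refine differentiableOn_tsum_of_summable_norm hsum (fun j => ?_)
    (isOpen_lt continuous_const Complex.continuous_re) (fun j s hs => ?_)
  · refine Differentiable.differentiableOn fun s => ?_
    refine DifferentiableAt.const_mul (DifferentiableAt.const_cpow (by fun_prop) (Or.inl ?_)) _
    exact_mod_cast (by omega : p ≠ 0)
  · have hs' : σ₀ < s.re := hs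
    refine (norm_localTail_term_le hA hv hσ hs'.le hp j).trans ?_
    have : (p : ℝ) ^ (-(J * s.re)) ≤ 1 := by
      refine Real.rpow_le_one_of_one_le_of_nonpos (by exact_mod_cast (by omega : 1 ≤ p)) ?_
      have : 0 ≤ J * s.re := mul_nonneg (by positivity) (by linarith)
      linarith
    exact mul_le_of_le_one_right (by positivity) this

lemma summable_localTail (hA : 0 < A) (hJ : 1 ≤ J)
    (hv : ∀ j, |v j| ≤ (A * ((j + J : ℕ) : ℝ)) ^ B) {s : ℂ} (hs : 1 < J * s.re) :
    Summable fun p : Nat.Primes => localTail v J p s := by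
  have hs0 : 0 < s.re := by
    have : (0 : ℝ) < J := by positivity
    by_contra! h
    nlinarith
  obtain ⟨K, _, hK⟩ := exists_norm_localTail_le hA hJ hv hs0
  exact Summable.of_norm_bounded ((Nat.Primes.summable_rpow.mpr (by linarith)).mul_left K)
    fun p => hK s le_rfl p p.2.two_le

lemma differentiableOn_eulerTail (hA : 0 < A) (hJ : 1 ≤ J)
    (hv : ∀ j, |v j| ≤ (A * ((j + J : ℕ) : ℝ)) ^ B) :
    DifferentiableOn ℂ (eulerTail v J) {s | 1 / (J : ℝ) < s.re} := by
  intro s hs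
  obtain ⟨σ₀, h1, h2⟩ := exists_between (show 1 / (J : ℝ) < s.re from hs)
  have hJ0 : (0 : ℝ) < J := by positivity
  have hσ : 0 < σ₀ := lt_trans (by positivity) h1
  have hJσ : 1 < J * σ₀ := by rwa [div_lt_iff₀' hJ0] at h1
  have hopen : IsOpen {s : ℂ | σ₀ < s.re} := isOpen_lt continuous_const Complex.continuous_re
  obtain ⟨K, hK0, hK⟩ := exists_norm_localTail_le hA hJ hv hσ
  have hprod := Summable.hasProdLocallyUniformlyOn_one_add
    (f := fun (p : Nat.Primes) s => localTail v J p s)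
    hopen ((Nat.Primes.summable_rpow.mpr (by linarith : -(J * σ₀) < -1)).mul_left K)
    (Filter.Eventually.of_forall fun p s hs => by
      have hs' : σ₀ < s.re := hs
      refine (hK s hs'.le p p.2.two_le).trans ?_
      have hp1 : (1 : ℝ) ≤ (p : ℕ) := by exact_mod_cast p.2.one_le
      have : -(J * s.re) ≤ -(J * σ₀) := by
        have : J * σ₀ ≤ J * s.re := by gcongr
        linarith
      gcongr)
    (fun p => (differentiableOn_localTail hA hJ hv hσ p.2.two_le).continuousOn)
  have hd : DifferentiableOn ℂ (eulerTail v J) {s | σ₀ < s.re} := by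
    refine TendstoLocallyUniformlyOn.differentiableOn
      (hasProdLocallyUniformlyOn_iff_tendstoLocallyUniformlyOn.mp hprod)
      (Filter.Eventually.of_forall fun S => ?_) hopen
    refine DifferentiableOn.fun_finsetProd fun p _ => ?_
    exact (differentiableOn_localTail hA hJ hv hσ p.2.two_le).const_add _
  exact (hd.differentiableAt (hopen.mem_nhds h2)).differentiableWithinAt

lemma norm_tprod_one_add_sub_one_le {ι : Type*} {f : ι → ℂ} {u : ι → ℝ} (hu : Summable u)
    (hf : ∀ i, ‖f i‖ ≤ u i) : ‖∏' i, (1 + f i) - 1‖ ≤ Real.exp (∑' i, u i) - 1 := by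
  have hm := (Complex.multipliable_one_add_of_summable (Summable.of_norm_bounded hu hf)).hasProd
  refine le_of_tendsto (hm.sub_const 1).norm (Filter.Eventually.of_forall fun S => ?_)
  refine (Finset.norm_prod_one_add_sub_one_le S f).trans ?_
  have : ∑ i ∈ S, ‖f i‖ ≤ ∑' i, u i :=
    (Finset.sum_le_sum fun i _ => hf i).trans
      (hu.sum_le_tsum S fun i _ => (norm_nonneg _).trans (hf i))
  gcongr

lemma exists_norm_eulerTail_le (hA : 0 < A) (hJ : 1 ≤ J)
    (hv : ∀ j, |v j| ≤ (A * ((j + J : ℕ) : ℝ)) ^ B) {σ₀ : ℝ} (hσ : 1 / (J : ℝ) < σ₀) :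
    (∃ M : ℝ, ∀ s : ℂ, σ₀ ≤ s.re → ‖eulerTail v J s‖ ≤ M) ∧
    ∃ c : ℝ, ∀ s : ℂ, c ≤ s.re → 1 / 2 ≤ ‖eulerTail v J s‖ := by
  have hJ0 : (0 : ℝ) < J := by positivity
  have hσ0 : 0 < σ₀ := lt_trans (by positivity) hσ
  have hJσ : 1 < J * σ₀ := by rwa [div_lt_iff₀' hJ0] at hσ
  obtain ⟨K, hK0, hK⟩ := exists_norm_localTail_le hA hJ hv hσ0
  have hsum := Nat.Primes.summable_rpow.mpr (by linarith : -(J * σ₀) < -1)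
  set Z : ℝ := ∑' p : Nat.Primes, (p : ℝ) ^ (-(J * σ₀)) with hZ
  have hmain : ∀ d : ℝ, 0 ≤ d → ∀ s : ℂ, σ₀ + d ≤ s.re →
      ‖eulerTail v J s - 1‖ ≤ Real.exp (K * (2 : ℝ) ^ (-d) * Z) - 1 := by
    intro d hd s hs
    have h1 := hsum.mul_left (K * (2 : ℝ) ^ (-d))
    rw [hZ, ← tsum_mul_left]
    refine norm_tprod_one_add_sub_one_le h1 fun p => ?_
    refine (hK s (by linarith) p p.2.two_le).trans ?_
    rw [mul_assoc]
    have hp1 : (1 : ℝ) ≤ (p : ℕ) := by exact_mod_cast p.2.one_le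
    have hp2 : (2 : ℝ) ≤ (p : ℕ) := by exact_mod_cast p.2.two_le
    have hJ1 : (1 : ℝ) ≤ J := by exact_mod_cast hJ
    have h2 : ((p : ℕ) : ℝ) ^ (-(J * s.re)) ≤ (2 : ℝ) ^ (-d) * ((p : ℕ) : ℝ) ^ (-(J * σ₀)) := by
      calc ((p : ℕ) : ℝ) ^ (-(J * s.re)) ≤ ((p : ℕ) : ℝ) ^ (-d + -(J * σ₀)) := by
            refine Real.rpow_le_rpow_of_exponent_le hp1 ?_
            have h3 : J * (σ₀ + d) ≤ J * s.re := by gcongr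
            nlinarith
        _ = ((p : ℕ) : ℝ) ^ (-d) * ((p : ℕ) : ℝ) ^ (-(J * σ₀)) := Real.rpow_add (by linarith) _ _
        _ ≤ _ := by
            have := Real.rpow_le_rpow_of_nonpos (by norm_num) hp2 (by linarith : -d ≤ 0)
            gcongr
    gcongr
  constructor
  · refine ⟨Real.exp (K * (2 : ℝ) ^ (-(0 : ℝ)) * Z), fun s hs => ?_⟩
    have h1 := hmain 0 le_rfl s (by linarith)
    have h2 : ‖eulerTail v J s‖ ≤ ‖eulerTail v J s - 1‖ + ‖(1 : ℂ)‖ := by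
      simpa using norm_add_le (eulerTail v J s - 1) 1
    rw [norm_one] at h2
    linarith
  · have hlim : Filter.Tendsto (fun d : ℝ => Real.exp (K * (2 : ℝ) ^ (-d) * Z) - 1) Filter.atTop
        (nhds 0) := by
      have h1 : Filter.Tendsto (fun d : ℝ => (2 : ℝ) ^ (-d)) Filter.atTop (nhds 0) :=
        (tendsto_rpow_atBot_of_base_gt_one 2 one_lt_two).comp Filter.tendsto_neg_atTop_atBot
      have h2 := ((Real.continuous_exp.tendsto _).comp ((h1.const_mul K).mul_const Z)).sub_const 1
      simpa using h2
    obtain ⟨d, hd, hd0⟩ := ((hlim.eventually_le_const (by norm_num : (0 : ℝ) < 1 / 2)).and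
      (Filter.eventually_ge_atTop 0)).exists
    refine ⟨σ₀ + d, fun s hs => ?_⟩
    have h1 := hmain d hd0 s hs
    have h2 : ‖(1 : ℂ)‖ ≤ ‖eulerTail v J s‖ + ‖eulerTail v J s - 1‖ := by
      simpa using norm_sub_le (eulerTail v J s) (eulerTail v J s - 1)
    rw [norm_one] at h2
    linarith

lemma eulerTail_conj (hA : 0 < A) (hJ : 1 ≤ J)
    (hv : ∀ j, |v j| ≤ (A * ((j + J : ℕ) : ℝ)) ^ B) {s : ℂ} (hs : 1 / (J : ℝ) < s.re) :
    eulerTail v J ((starRingEnd ℂ) s) = (starRingEnd ℂ) (eulerTail v J s) := by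
  have hJ0 : (0 : ℝ) < J := by positivity
  have hm := Complex.multipliable_one_add_of_summable (summable_localTail hA hJ hv
    (by rwa [div_lt_iff₀' hJ0] at hs))
  rw [eulerTail, eulerTail, hm.map_tprod (starRingEnd ℂ) Complex.continuous_conj]
  refine tprod_congr fun p => ?_
  rw [map_add, map_one, localTail, localTail, Complex.conj_tsum]
  congr 1
  refine tsum_congr fun j => ?_
  have hp : ((p : ℕ) : ℂ).arg ≠ Real.pi := by
    rw [Complex.natCast_arg]; exact Real.pi_ne_zero.symm
  rw [map_mul, Complex.conj_ofReal]
  congr 1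
  have h := Complex.cpow_conj ((p : ℕ) : ℂ) (-((j + J : ℕ) : ℂ) * s) hp
  rw [Complex.conj_natCast, map_mul, map_neg, Complex.conj_natCast] at h
  exact h

end FakeMu

namespace FakeMu

lemma exists_card_eulerTail_zeros_le {v : ℕ → ℝ} {J : ℕ} {A B : ℝ} (hA : 0 < A) (hJ : 1 ≤ J)
    (hv : ∀ j, |v j| ≤ (A * ((j + J : ℕ) : ℝ)) ^ B) {σ₀ : ℝ} (hσ : 1 / (J : ℝ) < σ₀) :
    ∃ C : ℝ, 0 ≤ C ∧ ∀ T : ℝ, 1 ≤ T → ∀ S : Finset ℂ,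
      (∀ s ∈ S, eulerTail v J s = 0 ∧ σ₀ ≤ s.re ∧ |s.im| ≤ T) → (S.card : ℝ) ≤ C * T := by
  obtain ⟨⟨M, hM⟩, -⟩ := exists_norm_eulerTail_le hA hJ hv
    (show 1 / (J : ℝ) < (1 / (J : ℝ) + σ₀) / 2 by linarith)
  obtain ⟨-, c, hc⟩ := exists_norm_eulerTail_le hA hJ hv hσ
  refine exists_card_zeros_le_of_bounded (c := max c (σ₀ + 1)) (κ := 1 / 2) (M := M) hσ
    (lt_of_lt_of_le (lt_add_one _) (le_max_right _ _)) ?_ (by norm_num)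
    (fun s hs => hc s ((le_max_left _ _).trans hs)) hM
  exact (differentiableOn_eulerTail hA hJ hv).analyticOnNhd
    (isOpen_lt continuous_const Complex.continuous_re)

lemma abs_le_one_of_multiplicative {f ε : ℕ → ℤ} (hf1 : f 1 = 1)
    (hmul : ∀ m n : ℕ, Nat.Coprime m n → f (m * n) = f m * f n)
    (hεval : ∀ j : ℕ, 1 ≤ j → ε j = -1 ∨ ε j = 0 ∨ ε j = 1)
    (hfp : ∀ p : ℕ, Nat.Prime p → ∀ j : ℕ, 1 ≤ j → f (p ^ j) = ε j) {n : ℕ} (hn : n ≠ 0) :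
    |f n| ≤ 1 := by
  induction n using Nat.recOnPosPrimePosCoprime with
  | prime_pow p n hp hk =>
    rw [hfp p hp n hk]
    rcases hεval n hk with h | h | h <;> simp [h]
  | zero => exact absurd rfl hn
  | one => simp [hf1]
  | coprime a b ha hb hab iha ihb =>
    rw [hmul a b hab, abs_mul]
    exact mul_le_one₀ (iha (by omega)) (abs_nonneg _) (ihb (by omega))

end FakeMu

namespace FakeMu

open MeasureTheory ProbabilityTheory Filter Topology

/-- Landau's lemma: the Laplace transform of a positive measure has a singularity at its abscissa
of convergence. -/
lemma exists_lt_mem_integrableExpSet {Ω : Type*} [MeasurableSpace Ω] {ν : Measure Ω} {X : Ω → ℝ}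
    (hX : ∀ᵐ ω ∂ν, X ω ≤ 0) {b : ℝ} (hb : Set.Ioi b ⊆ integrableExpSet X ν)
    {G : ℂ → ℂ} (hG : AnalyticAt ℂ G b)
    (hGX : ∀ᶠ s : ℂ in 𝓝 (b : ℂ), b < s.re → G s = complexMGF X ν s) :
    ∃ a < b, a ∈ integrableExpSet X ν := by
  have h_int : Set.Ioi b ⊆ interior (integrableExpSet X ν) := interior_maximal hb isOpen_Ioi
  obtain ⟨R, hR, hball⟩ := Metric.eventually_nhds_iff_ball.1
    (hG.eventually_analyticAt.and hGX)
  set d : ℝ := R / 2 with hd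
  have hd0 : 0 < d := by positivity
  set c : ℝ := b + d / 2 with hc
  set a : ℝ := b - d / 4 with ha
  have hcb : b < c := by linarith
  refine ⟨a, by linarith, ?_⟩
  have hsub : Metric.ball (c : ℂ) d ⊆ Metric.ball (b : ℂ) R := by
    refine Metric.ball_subset_ball' ?_
    rw [Complex.dist_of_im_eq (by simp), Complex.ofReal_re, Complex.ofReal_re, Real.dist_eq,
      hc, add_sub_cancel_left, abs_of_pos (by positivity)]
    linarith
  have hdiff : DifferentiableOn ℂ G (Metric.ball (c : ℂ) d) := fun z hz =>
    (hball z (hsub hz)).1.differentiableAt.differentiableWithinAt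
  have haball : (a : ℂ) ∈ Metric.ball (c : ℂ) d := by
    rw [Metric.mem_ball, Complex.dist_of_im_eq (by simp), Complex.ofReal_re, Complex.ofReal_re,
      Real.dist_eq, abs_lt]
    constructor <;> simp only [ha, hc] <;> linarith
  have hsum := Complex.hasSum_taylorSeries_on_ball hdiff haball
  have hder : ∀ n, iteratedDeriv n G (c : ℂ) = ((∫ ω, X ω ^ n * Real.exp (c * X ω) ∂ν : ℝ) : ℂ) := by
    intro n
    have h1 : G =ᶠ[𝓝 (c : ℂ)] complexMGF X ν := by
      have h2 : ∀ᶠ s : ℂ in 𝓝 (c : ℂ), b < s.re :=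
        (isOpen_lt continuous_const Complex.continuous_re).mem_nhds (by simpa using hcb)
      filter_upwards [h2, Metric.ball_mem_nhds (c : ℂ) hd0] with s h2 h3
      exact (hball s (hsub h3)).2 h2
    rw [h1.iteratedDeriv_eq, iteratedDeriv_complexMGF (h_int (by simpa using hcb)),
      ← integral_complex_ofReal]
    simp
  have hterm : ∀ n : ℕ, ((n.factorial : ℂ)⁻¹ • ((a : ℂ) - c) ^ n • iteratedDeriv n G (c : ℂ)) =
      ((∫ ω, (n.factorial : ℝ)⁻¹ * ((a - c) * X ω) ^ n * Real.exp (c * X ω) ∂ν : ℝ) : ℂ) := by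
    intro n
    rw [hder]
    have : ∀ ω, (n.factorial : ℝ)⁻¹ * ((a - c) * X ω) ^ n * Real.exp (c * X ω) =
        ((n.factorial : ℝ)⁻¹ * (a - c) ^ n) * (X ω ^ n * Real.exp (c * X ω)) := fun ω => by
      rw [mul_pow]; ring
    simp_rw [this, integral_const_mul]
    push_cast
    simp only [smul_eq_mul]
    ring
  simp_rw [hterm] at hsum
  have hsum' := (Complex.hasSum_re hsum).summable
  simp only [Complex.ofReal_re] at hsum'
  have hac : a - c < 0 := by linarith
  have hpos : ∀ n : ℕ, ∀ᵐ ω ∂ν,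
      0 ≤ (n.factorial : ℝ)⁻¹ * ((a - c) * X ω) ^ n * Real.exp (c * X ω) := by
    intro n
    filter_upwards [hX] with ω hω
    have := mul_nonneg_of_nonpos_of_nonpos hac.le hω
    positivity
  have hInt : ∀ n : ℕ, Integrable
      (fun ω => (n.factorial : ℝ)⁻¹ * ((a - c) * X ω) ^ n * Real.exp (c * X ω)) ν := by
    intro n
    have := (integrable_pow_mul_exp_of_mem_interior_integrableExpSet (h_int hcb) n).const_mul
      ((n.factorial : ℝ)⁻¹ * (a - c) ^ n)
    refine this.congr (Eventually.of_forall fun ω => ?_)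
    simp only [mul_pow]
    ring
  have hXm : AEMeasurable X ν := aemeasurable_of_mem_interior_integrableExpSet (h_int hcb)
  have hexp : ∀ ω, HasSum (fun n : ℕ => (n.factorial : ℝ)⁻¹ * ((a - c) * X ω) ^ n *
      Real.exp (c * X ω)) (Real.exp (a * X ω)) := by
    intro ω
    have h := (NormedSpace.expSeries_div_hasSum_exp ((a - c) * X ω)).mul_right (Real.exp (c * X ω))
    rw [← Real.exp_eq_exp_ℝ, ← Real.exp_add] at h
    rw [show (a - c) * X ω + c * X ω = a * X ω by ring] at h
    simpa only [div_eq_inv_mul] using h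
  refine ⟨((hXm.const_mul a).exp).aestronglyMeasurable, ?_⟩
  rw [hasFiniteIntegral_iff_ofReal (Eventually.of_forall fun ω => (Real.exp_pos _).le)]
  have h1 : ∫⁻ ω, ENNReal.ofReal (Real.exp (a * X ω)) ∂ν =
      ∫⁻ ω, ∑' n : ℕ, ENNReal.ofReal ((n.factorial : ℝ)⁻¹ * ((a - c) * X ω) ^ n *
        Real.exp (c * X ω)) ∂ν := by
    refine lintegral_congr_ae ?_
    filter_upwards [ae_all_iff.2 hpos] with ω hω
    rw [← (hexp ω).tsum_eq, ENNReal.ofReal_tsum_of_nonneg hω (hexp ω).summable]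
  rw [h1, lintegral_tsum fun n => (hInt n).1.aemeasurable.ennreal_ofReal]
  simp_rw [← ofReal_integral_eq_lintegral_ofReal (hInt _) (hpos _)]
  rw [← ENNReal.ofReal_tsum_of_nonneg (fun n => integral_nonneg_of_ae (hpos n)) hsum']
  exact ENNReal.ofReal_lt_top

lemma isUpperSet_integrableExpSet {Ω : Type*} [MeasurableSpace Ω] {ν : Measure Ω} {X : Ω → ℝ}
    (hXm : AEMeasurable X ν) (hX : ∀ᵐ ω ∂ν, X ω ≤ 0) : IsUpperSet (integrableExpSet X ν) := by
  intro a b hab ha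
  refine Integrable.mono' ha (hXm.const_mul b).exp.aestronglyMeasurable ?_
  filter_upwards [hX] with ω hω
  rw [Real.norm_of_nonneg (Real.exp_pos _).le]
  exact Real.exp_le_exp.2 (mul_le_mul_of_nonpos_right hab hω)

end FakeMu

namespace FakeMu

open MeasureTheory ProbabilityTheory Filter Topology

lemma isPreconnected_re_gt (b : ℝ) : IsPreconnected {s : ℂ | b < s.re} :=
  (convex_halfSpace_re_gt b).isPreconnected

lemma eventuallyEq_of_eqOn_re_gt {Φ F : ℂ → ℂ} {b c : ℝ}
    (hΦ : MeromorphicOn Φ {s | b < s.re}) (hF : MeromorphicOn F {s | b < s.re})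
    (heq : ∀ s : ℂ, c < s.re → Φ s = F s) {s : ℂ} (hs : b < s.re) : Φ =ᶠ[𝓝[≠] s] F := by
  set x : ℂ := ((max b c + 1 : ℝ) : ℂ)
  have hxb : b < x.re := by
    simp only [x, Complex.ofReal_re]; linarith [le_max_left b c]
  have hxc : c < x.re := by
    simp only [x, Complex.ofReal_re]; linarith [le_max_right b c]
  have hx : meromorphicOrderAt (Φ - F) x = ⊤ := by
    rw [meromorphicOrderAt_eq_top_iff]
    have : ∀ᶠ z : ℂ in 𝓝 x, c < z.re :=
      (isOpen_lt continuous_const Complex.continuous_re).mem_nhds hxc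
    filter_upwards [this.filter_mono nhdsWithin_le_nhds] with z hz
    simp [heq z hz]
  have h : meromorphicOrderAt (Φ - F) s = ⊤ := by
    by_contra h
    exact (hΦ.sub hF).meromorphicOrderAt_ne_top_of_isPreconnected (isPreconnected_re_gt b)
      hs hxb h hx
  filter_upwards [meromorphicOrderAt_eq_top_iff.1 h] with z hz
  exact sub_eq_zero.1 hz

lemma Ioi_subset_integrableExpSet {Ω : Type*} [MeasurableSpace Ω] {ν : Measure Ω} {X : Ω → ℝ}
    (hXm : AEMeasurable X ν) (hX : ∀ᵐ ω ∂ν, X ω ≤ 0) {Φ : ℂ → ℂ} {α' α c : ℝ} (hα : α' ≤ α)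
    (hΦ : MeromorphicOn Φ {s | α' < s.re}) (hc : Set.Ioi c ⊆ integrableExpSet X ν)
    (heq : ∀ s : ℂ, c < s.re → Φ s = complexMGF X ν s)
    (hord : ∀ σ : ℝ, α < σ → 0 ≤ meromorphicOrderAt Φ (σ : ℂ)) :
    Set.Ioi α ⊆ integrableExpSet X ν := by
  intro σ hσ
  by_contra hσS
  have hup := isUpperSet_integrableExpSet hXm hX
  have hne : (integrableExpSet X ν).Nonempty := ⟨c + 1, hc (lt_add_one c)⟩
  have hlb : ∀ t ∈ integrableExpSet X ν, σ ≤ t := fun t ht => by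
    by_contra! h
    exact hσS (hup h.le ht)
  have hbdd : BddBelow (integrableExpSet X ν) := ⟨σ, hlb⟩
  set b : ℝ := sInf (integrableExpSet X ν) with hb
  have hσb : σ ≤ b := le_csInf hne hlb
  have hαb : α < b := lt_of_lt_of_le hσ hσb
  have hbS : Set.Ioi b ⊆ integrableExpSet X ν := fun t ht => by
    obtain ⟨r, hr, hrt⟩ := exists_lt_of_csInf_lt hne ht
    exact hup hrt.le hr
  have hmgf : AnalyticOnNhd ℂ (complexMGF X ν) {s | b < s.re} :=
    analyticOnNhd_complexMGF.mono fun s hs => interior_maximal hbS isOpen_Ioi hs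
  have hΦb : MeromorphicOn Φ {s | b < s.re} := hΦ.mono_set fun s hs =>
    lt_of_le_of_lt hα (hαb.trans hs)
  obtain ⟨G, hG, hGΦ⟩ := (MeromorphicAt.meromorphicOrderAt_nonneg_iff
    (hΦ (b : ℂ) (by simpa using lt_of_le_of_lt hα hαb))).1 (hord b hαb)
  have hGX : ∀ᶠ s : ℂ in 𝓝 (b : ℂ), b < s.re → G s = complexMGF X ν s := by
    filter_upwards [(eventually_nhdsWithin_iff.1 hGΦ).eventually_nhds,
      hG.eventually_analyticAt] with s hs hGs hbs
    have hsb : s ≠ (b : ℂ) := by rintro rfl; simp at hbs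
    have h1 : Φ =ᶠ[𝓝[≠] s] G := by
      have h2 : ∀ᶠ z in 𝓝 s, z ≠ (b : ℂ) := isOpen_ne.mem_nhds hsb
      filter_upwards [(hs.and h2).filter_mono nhdsWithin_le_nhds] with z hz
      exact hz.1 hz.2
    have h4 := h1.symm.trans (eventuallyEq_of_eqOn_re_gt hΦb hmgf.meromorphicOn heq hbs)
    exact ((hGs.continuousAt.eventuallyEq_nhds_iff_eventuallyEq_nhdsNE
      (hmgf s hbs).continuousAt).1 h4).eq_of_nhds
  obtain ⟨a, hab, ha⟩ := exists_lt_mem_integrableExpSet hX hbS hG hGX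
  exact absurd (csInf_le hbdd ha) (not_le.2 hab)

end FakeMu

namespace FakeMu

open MeasureTheory ProbabilityTheory Filter Topology

lemma integral_pow_mul_cexp (n : ℕ) {w : ℂ} (hw : 0 < w.re) :
    IntegrableOn (fun u : ℝ => (u : ℂ) ^ n * cexp (-w * u)) (Set.Ioi 0) ∧
      ∫ u : ℝ in Set.Ioi 0, (u : ℂ) ^ n * cexp (-w * u) = n.factorial / w ^ (n + 1) := by
  have hw0 : w ≠ 0 := by rintro rfl; simp at hw
  set ν : Measure ℝ := volume.restrict (Set.Ioi 0) with hν
  have hexp : ∀ z : ℂ, ∀ u : ℝ, cexp (z * ((-u : ℝ) : ℂ)) = cexp (-z * u) := fun z u => by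
    push_cast; ring_nf
  have hS : Set.Ioi 0 ⊆ integrableExpSet (fun u : ℝ => -u) ν := by
    intro σ hσ
    refine (exp_neg_integrableOn_Ioi 0 hσ).congr (Eventually.of_forall fun u => ?_)
    simp only
    ring_nf
  have h_int : ∀ z : ℂ, 0 < z.re → z.re ∈ interior (integrableExpSet (fun u : ℝ => -u) ν) :=
    fun z hz => interior_maximal hS isOpen_Ioi hz
  have hinv : complexMGF (fun u : ℝ => -u) ν =ᶠ[𝓝 w] Inv.inv := by
    filter_upwards [(isOpen_lt continuous_const Complex.continuous_re).mem_nhds hw] with z hz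
    rw [complexMGF]
    simp_rw [hexp]
    rw [integral_exp_mul_complex_Ioi (by simpa using hz) 0]
    simp
  have h := iteratedDeriv_complexMGF (h_int w hw) n
  rw [hinv.iteratedDeriv_eq, iteratedDeriv_eq_iterate, iter_deriv_inv] at h
  have h3 : ∫ u : ℝ in Set.Ioi 0, (u : ℂ) ^ n * cexp (-w * u) = n.factorial / w ^ (n + 1) := by
    have h4 : ∀ u : ℝ, (((-u : ℝ) : ℂ)) ^ n * cexp (w * ((-u : ℝ) : ℂ)) =
        (-1) ^ n * ((u : ℂ) ^ n * cexp (-w * u)) := fun u => by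
      rw [hexp, Complex.ofReal_neg, neg_pow, mul_assoc]
    simp_rw [h4, integral_const_mul] at h
    rw [mul_assoc] at h
    have h5 := mul_left_cancel₀ (pow_ne_zero n (by norm_num : (-1 : ℂ) ≠ 0)) h
    rw [← h5, div_eq_mul_inv, ← zpow_natCast, ← zpow_neg]
    congr 2
    push_cast
    ring
  exact ⟨Integrable.of_integral_ne_zero (by
    rw [h3]
    exact div_ne_zero (by exact_mod_cast n.factorial_ne_zero) (pow_ne_zero _ hw0)), h3⟩

/-- If the Laplace transform of a nonnegative function `A` continues meromorphically to `Φ` with no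
real pole to the right of `α`, then it is analytic on `α < Re s`. -/
lemma exists_analytic_laplace {A : ℝ → ℝ} (hAm : Measurable A) (hA0 : ∀ u, 0 < u → 0 ≤ A u)
    {Φ : ℂ → ℂ} {α' α : ℝ} (hα : α' ≤ α) (hΦ : MeromorphicOn Φ {s | α' < s.re})
    (h_int : ∀ s : ℂ, 1 < s.re → IntegrableOn (fun u : ℝ => (A u : ℂ) * cexp (-s * u)) (Set.Ioi 0) ∧
      ∫ u : ℝ in Set.Ioi 0, (A u : ℂ) * cexp (-s * u) = Φ s)
    (hord : ∀ σ : ℝ, α < σ → 0 ≤ meromorphicOrderAt Φ (σ : ℂ)) :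
    ∃ F : ℂ → ℂ, AnalyticOnNhd ℂ F {s | α < s.re} ∧ (∀ s : ℂ, α < s.re → Φ =ᶠ[𝓝[≠] s] F) ∧
      ∀ s : ℂ, ‖F s‖ ≤ ‖F s.re‖ := by
  set ν : Measure ℝ := (volume.restrict (Set.Ioi 0)).withDensity
    (fun u => ((A u).toNNReal : ENNReal)) with hν
  set X : ℝ → ℝ := fun u => -u with hX
  have hNN : Measurable fun u => (A u).toNNReal := hAm.real_toNNReal
  have hXm : AEMeasurable X ν := measurable_neg.aemeasurable
  have hX0 : ∀ᵐ u ∂ν, X u ≤ 0 := by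
    refine (withDensity_absolutelyContinuous _ _).ae_le ?_
    filter_upwards [ae_restrict_mem measurableSet_Ioi] with u hu
    exact neg_nonpos.2 (le_of_lt hu)
  have hcoe : ∀ (s : ℂ), ∀ u ∈ Set.Ioi (0 : ℝ),
      (A u).toNNReal • cexp (s * (X u : ℝ)) = (A u : ℂ) * cexp (-s * u) := by
    intro s u hu
    rw [NNReal.smul_def, Real.coe_toNNReal _ (hA0 u hu), Complex.real_smul]
    simp [hX]
  have hS : Set.Ioi 1 ⊆ integrableExpSet X ν := by
    intro σ hσ
    have h1 := (h_int σ (by simpa using hσ)).1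
    have h2 : Integrable (fun u : ℝ => cexp ((σ : ℂ) * (X u : ℝ))) ν := by
      rw [hν, integrable_withDensity_iff_integrable_smul hNN]
      exact (integrableOn_congr_fun (hcoe σ) measurableSet_Ioi).2 h1
    have h3 := h2.norm
    simpa [Complex.norm_exp, integrableExpSet] using h3
  have heq : ∀ s : ℂ, 1 < s.re → Φ s = complexMGF X ν s := by
    intro s hs
    rw [complexMGF, hν, integral_withDensity_eq_integral_smul hNN, ← (h_int s hs).2]
    exact (setIntegral_congr_fun measurableSet_Ioi (hcoe s)).symm
  have hI := Ioi_subset_integrableExpSet hXm hX0 hα hΦ hS heq hord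
  have han : AnalyticOnNhd ℂ (complexMGF X ν) {s | α < s.re} :=
    analyticOnNhd_complexMGF.mono fun s hs => interior_maximal hI isOpen_Ioi hs
  refine ⟨complexMGF X ν, han, fun s hs => ?_, fun s => ?_⟩
  · exact eventuallyEq_of_eqOn_re_gt (hΦ.mono_set fun z hz => lt_of_le_of_lt hα hz)
      han.meromorphicOn heq hs
  · rw [complexMGF_ofReal, Complex.norm_real]
    exact norm_complexMGF_le_mgf.trans (le_abs_self _)

end FakeMu

namespace FakeMu

open MeasureTheory Filter Topology

lemma eq_of_analyticAt_of_eventuallyEq {Φ F : ℂ → ℂ} {s : ℂ} (hΦ : AnalyticAt ℂ Φ s)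
    (hF : AnalyticAt ℂ F s) (h : Φ =ᶠ[𝓝[≠] s] F) : Φ s = F s :=
  ((hΦ.continuousAt.eventuallyEq_nhds_iff_eventuallyEq_nhdsNE hF.continuousAt).1 h).eq_of_nhds

lemma tendsto_add_im_nhdsNE {α : ℝ} {s : ℂ} (hs : s.re = α) :
    Tendsto (fun σ : ℝ => (σ : ℂ) + s.im * I) (𝓝[>] α) (𝓝[≠] s) := by
  refine tendsto_nhdsWithin_iff.2 ⟨?_, ?_⟩
  · have h : Continuous fun σ : ℝ => (σ : ℂ) + s.im * I := by fun_prop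
    have h2 := h.tendsto α
    rw [← hs, Complex.re_add_im] at h2
    rw [← hs]
    exact h2.mono_left nhdsWithin_le_nhds
  · filter_upwards [self_mem_nhdsWithin] with σ hσ h
    have h2 := congrArg Complex.re (Set.mem_singleton_iff.1 h)
    rw [hs] at h2
    simp only [add_re, ofReal_re, mul_re, I_re, mul_zero, ofReal_im, I_im, mul_one, sub_self,
      add_zero] at h2
    exact absurd h2 (ne_of_gt hσ)

lemma eventually_eq_on_line {Φ F : ℂ → ℂ} {α : ℝ} (hF : AnalyticOnNhd ℂ F {s | α < s.re})
    (hΦF : ∀ s : ℂ, α < s.re → Φ =ᶠ[𝓝[≠] s] F) {s : ℂ} (hs : s.re = α)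
    (hΦ : MeromorphicAt Φ s) :
    ∀ᶠ σ : ℝ in 𝓝[>] α, Φ (σ + s.im * I) = F (σ + s.im * I) := by
  filter_upwards [(tendsto_add_im_nhdsNE hs).eventually hΦ.eventually_analyticAt,
    self_mem_nhdsWithin] with σ h1 h2
  have h3 : α < ((σ : ℂ) + s.im * I).re := by simpa using h2
  exact eq_of_analyticAt_of_eventuallyEq h1 (hF _ h3) (hΦF _ h3)

/-- A pole of order at least `k` off the real axis is not dominated on the abscissa by a small real
pole of order `k`. -/
lemma not_dominated {H R F : ℂ → ℂ} {α : ℝ} {k : ℕ} (hk : 1 ≤ k) {q : ℝ} {s₀ : ℂ}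
    (hre : α ≤ s₀.re) (hHα : MeromorphicAt H α) (hordα : 0 ≤ meromorphicOrderAt H (α : ℂ))
    {g : ℂ → ℂ} (hg : AnalyticAt ℂ g s₀) {m : ℤ} (hm : m ≤ -k)
    (hHg : ∀ᶠ z in 𝓝[≠] s₀, H z = (z - s₀) ^ m • g z) (hgq : q < ‖g s₀‖)
    (hR : AnalyticAt ℂ R s₀) (hRα : MeromorphicAt R α)
    (hRq : Tendsto (fun σ : ℝ => (σ - α) ^ k * ‖R σ‖) (𝓝[>] α) (𝓝 q))
    (hF : AnalyticOnNhd ℂ F {s | α < s.re}) (hFle : ∀ s : ℂ, ‖F s‖ ≤ ‖F s.re‖)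
    (hHF : ∀ s : ℂ, α < s.re → (fun s => H s + R s) =ᶠ[𝓝[≠] s] F) (hH : MeromorphicAt H s₀) :
    False := by
  have hq : 0 ≤ q := ge_of_tendsto hRq (by
    filter_upwards [self_mem_nhdsWithin] with σ hσ
    have : 0 ≤ σ - α := sub_nonneg.2 (le_of_lt hσ)
    positivity)
  have hg0 : g s₀ ≠ 0 := by
    intro h; rw [h, norm_zero] at hgq; linarith
  rcases hre.lt_or_eq with hlt | heq
  · have h1 : H =ᶠ[𝓝[≠] s₀] F - R := by
      filter_upwards [hHF s₀ hlt] with z hz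
      simp only [Pi.sub_apply, ← hz, add_sub_cancel_right]
    have h2 := meromorphicOrderAt_congr h1
    rw [(meromorphicOrderAt_eq_int_iff hH).2 ⟨g, hg, hg0, hHg⟩] at h2
    have h3 := ((hF s₀ hlt).sub hR).meromorphicOrderAt_nonneg
    rw [← h2] at h3
    have : (0 : ℤ) ≤ m := by exact_mod_cast h3
    omega
  · have hline := tendsto_add_im_nhdsNE heq.symm
    have hreal : Tendsto (fun σ : ℝ => (σ : ℂ)) (𝓝[>] α) (𝓝[≠] (α : ℂ)) := by
      simpa using tendsto_add_im_nhdsNE (s := (α : ℂ)) (α := α) (by simp)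
    have e1 := eventually_eq_on_line hF hHF heq.symm (hH.add hR.meromorphicAt)
    have e2 := eventually_eq_on_line hF hHF (s := (α : ℂ)) (by simp) (hHα.add hRα)
    simp only [Complex.ofReal_im, Complex.ofReal_zero, zero_mul, add_zero] at e2
    have e3 := hline.eventually hHg
    have hpow : Tendsto (fun σ : ℝ => (σ - α) ^ k) (𝓝[>] α) (𝓝 0) := by
      have : Continuous fun σ : ℝ => (σ - α) ^ k := by fun_prop
      have h := this.tendsto α
      rw [sub_self, zero_pow (by omega)] at h
      exact h.mono_left nhdsWithin_le_nhds
    obtain ⟨y, hy⟩ := tendsto_nhds_of_meromorphicOrderAt_nonneg hHα hordα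
    have t1 : Tendsto (fun σ : ℝ => (σ - α) ^ k * ‖H σ‖) (𝓝[>] α) (𝓝 0) := by
      simpa using hpow.mul (hy.comp hreal).norm
    have t2 : Tendsto (fun σ : ℝ => (σ - α) ^ k * ‖R (σ + s₀.im * I)‖) (𝓝[>] α) (𝓝 0) := by
      simpa using hpow.mul
        ((hR.continuousAt.tendsto.mono_left nhdsWithin_le_nhds).comp hline).norm
    have t3 : Tendsto (fun σ : ℝ => ‖g (σ + s₀.im * I)‖) (𝓝[>] α) (𝓝 ‖g s₀‖) :=
      ((hg.continuousAt.tendsto.mono_left nhdsWithin_le_nhds).comp hline).norm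
    have t4 := (t1.add hRq).add t2
    rw [zero_add, add_zero] at t4
    refine absurd (le_of_tendsto_of_tendsto t3 t4 ?_) (not_le.2 hgq)
    have hnear : ∀ᶠ σ : ℝ in 𝓝[>] α, σ < α + 1 :=
      (isOpen_Iio.mem_nhds (lt_add_one α)) |> fun h => mem_nhdsWithin_of_mem_nhds h
    filter_upwards [e1, e2, e3, self_mem_nhdsWithin, hnear] with σ h1 h2 h3 h4 h5
    have hd0 : 0 < σ - α := sub_pos.2 h4
    have hd1 : σ - α ≤ 1 := by linarith
    have hz : (σ : ℂ) + s₀.im * I - s₀ = ((σ - α : ℝ) : ℂ) := by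
      conv_lhs => rw [← Complex.re_add_im s₀]
      rw [← heq]
      simp
    have h6 : ‖g (σ + s₀.im * I)‖ ≤ (σ - α) ^ k * ‖H (σ + s₀.im * I)‖ := by
      rw [h3, hz, norm_smul, norm_zpow, Complex.norm_real, Real.norm_of_nonneg hd0.le, ← mul_assoc]
      refine le_mul_of_one_le_left (norm_nonneg _) ?_
      rw [← zpow_natCast, ← zpow_add₀ hd0.ne']
      exact one_le_zpow_of_nonpos₀ hd0 hd1 (by omega)
    have h7 : ‖H (σ + s₀.im * I)‖ ≤ ‖F σ‖ + ‖R (σ + s₀.im * I)‖ := by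
      have h8 := hFle (σ + s₀.im * I)
      rw [← h1] at h8
      have h9 := norm_sub_le (H (σ + s₀.im * I) + R (σ + s₀.im * I)) (R (σ + s₀.im * I))
      rw [add_sub_cancel_right] at h9
      have : (((σ : ℂ) + s₀.im * I).re : ℂ) = σ := by simp
      rw [this] at h8
      linarith
    have h8 : ‖F σ‖ ≤ ‖H σ‖ + ‖R σ‖ := by
      rw [← h2]; exact norm_add_le _ _
    calc _ ≤ (σ - α) ^ k * ‖H (σ + s₀.im * I)‖ := h6
      _ ≤ (σ - α) ^ k * (‖H σ‖ + ‖R σ‖ + ‖R (σ + s₀.im * I)‖) := by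
          gcongr; linarith
      _ = _ := by ring

end FakeMu

namespace FakeMu

open MeasureTheory Filter Topology

/-- A nonreal pole of the Laplace transform of `e` forces large negative values of `e`. -/
lemma exists_le_neg_of_pole {e : ℝ → ℝ} (hem : Measurable e)
    (hbd : ∀ U : ℝ, ∃ K : ℝ, ∀ u, 0 < u → u ≤ U → |e u| ≤ K)
    {H : ℂ → ℂ} {α' α : ℝ} (h0 : 0 ≤ α') (hα : α' < α) (hα1 : α ≤ 1)
    (hH : MeromorphicOn H {s | α' < s.re})
    (h_int : ∀ s : ℂ, 1 < s.re → IntegrableOn (fun u : ℝ => (e u : ℂ) * cexp (-s * u)) (Set.Ioi 0) ∧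
      ∫ u : ℝ in Set.Ioi 0, (e u : ℂ) * cexp (-s * u) = H s)
    (hord : ∀ σ : ℝ, α ≤ σ → 0 ≤ meromorphicOrderAt H (σ : ℂ))
    {s₀ : ℂ} (him : s₀.im ≠ 0) (hre : α ≤ s₀.re) {k : ℕ} (hk : 1 ≤ k)
    {m : ℤ} (hm : m ≤ -k) (hs₀ : meromorphicOrderAt H s₀ = m) :
    ∃ c : ℝ, 0 < c ∧ ∀ u₀ : ℝ, ∃ u, u₀ ≤ u ∧ e u ≤ -(c * (u ^ (k - 1) * Real.exp (α * u))) := by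
  have hα0 : 0 < α := lt_of_le_of_lt h0 hα
  have hHs := hH s₀ (lt_of_lt_of_le hα hre)
  obtain ⟨g, hg, hg0, hHg⟩ := (meromorphicOrderAt_eq_int_iff hHs).1 hs₀
  set q : ℝ := ‖g s₀‖ / 2 with hq
  have hgpos : 0 < ‖g s₀‖ := norm_pos_iff.2 hg0
  have hq0 : 0 < q := half_pos hgpos
  have hf0 : (0 : ℝ) < (k - 1).factorial := by exact_mod_cast (k - 1).factorial_pos
  set c : ℝ := q / (k - 1).factorial with hc
  have hc0 : 0 < c := by positivity
  have hcq : c * (k - 1).factorial = q := by rw [hc]; field_simp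
  refine ⟨c, hc0, fun u₀ => ?_⟩
  by_contra! hcon
  obtain ⟨K, hK⟩ := hbd u₀
  set A : ℝ → ℝ := fun u => e u + c * (u ^ (k - 1) * Real.exp (α * u)) + |K| with hA
  set R : ℂ → ℂ := fun s => q / (s - α) ^ k + |K| / s with hR
  have hAm : Measurable A := by fun_prop
  have hA0 : ∀ u, 0 < u → 0 ≤ A u := by
    intro u hu
    have h1 : 0 < c * (u ^ (k - 1) * Real.exp (α * u)) := by positivity
    have h2 := abs_nonneg K
    simp only [hA]
    rcases le_total u u₀ with h | h
    · have h3 := (neg_le_of_abs_le (hK u hu h))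
      linarith [le_abs_self K]
    · linarith [hcon u h]
  have hRan : ∀ s : ℂ, s ≠ α → s ≠ 0 → AnalyticAt ℂ R s := by
    intro s h1 h2
    have h3 : (s - α) ^ k ≠ 0 := pow_ne_zero _ (sub_ne_zero.2 h1)
    exact (analyticAt_const.div ((analyticAt_id.sub analyticAt_const).pow k) h3).add
      (analyticAt_const.div analyticAt_id h2)
  have hRmer : ∀ s : ℂ, MeromorphicAt R s := by
    intro s
    exact ((MeromorphicAt.const _ _).div (((MeromorphicAt.id s).sub
      (MeromorphicAt.const _ _)).pow k)).add ((MeromorphicAt.const _ _).div (MeromorphicAt.id s))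
  have hs0 : s₀ ≠ 0 := by rintro rfl; simp at him
  have hs0α : s₀ ≠ α := by rintro rfl; simp at him
  have h_int' : ∀ s : ℂ, 1 < s.re →
      IntegrableOn (fun u : ℝ => (A u : ℂ) * cexp (-s * u)) (Set.Ioi 0) ∧
      ∫ u : ℝ in Set.Ioi 0, (A u : ℂ) * cexp (-s * u) = H s + R s := by
    intro s hs
    obtain ⟨i1, v1⟩ := h_int s hs
    obtain ⟨i2, v2⟩ := integral_pow_mul_cexp (k - 1) (w := s - α) (by
      simp only [sub_re, ofReal_re]; linarith)
    obtain ⟨i3, v3⟩ := integral_pow_mul_cexp 0 (w := s) (by linarith)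
    have hfun : (fun u : ℝ => (A u : ℂ) * cexp (-s * u)) = fun u : ℝ =>
        ((e u : ℂ) * cexp (-s * u) + (c : ℂ) * ((u : ℂ) ^ (k - 1) * cexp (-(s - α) * u))) +
          ((|K| : ℝ) : ℂ) * ((u : ℂ) ^ 0 * cexp (-s * u)) := by
      funext u
      have : cexp (-(s - α) * u) = cexp (α * u) * cexp (-s * u) := by
        rw [← Complex.exp_add]; ring_nf
      simp only [hA]
      rw [this]
      push_cast
      ring
    have i12 : IntegrableOn (fun u : ℝ => (e u : ℂ) * cexp (-s * u) +
        (c : ℂ) * ((u : ℂ) ^ (k - 1) * cexp (-(s - α) * u))) (Set.Ioi 0) :=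
      i1.add (i2.const_mul (c : ℂ))
    have i3' := i3.const_mul ((|K| : ℝ) : ℂ)
    rw [hfun]
    refine ⟨i12.add i3', ?_⟩
    rw [integral_add i12 i3', integral_add i1 (i2.const_mul (c : ℂ)), integral_const_mul,
      integral_const_mul, v1, v2, v3, Nat.sub_add_cancel hk, add_assoc]
    simp only [hR, ← hcq]
    push_cast
    simp
    ring
  have hΦ : MeromorphicOn (fun s => H s + R s) {s | α' < s.re} := fun s hs =>
    (hH s hs).add (hRmer s)
  have hord' : ∀ σ : ℝ, α < σ → 0 ≤ meromorphicOrderAt (fun s => H s + R s) (σ : ℂ) := by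
    intro σ hσ
    have h1 : 0 ≤ meromorphicOrderAt R (σ : ℂ) := (hRan σ (by
      exact_mod_cast hσ.ne') (by exact_mod_cast (hα0.trans hσ).ne')).meromorphicOrderAt_nonneg
    exact (le_min (hord σ hσ.le) h1).trans
      (meromorphicOrderAt_add (hH σ (by simpa using hα.trans hσ)) (hRmer σ))
  obtain ⟨F, hF, hHF, hFle⟩ := exists_analytic_laplace hAm hA0 hα.le hΦ h_int' hord'
  have hRq : Tendsto (fun σ : ℝ => (σ - α) ^ k * ‖R σ‖) (𝓝[>] α) (𝓝 q) := by
    have hcont : ContinuousAt (fun σ : ℝ => |q + (σ - α) ^ k * (|K| / σ)|) α := by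
      have h1 : ContinuousAt (fun σ : ℝ => |K| / σ) α :=
        continuousAt_const.div continuousAt_id hα0.ne'
      exact (continuousAt_const.add (((continuousAt_id.sub continuousAt_const).pow k).mul h1)).abs
    have h1 := hcont.tendsto
    rw [sub_self, zero_pow (by omega), zero_mul, add_zero, abs_of_pos hq0] at h1
    refine (h1.mono_left nhdsWithin_le_nhds).congr' ?_
    filter_upwards [self_mem_nhdsWithin] with σ hσ
    have h2 : 0 < σ - α := sub_pos.2 hσ
    have h3 : R σ = ((q / (σ - α) ^ k + |K| / σ : ℝ) : ℂ) := by simp [hR]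
    rw [h3, Complex.norm_real, Real.norm_eq_abs]
    nth_rewrite 2 [← abs_of_pos (pow_pos h2 k)]
    rw [← abs_mul]
    congr 1
    field_simp
  exact not_dominated hk hre (hH α (by simpa using hα)) (hord α le_rfl) hg hm hHg
    (by rw [hq]; linarith) (hRan s₀ hs0α hs0) (hRmer α) hRq hF hFle hHF hHs

end FakeMu

namespace FakeMu

open Filter Topology

lemma altZeta_ofReal_ne_zero {σ : ℝ} (hσ : 0 < σ) : altZeta (σ : ℂ) ≠ 0 := by
  set b : ℕ → ℝ := fun m => ((m : ℝ) + 1) ^ (-σ) with hb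
  have hanti : ∀ m, b (m + 1) ≤ b m := by
    intro m
    simp only [hb]
    exact Real.rpow_le_rpow_of_nonpos (by positivity) (by push_cast; linarith) (by linarith)
  have hbpos : ∀ m, 0 < b m := fun m => by positivity
  have hlt : b 1 < b 0 := by
    simp only [hb]
    exact Real.rpow_lt_rpow_of_neg (by positivity) (by norm_num) (by linarith)
  have hs : 1 < (σ : ℂ).re + (1 : ℕ) := by simpa using hσ
  have hcast : ∀ m : ℕ, iterDiff (σ : ℂ) 1 (((0 + 1 : ℕ) : ℝ) + m) = ((b m - b (m + 1) : ℝ) : ℂ) := by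
    intro m
    simp only [iterDiff, hb]
    rw [← Complex.ofReal_neg, ← Complex.ofReal_cpow (by positivity),
      ← Complex.ofReal_cpow (by positivity)]
    push_cast
    ring_nf
  have hsum := (summable_altTail (s := (σ : ℂ)) (N := 0 + 1) (by norm_num) hs).hasSum
  have heuler := altZeta_eq_euler 0 1 hs
  have htend := hsum.tendsto_sum_nat.comp (tendsto_id.const_mul_atTop' (by norm_num : 0 < 2))
  have hpart : ∀ N : ℕ, ∑ m ∈ Finset.range (2 * N), (-1 : ℂ) ^ m *
      iterDiff (σ : ℂ) 1 (((0 + 1 : ℕ) : ℝ) + m) =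
      ((2 * ∑ i ∈ Finset.range N, (b (2 * i) - b (2 * i + 1)) + b (2 * N) - b 0 : ℝ) : ℂ) := by
    intro N
    induction N with
    | zero => simp
    | succ N ih =>
      rw [show 2 * (N + 1) = 2 * N + 1 + 1 by ring, Finset.sum_range_succ, Finset.sum_range_succ,
        ih, hcast, hcast, Finset.sum_range_succ, pow_succ, pow_mul]
      push_cast
      ring_nf
  have hre := (Complex.continuous_re.tendsto _).comp htend
  have hlim : 2 * (b 0 - b 1) - b 0 ≤ (altTail (σ : ℂ) 1 (0 + 1)).re := by
    refine ge_of_tendsto hre ?_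
    filter_upwards [eventually_ge_atTop 1] with N hN
    simp only [Function.comp_apply, id]
    rw [hpart, Complex.ofReal_re]
    have h1 : b (2 * 0) - b (2 * 0 + 1) ≤ ∑ i ∈ Finset.range N, (b (2 * i) - b (2 * i + 1)) :=
      Finset.single_le_sum (f := fun i => b (2 * i) - b (2 * i + 1))
        (fun i _ => sub_nonneg.2 (hanti _)) (Finset.mem_range.2 hN)
    simp only [mul_zero, zero_add] at h1
    linarith [hbpos (2 * N)]
  intro h
  rw [heuler] at h
  have h2 := congrArg Complex.re h
  have h3 : iterDiff (σ : ℂ) 0 ((0 + 1 : ℕ) : ℝ) = 1 := by simp [iterDiff]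
  have hb0 : b 0 = 1 := by simp [hb]
  simp only [Finset.range_zero, Finset.sum_empty, pow_zero, one_mul, zero_add,
    Finset.sum_range_one, pow_one] at h2
  simp only [zero_add] at h3 hlim
  rw [h3] at h2
  have h4 : ((1 : ℂ) / 2 + altTail (σ : ℂ) 1 1 / 2).re = 1 / 2 + (altTail (σ : ℂ) 1 1).re / 2 := by
    simp
  rw [h4, Complex.zero_re] at h2
  linarith

lemma riemannZeta_ofReal_ne_zero {σ : ℝ} (hσ : 0 < σ) : riemannZeta (σ : ℂ) ≠ 0 := by
  by_cases h1 : 1 ≤ σ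
  · exact riemannZeta_ne_zero_of_one_le_re (by simpa using h1)
  · intro h
    apply altZeta_ofReal_ne_zero hσ
    rw [altZeta_eq (by exact_mod_cast (not_le.1 h1).ne), h, mul_zero]

end FakeMu

namespace FakeMu

open Filter Topology

lemma analyticAt_riemannZeta {s : ℂ} (hs : s ≠ 1) : AnalyticAt ℂ riemannZeta s :=
  analyticOn_riemannZeta s hs

lemma meromorphicAt_riemannZeta (s : ℂ) : MeromorphicAt riemannZeta s := by
  by_cases hs : s = 1
  · subst hs
    have h : MeromorphicAt (fun s : ℂ => altZeta s / (1 - (2 : ℂ) ^ (1 - s))) 1 :=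
      (differentiable_altZeta.analyticAt 1).meromorphicAt.div
        (differentiable_one_sub_two_cpow.analyticAt 1).meromorphicAt
    refine h.congr ?_
    have hne := differentiable_one_sub_two_cpow.analyticAt 1
    have h2 : ∀ᶠ s : ℂ in 𝓝[≠] 1, (1 - (2 : ℂ) ^ (1 - s)) ≠ 0 := by
      refine hne.eventually_eq_zero_or_eventually_ne_zero.resolve_left fun h0 => ?_
      have hd : HasDerivAt (fun s : ℂ => 1 - (2 : ℂ) ^ (1 - s)) (Complex.log 2) 1 := by
        have := ((((hasDerivAt_id (1 : ℂ)).const_sub 1).const_cpow (c := 2)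
          (Or.inl two_ne_zero)).const_sub 1)
        simpa using this
      have h3 : (fun s : ℂ => 1 - (2 : ℂ) ^ (1 - s)) =ᶠ[𝓝 1] fun _ => 0 := h0
      have h4 := hd.unique ((hasDerivAt_const (1 : ℂ) (0 : ℂ)).congr_of_eventuallyEq h3)
      have h5 : Complex.log 2 = ((Real.log 2 : ℝ) : ℂ) := by
        rw [Complex.ofReal_log (by norm_num)]; norm_num
      rw [h5] at h4
      exact (Real.log_pos one_lt_two).ne' (by exact_mod_cast h4)
    filter_upwards [h2, self_mem_nhdsWithin] with s hs hs1
    rw [altZeta_eq hs1, mul_div_cancel_left₀ _ hs]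
  · exact (analyticAt_riemannZeta hs).meromorphicAt

lemma meromorphicOrderAt_riemannZeta_one : meromorphicOrderAt riemannZeta 1 = (-1 : ℤ) := by
  have h1 : MeromorphicAt (fun s : ℂ => s - 1) 1 := by fun_prop
  have h2 := meromorphicAt_riemannZeta 1
  have h3 : meromorphicOrderAt (fun s => (s - 1) * riemannZeta s) 1 = 0 :=
    (tendsto_ne_zero_iff_meromorphicOrderAt_eq_zero (h1.fun_mul h2)).1
      ⟨1, one_ne_zero, riemannZeta_residue_one⟩
  rw [fun_meromorphicOrderAt_mul h1 h2, meromorphicOrderAt_id_sub_const] at h3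
  cases h : meromorphicOrderAt riemannZeta 1 with
  | top => rw [h] at h3; simp at h3
  | coe n =>
    rw [h] at h3
    have h4 : (1 : ℤ) + n = 0 := by exact_mod_cast h3
    have : n = -1 := by linarith
    rw [this]

lemma meromorphicOrderAt_riemannZeta_ne_top (s : ℂ) : meromorphicOrderAt riemannZeta s ≠ ⊤ := by
  have hm : MeromorphicOn riemannZeta Set.univ := fun s _ => meromorphicAt_riemannZeta s
  refine hm.meromorphicOrderAt_ne_top_of_isPreconnected isPreconnected_univ (Set.mem_univ 1)
    (Set.mem_univ s) ?_
  rw [meromorphicOrderAt_riemannZeta_one]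
  exact WithTop.coe_ne_top

lemma exists_meromorphicOrderAt_riemannZeta (s : ℂ) : ∃ n : ℤ,
    meromorphicOrderAt riemannZeta s = n ∧ (s = 1 → n = -1) ∧
      (s ≠ 1 → riemannZeta s ≠ 0 → n = 0) ∧ (s ≠ 1 → riemannZeta s = 0 → 1 ≤ n) := by
  obtain ⟨n, hn⟩ := WithTop.ne_top_iff_exists.1 (meromorphicOrderAt_riemannZeta_ne_top s)
  refine ⟨n, hn.symm, ?_, ?_, ?_⟩
  · rintro rfl
    rw [meromorphicOrderAt_riemannZeta_one] at hn
    exact_mod_cast hn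
  · intro hs h0
    have h1 := (tendsto_ne_zero_iff_meromorphicOrderAt_eq_zero (meromorphicAt_riemannZeta s)).1
      ⟨_, h0, ((analyticAt_riemannZeta hs).continuousAt.tendsto).mono_left nhdsWithin_le_nhds⟩
    rw [h1] at hn
    exact_mod_cast hn
  · intro hs h0
    have h1 := (tendsto_zero_iff_meromorphicOrderAt_pos (meromorphicAt_riemannZeta s)).1
      (by simpa [h0] using
        ((analyticAt_riemannZeta hs).continuousAt.tendsto).mono_left nhdsWithin_le_nhds)
    rw [← hn] at h1
    have : 0 < n := by exact_mod_cast h1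
    omega

lemma meromorphicAt_riemannZeta_mul (j : ℕ) (s : ℂ) :
    MeromorphicAt (fun s : ℂ => riemannZeta (j * s)) s :=
  MeromorphicAt.comp_analyticAt (f := riemannZeta) (g := fun s : ℂ => (j : ℂ) * s)
    (meromorphicAt_riemannZeta _) (by fun_prop)

lemma meromorphicOrderAt_riemannZeta_mul {j : ℕ} (hj : j ≠ 0) (s : ℂ) :
    meromorphicOrderAt (fun s : ℂ => riemannZeta (j * s)) s =
      meromorphicOrderAt riemannZeta (j * s) := by
  refine meromorphicOrderAt_comp_of_deriv_ne_zero (f := riemannZeta)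
    (g := fun s : ℂ => (j : ℂ) * s) (by fun_prop) ?_
  have : HasDerivAt (fun s : ℂ => (j : ℂ) * s) (j : ℂ) s := by
    simpa using (hasDerivAt_id s).const_mul (j : ℂ)
  rw [this.deriv]
  exact_mod_cast hj

lemma meromorphicAt_zetaProd (a : ℕ → ℤ) (N : ℕ) (s : ℂ) :
    MeromorphicAt (fun s : ℂ => ∏ j ∈ Finset.Icc 1 N, riemannZeta (j * s) ^ a j) s :=
  MeromorphicAt.fun_prod fun j _ => (meromorphicAt_riemannZeta_mul j s).zpow (a j)

lemma meromorphicOrderAt_zetaProd (a : ℕ → ℤ) (N : ℕ) (s : ℂ) {n : ℕ → ℤ}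
    (hn : ∀ j : ℕ, meromorphicOrderAt riemannZeta (j * s) = n j) :
    meromorphicOrderAt (fun s : ℂ => ∏ j ∈ Finset.Icc 1 N, riemannZeta (j * s) ^ a j) s =
      (∑ j ∈ Finset.Icc 1 N, a j * n j : ℤ) := by
  rw [meromorphicOrderAt_fun_prod (f := fun (j : ℕ) (s : ℂ) => riemannZeta (j * s) ^ a j)
    fun j _ => (meromorphicAt_riemannZeta_mul j s).zpow (a j)]
  push_cast
  refine Finset.sum_congr rfl fun j hj => ?_
  have hj0 : j ≠ 0 := by have := (Finset.mem_Icc.1 hj).1; omega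
  have := fun_meromorphicOrderAt_zpow (meromorphicAt_riemannZeta_mul j s) (n := a j)
  rw [this, meromorphicOrderAt_riemannZeta_mul hj0, hn]

end FakeMu

namespace FakeMu

open Filter Topology MeasureTheory

lemma tendsto_conj_nhdsNE (x : ℝ) :
    Tendsto (starRingEnd ℂ) (𝓝[≠] (x : ℂ)) (𝓝[≠] (x : ℂ)) := by
  refine tendsto_nhdsWithin_of_tendsto_nhds_of_eventually_within _ ?_ ?_
  · have := (Complex.continuous_conj.tendsto (x : ℂ))
    rw [Complex.conj_ofReal] at this
    exact this.mono_left nhdsWithin_le_nhds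
  · filter_upwards [self_mem_nhdsWithin] with s hs h
    apply hs
    have := congrArg (starRingEnd ℂ) (show starRingEnd ℂ s = (x : ℂ) from h)
    simpa using this

/-- A function commuting with conjugation has real principal part at a real point. -/
lemma exists_real_principal_part {x : ℝ} (n : ℕ) {R : ℂ → ℂ} (hR : MeromorphicAt R x)
    (hord : ((-n : ℤ) : WithTop ℤ) ≤ meromorphicOrderAt R x)
    (hreal : ∀ᶠ s in 𝓝[≠] (x : ℂ), R (starRingEnd ℂ s) = starRingEnd ℂ (R s)) :
    ∃ c : ℕ → ℝ, 0 ≤ meromorphicOrderAt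
      (fun s => R s - ∑ i ∈ Finset.range n, (c i : ℂ) / (s - x) ^ (i + 1)) x := by
  induction n generalizing R with
  | zero => exact ⟨0, by simpa using hord⟩
  | succ n ih =>
    have hp : MeromorphicAt (fun s : ℂ => (s - x) ^ (n + 1)) x := by fun_prop
    have hpo : meromorphicOrderAt (fun s : ℂ => (s - x) ^ (n + 1)) x = ((n + 1 : ℕ) : ℤ) := by
      simpa using fun_meromorphicOrderAt_pow_id_sub_const (x := (x : ℂ)) (n := n + 1)
    have hG := hp.fun_mul hR
    have hGo : 0 ≤ meromorphicOrderAt (fun s : ℂ => (s - x) ^ (n + 1) * R s) x := by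
      rw [fun_meromorphicOrderAt_mul hp hR, hpo]
      cases h : meromorphicOrderAt R x with
      | top => simp
      | coe m =>
        rw [h] at hord
        have h1 : (-((n + 1 : ℕ) : ℤ)) ≤ m := by exact_mod_cast hord
        have h2 : 0 ≤ ((n + 1 : ℕ) : ℤ) + m := by linarith
        exact_mod_cast h2
    obtain ⟨c, hc⟩ := (tendsto_nhds_iff_meromorphicOrderAt_nonneg hG).2 hGo
    have hcr : starRingEnd ℂ c = c := by
      have h1 := hc.comp (tendsto_conj_nhdsNE x)
      have h2 := (Complex.continuous_conj.tendsto c).comp hc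
      refine tendsto_nhds_unique (h2.congr' ?_) h1
      filter_upwards [hreal] with s hs
      simp [hs]
    obtain ⟨d, rfl⟩ := Complex.conj_eq_iff_real.1 hcr
    set R₁ : ℂ → ℂ := fun s => R s - d / (s - x) ^ (n + 1) with hR₁
    have hR₁m : MeromorphicAt R₁ x := by
      exact hR.fun_sub ((MeromorphicAt.const _ _).div hp)
    have hR₁o : ((-n : ℤ) : WithTop ℤ) ≤ meromorphicOrderAt R₁ x := by
      have h1 : 0 < meromorphicOrderAt (fun s : ℂ => (s - x) ^ (n + 1) * R₁ s) x := by
        refine (tendsto_zero_iff_meromorphicOrderAt_pos (hp.fun_mul hR₁m)).1 ?_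
        have h2 := hc.sub_const (d : ℂ)
        rw [sub_self] at h2
        refine h2.congr' ?_
        filter_upwards [self_mem_nhdsWithin] with s hs
        have h3 : (s - x) ≠ 0 := sub_ne_zero.2 hs
        simp only [hR₁]
        field_simp
      rw [fun_meromorphicOrderAt_mul hp hR₁m, hpo] at h1
      cases h : meromorphicOrderAt R₁ x with
      | top => simp
      | coe m =>
        rw [h] at h1
        have h2 : 0 < ((n + 1 : ℕ) : ℤ) + m := by exact_mod_cast h1
        have h3 : (-n : ℤ) ≤ m := by push_cast at h2; linarith
        exact_mod_cast h3
    have hreal₁ : ∀ᶠ s in 𝓝[≠] (x : ℂ), R₁ (starRingEnd ℂ s) = starRingEnd ℂ (R₁ s) := by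
      filter_upwards [hreal] with s hs
      simp [hR₁, hs]
    obtain ⟨c, hc⟩ := ih hR₁m hR₁o hreal₁
    refine ⟨fun i => if i = n then d else c i, ?_⟩
    convert hc using 3 with s
    rw [Finset.sum_range_succ]
    simp only [hR₁, if_true]
    rw [Finset.sum_congr rfl (g := fun i => (c i : ℂ) / (s - x) ^ (i + 1)) fun i hi => by
      rw [if_neg (Finset.mem_range.1 hi).ne]]
    ring

/-- The polynomial whose Laplace transform has principal part coefficients `c`. -/
noncomputable def laplacePoly (c : ℕ → ℝ) (n : ℕ) : Polynomial ℝ :=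
  ∑ i ∈ Finset.range n, Polynomial.C (c i / i.factorial) * Polynomial.X ^ i

lemma natDegree_laplacePoly_le (c : ℕ → ℝ) (n : ℕ) : (laplacePoly c n).natDegree ≤ n - 1 := by
  refine Polynomial.natDegree_sum_le_of_forall_le _ _ fun i hi => ?_
  exact (Polynomial.natDegree_C_mul_X_pow_le _ _).trans (by
    have := Finset.mem_range.1 hi; omega)

lemma integral_laplacePoly (c : ℕ → ℝ) (n : ℕ) {x : ℝ} {s : ℂ} (hs : x < s.re) :
    IntegrableOn (fun u : ℝ => (((laplacePoly c n).eval u * Real.exp (x * u) : ℝ) : ℂ) *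
        cexp (-s * u)) (Set.Ioi 0) ∧
      ∫ u : ℝ in Set.Ioi 0, (((laplacePoly c n).eval u * Real.exp (x * u) : ℝ) : ℂ) *
        cexp (-s * u) = ∑ i ∈ Finset.range n, (c i : ℂ) / (s - x) ^ (i + 1) := by
  have hw : 0 < (s - x).re := by simpa using hs
  have hfun : (fun u : ℝ => (((laplacePoly c n).eval u * Real.exp (x * u) : ℝ) : ℂ) *
      cexp (-s * u)) = fun u : ℝ => ∑ i ∈ Finset.range n,
        ((c i / i.factorial : ℝ) : ℂ) * ((u : ℂ) ^ i * cexp (-(s - x) * u)) := by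
    funext u
    have : cexp (-(s - x) * u) = cexp (x * u) * cexp (-s * u) := by
      rw [← Complex.exp_add]; ring_nf
    rw [this, laplacePoly, Polynomial.eval_finsetSum]
    push_cast
    rw [Finset.sum_mul, Finset.sum_mul]
    refine Finset.sum_congr rfl fun i _ => ?_
    simp
    ring
  have hi : ∀ i ∈ Finset.range n, IntegrableOn (fun u : ℝ =>
      ((c i / i.factorial : ℝ) : ℂ) * ((u : ℂ) ^ i * cexp (-(s - x) * u))) (Set.Ioi 0) :=
    fun i _ => (integral_pow_mul_cexp i hw).1.const_mul _
  rw [hfun]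
  refine ⟨integrable_finsetSum _ hi, ?_⟩
  rw [integral_finsetSum _ hi]
  refine Finset.sum_congr rfl fun i _ => ?_
  rw [integral_const_mul, (integral_pow_mul_cexp i hw).2]
  have : (i.factorial : ℂ) ≠ 0 := by exact_mod_cast i.factorial_ne_zero
  push_cast
  field_simp

end FakeMu

namespace FakeMu

open Filter Topology MeasureTheory

lemma measurable_summatory (f : ℕ → ℤ) :
    Measurable fun x : ℝ => ∑ n ∈ Finset.Icc 1 ⌊x⌋₊, (f n : ℝ) :=
  (measurable_from_nat (f := fun N : ℕ => ∑ n ∈ Finset.Icc 1 N, (f n : ℝ))).comp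
    Nat.measurable_floor

lemma abs_summatory_le {f : ℕ → ℤ} (hf : ∀ n, n ≠ 0 → |f n| ≤ 1) {x : ℝ} (hx : 0 ≤ x) :
    |∑ n ∈ Finset.Icc 1 ⌊x⌋₊, (f n : ℝ)| ≤ x := by
  refine (Finset.abs_sum_le_sum_abs _ _).trans ?_
  refine (Finset.sum_le_card_nsmul _ _ 1 fun n hn => ?_).trans ?_
  · have := hf n (by have := (Finset.mem_Icc.1 hn).1; omega)
    exact_mod_cast this
  · simpa using Nat.floor_le hx

lemma exp_image_Ioi_zero : Real.exp '' Set.Ioi 0 = Set.Ioi 1 := by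
  ext x
  constructor
  · rintro ⟨u, hu, rfl⟩
    exact Real.one_lt_exp_iff.2 hu
  · intro hx
    exact ⟨Real.log x, Real.log_pos hx, Real.exp_log (zero_lt_one.trans hx)⟩

/-- The Dirichlet series of `f`, divided by `s`, as a Laplace transform. -/
lemma integral_summatory {f : ℕ → ℤ} (hf : ∀ n, n ≠ 0 → |f n| ≤ 1) {s : ℂ} (hs : 1 < s.re) :
    IntegrableOn (fun u : ℝ => ((∑ n ∈ Finset.Icc 1 ⌊Real.exp u⌋₊, (f n : ℝ) : ℝ) : ℂ) *
        cexp (-s * u)) (Set.Ioi 0) ∧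
      ∫ u : ℝ in Set.Ioi 0, ((∑ n ∈ Finset.Icc 1 ⌊Real.exp u⌋₊, (f n : ℝ) : ℝ) : ℂ) *
        cexp (-s * u) = (∑' n : ℕ, (f n : ℂ) / (n : ℂ) ^ s) / s := by
  have hs0 : s ≠ 0 := by rintro rfl; norm_num at hs
  constructor
  · have hg : IntegrableOn (fun u : ℝ => Real.exp (-(s.re - 1) * u)) (Set.Ioi 0) :=
      exp_neg_integrableOn_Ioi 0 (by linarith)
    refine hg.mono' ?_ (ae_of_all _ fun u => ?_)
    · refine Measurable.aestronglyMeasurable (Measurable.mul ?_ (by fun_prop))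
      exact Complex.measurable_ofReal.comp ((measurable_summatory f).comp Real.measurable_exp)
    · rw [norm_mul, Complex.norm_real, Real.norm_eq_abs, Complex.norm_exp,
        show -(s.re - 1) * u = u + (-s * u).re by simp; ring, Real.exp_add]
      gcongr
      exact abs_summatory_le hf (Real.exp_pos u).le
  · have hL : ∑' n : ℕ, (f n : ℂ) / (n : ℂ) ^ s = LSeries (fun n => (f n : ℂ)) s := by
      refine tsum_congr fun n => ?_
      rw [LSeries.term_def]
      split_ifs with h
      · simp [h, Complex.zero_cpow hs0]
      · rfl
    have hO : (fun n : ℕ => ∑ k ∈ Finset.Icc 1 n, ‖(f k : ℂ)‖) =O[atTop]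
        fun n : ℕ => (n : ℝ) ^ (1 : ℝ) := by
      refine Asymptotics.IsBigO.of_bound 1 (Eventually.of_forall fun n => ?_)
      rw [Real.norm_of_nonneg (Finset.sum_nonneg fun _ _ => norm_nonneg _), Real.rpow_one, one_mul,
        Real.norm_natCast]
      refine (Finset.sum_le_card_nsmul _ _ 1 fun k hk => ?_).trans (by simp)
      rw [Complex.norm_intCast]
      exact_mod_cast hf k (by have := (Finset.mem_Icc.1 hk).1; omega)
    rw [hL, LSeries_eq_mul_integral' _ zero_le_one hs hO, mul_div_cancel_left₀ _ hs0,
      ← exp_image_Ioi_zero, integral_image_eq_integral_abs_deriv_smul measurableSet_Ioi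
        (fun x _ => (Real.hasDerivAt_exp x).hasDerivWithinAt) Real.exp_injective.injOn]
    refine setIntegral_congr_fun measurableSet_Ioi fun u _ => ?_
    simp only [abs_of_pos (Real.exp_pos u)]
    rw [Complex.real_smul, Complex.ofReal_exp, Complex.cpow_def_of_ne_zero (Complex.exp_ne_zero _),
      ← Complex.ofReal_exp, ← Complex.ofReal_log (Real.exp_pos u).le, Real.log_exp]
    rw [show -s * (u : ℂ) = u + u * (-(s + 1)) by ring, Complex.exp_add, Complex.ofReal_exp]
    push_cast
    ring

end FakeMu

namespace FakeMu

open Filter Topology MeasureTheory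

/-- The meromorphic continuation of the Laplace transform of the summatory function. -/
noncomputable def dirichletQuot (U : ℂ → ℂ) (a : ℕ → ℤ) (N : ℕ) (s : ℂ) : ℂ :=
  s⁻¹ * (U s * ∏ j ∈ Finset.Icc 1 N, riemannZeta (j * s) ^ a j)

section

variable {U : ℂ → ℂ} {a : ℕ → ℤ} {N : ℕ} {s : ℂ}

lemma meromorphicAt_dirichletQuot (hU : AnalyticAt ℂ U s) :
    MeromorphicAt (dirichletQuot U a N) s :=
  (MeromorphicAt.id s).inv.mul (hU.meromorphicAt.mul (meromorphicAt_zetaProd a N s))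

lemma meromorphicOrderAt_dirichletQuot (hU : AnalyticAt ℂ U s) (hs : s ≠ 0) {n : ℕ → ℤ}
    (hn : ∀ j : ℕ, meromorphicOrderAt riemannZeta (j * s) = n j) :
    meromorphicOrderAt (dirichletQuot U a N) s =
      meromorphicOrderAt U s + (∑ j ∈ Finset.Icc 1 N, a j * n j : ℤ) := by
  rw [← meromorphicOrderAt_zetaProd a N s hn,
    ← fun_meromorphicOrderAt_mul hU.meromorphicAt (meromorphicAt_zetaProd a N s)]
  exact meromorphicOrderAt_mul_of_ne_zero (g := fun s : ℂ => s⁻¹) (analyticAt_id.inv hs)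
    (inv_ne_zero hs)

lemma le_meromorphicOrderAt_dirichletQuot {σ : ℝ} (hσ : 0 < σ) (hU : AnalyticAt ℂ U σ) :
    ((-∑ j ∈ Finset.Icc 1 N, if σ = 1 / j then a j else 0 : ℤ) : WithTop ℤ) ≤
      meromorphicOrderAt (dirichletQuot U a N) σ := by
  choose n hn h1 h0 _ using fun j : ℕ => exists_meromorphicOrderAt_riemannZeta ((j : ℂ) * σ)
  rw [meromorphicOrderAt_dirichletQuot hU (by exact_mod_cast hσ.ne') hn]
  have hsum : ∑ j ∈ Finset.Icc 1 N, a j * n j =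
      -∑ j ∈ Finset.Icc 1 N, if σ = 1 / j then a j else 0 := by
    rw [← Finset.sum_neg_distrib]
    refine Finset.sum_congr rfl fun j hj => ?_
    have hj0 : (0 : ℝ) < j := by exact_mod_cast (Finset.mem_Icc.1 hj).1
    split_ifs with h
    · rw [h1 j]
      · ring
      · rw [h]; push_cast; exact mul_one_div_cancel (by exact_mod_cast hj0.ne')
    · rw [h0 j]
      · ring
      · intro h2
        have h3 : (j : ℝ) * σ = 1 := by exact_mod_cast h2
        exact h (by field_simp; linarith)
      · have := riemannZeta_ofReal_ne_zero (mul_pos hj0 hσ)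
        push_cast at this
        exact this
  rw [hsum]
  exact le_add_of_nonneg_left hU.meromorphicOrderAt_nonneg

lemma neg_le_meromorphicOrderAt_dirichletQuot {j : ℕ} (hj : j ∈ Finset.Icc 1 N)
    (hU : AnalyticAt ℂ U ((1 / j : ℝ) : ℂ)) :
    ((-(a j).toNat : ℤ) : WithTop ℤ) ≤
      meromorphicOrderAt (dirichletQuot U a N) ((1 / j : ℝ) : ℂ) := by
  have hj0 : (0 : ℝ) < j := by exact_mod_cast (Finset.mem_Icc.1 hj).1
  refine le_trans ?_ (le_meromorphicOrderAt_dirichletQuot (a := a) (N := N)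
    (one_div_pos.2 hj0) hU)
  rw [Finset.sum_eq_single_of_mem j hj fun i hi hij => if_neg fun h => hij ?_, if_pos rfl]
  · have : -((a j).toNat : ℤ) ≤ -a j := by omega
    exact_mod_cast this
  · have hi0 : (0 : ℝ) < i := by exact_mod_cast (Finset.mem_Icc.1 hi).1
    field_simp at h
    exact_mod_cast h

lemma meromorphicOrderAt_dirichletQuot_nonneg {σ : ℝ} (hσ : 0 < σ) (hU : AnalyticAt ℂ U σ)
    (hne : ∀ j ∈ Finset.Icc 1 N, σ ≠ 1 / j) :
    0 ≤ meromorphicOrderAt (dirichletQuot U a N) σ := by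
  have h := le_meromorphicOrderAt_dirichletQuot (a := a) (N := N) hσ hU
  rw [Finset.sum_congr rfl (g := fun _ => 0) fun j hj => if_neg (hne j hj)] at h
  simpa using h

lemma exists_meromorphicOrderAt_dirichletQuot_le (hU : AnalyticAt ℂ U s) (hU0 : U s ≠ 0)
    (him : s.im ≠ 0) {ℓ : ℕ} (hℓ : ℓ ∈ Finset.Icc 1 N) (ha : a ℓ < 0)
    (h0 : riemannZeta (ℓ * s) = 0)
    (hne : ∀ j ∈ Finset.Icc 1 N, j ≠ ℓ → riemannZeta (j * s) ≠ 0) :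
    ∃ m : ℤ, m ≤ -((a ℓ).natAbs : ℤ) ∧ meromorphicOrderAt (dirichletQuot U a N) s = m := by
  choose n hn _ hn0 hn1 using fun j : ℕ => exists_meromorphicOrderAt_riemannZeta ((j : ℂ) * s)
  have hs : s ≠ 0 := by rintro rfl; simp at him
  have h1 : ∀ j ∈ Finset.Icc 1 N, (j : ℂ) * s ≠ 1 := by
    intro j hj h
    have hj0 : (j : ℝ) ≠ 0 := by
      have := (Finset.mem_Icc.1 hj).1
      exact_mod_cast (by omega : j ≠ 0)
    have := congrArg Complex.im h
    simp [hj0, him] at this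
  refine ⟨a ℓ * n ℓ, ?_, ?_⟩
  · have := hn1 ℓ (h1 ℓ hℓ) h0
    have h2 : ((a ℓ).natAbs : ℤ) = -a ℓ := by omega
    rw [h2, neg_neg]
    nlinarith
  · rw [meromorphicOrderAt_dirichletQuot hU hs hn, Finset.sum_eq_single_of_mem ℓ hℓ fun j hj hjℓ => by
      rw [hn0 j (h1 j hj) (hne j hj hjℓ), mul_zero]]
    rw [(tendsto_ne_zero_iff_meromorphicOrderAt_eq_zero hU.meromorphicAt).1
      ⟨_, hU0, hU.continuousAt.tendsto.mono_left nhdsWithin_le_nhds⟩, zero_add]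

lemma dirichletQuot_conj (hU : U (starRingEnd ℂ s) = starRingEnd ℂ (U s)) :
    dirichletQuot U a N (starRingEnd ℂ s) = starRingEnd ℂ (dirichletQuot U a N s) := by
  simp only [dirichletQuot, map_mul, map_inv₀, map_prod, map_zpow₀, hU, ← riemannZeta_conj,
    Complex.conj_natCast]

end

end FakeMu

namespace FakeMu

open Filter Topology MeasureTheory

lemma exists_laplace_oscillation {f : ℕ → ℤ} (hf : ∀ n, n ≠ 0 → |f n| ≤ 1) {ℓ : ℕ} (hℓ : 1 ≤ ℓ)
    {a : ℕ → ℤ} (ha : a ℓ < 0) {U : ℂ → ℂ} {α' : ℝ} (hα'0 : 0 ≤ α')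
    (hα' : α' < 1 / (2 * ℓ : ℝ)) (hU : ∀ s : ℂ, α' < s.re → AnalyticAt ℂ U s)
    (hconj : ∀ s : ℂ, α' < s.re → U (starRingEnd ℂ s) = starRingEnd ℂ (U s))
    (hD : ∀ s : ℂ, 1 < s.re → ∑' n : ℕ, (f n : ℂ) / (n : ℂ) ^ s =
      U s * ∏ j ∈ Finset.Icc 1 (2 * ℓ), riemannZeta (j * s) ^ a j)
    {s₀ : ℂ} (him : s₀.im ≠ 0) (hre : 1 / (2 * ℓ : ℝ) ≤ s₀.re) (hζ : riemannZeta (ℓ * s₀) = 0)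
    (hζ' : ∀ j ∈ Finset.Icc 1 (2 * ℓ), j ≠ ℓ → riemannZeta (j * s₀) ≠ 0) (hU0 : U s₀ ≠ 0) :
    ∃ c : ℕ → ℕ → ℝ,
      let e : ℝ → ℝ := fun u => (∑ n ∈ Finset.Icc 1 ⌊Real.exp u⌋₊, (f n : ℝ)) -
        ∑ j ∈ Finset.Icc 1 (2 * ℓ), (laplacePoly (c j) (a j).toNat).eval u * Real.exp (1 / j * u)
      let g : ℝ → ℝ := fun u => u ^ ((a ℓ).natAbs - 1) * Real.exp (1 / (2 * ℓ : ℝ) * u)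
      (∃ c : ℝ, 0 < c ∧ ∀ u₀ : ℝ, ∃ u, u₀ ≤ u ∧ e u ≤ -(c * g u)) ∧
        (∃ c : ℝ, 0 < c ∧ ∀ u₀ : ℝ, ∃ u, u₀ ≤ u ∧ -e u ≤ -(c * g u)) := by
  set N := 2 * ℓ with hN
  set R := dirichletQuot U a N with hR
  have hℓ' : (1 : ℝ) ≤ ℓ := by exact_mod_cast hℓ
  set α : ℝ := 1 / (2 * ℓ : ℝ) with hα
  have hα0 : 0 < α := by positivity
  have hα1 : α ≤ 1 := by rw [hα, div_le_one (by positivity)]; linarith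
  have hj1 : ∀ j ∈ Finset.Icc 1 N, (1 : ℝ) ≤ j := fun j hj => by
    exact_mod_cast (Finset.mem_Icc.1 hj).1
  have hjα : ∀ j ∈ Finset.Icc 1 N, α ≤ 1 / (j : ℝ) := by
    intro j hj
    have h1 : (j : ℝ) ≤ 2 * ℓ := by exact_mod_cast (Finset.mem_Icc.1 hj).2
    exact one_div_le_one_div_of_le (by linarith [hj1 j hj]) h1
  have hRm : ∀ s : ℂ, α' < s.re → MeromorphicAt R s := fun s hs =>
    meromorphicAt_dirichletQuot (hU s hs)
  have hRc : ∀ s : ℂ, α' < s.re → R (starRingEnd ℂ s) = starRingEnd ℂ (R s) := fun s hs =>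
    dirichletQuot_conj (hconj s hs)
  have hopen : IsOpen {s : ℂ | α' < s.re} := isOpen_lt continuous_const Complex.continuous_re
  have hpp : ∀ j : ℕ, ∃ c : ℕ → ℝ, j ∈ Finset.Icc 1 N → 0 ≤ meromorphicOrderAt
      (fun s => R s - ∑ i ∈ Finset.range (a j).toNat,
        (c i : ℂ) / (s - ((1 / j : ℝ) : ℂ)) ^ (i + 1)) ((1 / j : ℝ) : ℂ) := by
    intro j
    by_cases hj : j ∈ Finset.Icc 1 N
    · have hre : α' < ((1 / j : ℝ) : ℂ).re := by
        rw [Complex.ofReal_re]; exact hα'.trans_le (hjα j hj)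
      obtain ⟨c, hc⟩ := exists_real_principal_part (a j).toNat (hRm _ hre)
        (neg_le_meromorphicOrderAt_dirichletQuot hj (hU _ hre)) (by
          filter_upwards [nhdsWithin_le_nhds (hopen.mem_nhds hre)] with s hs
          exact hRc s hs)
      exact ⟨c, fun _ => hc⟩
    · exact ⟨0, fun h => absurd h hj⟩
  choose c hc using hpp
  set pp : ℕ → ℂ → ℂ := fun j s => ∑ i ∈ Finset.range (a j).toNat,
    (c j i : ℂ) / (s - ((1 / j : ℝ) : ℂ)) ^ (i + 1) with hppdef
  have hppan : ∀ (j : ℕ) (s : ℂ), s ≠ ((1 / j : ℝ) : ℂ) → AnalyticAt ℂ (pp j) s := by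
    intro j s hs
    refine Finset.analyticAt_fun_sum _ fun i _ => ?_
    exact analyticAt_const.div ((analyticAt_id.sub analyticAt_const).pow _)
      (pow_ne_zero _ (sub_ne_zero.2 hs))
  have hppm : ∀ (j : ℕ) (s : ℂ), MeromorphicAt (pp j) s := by
    intro j s
    refine MeromorphicAt.fun_sum fun i _ => ?_
    exact (MeromorphicAt.const _ _).div (((MeromorphicAt.id s).sub (MeromorphicAt.const _ _)).pow _)
  set H : ℂ → ℂ := fun s => R s - ∑ j ∈ Finset.Icc 1 N, pp j s with hH
  have hHm : MeromorphicOn H {s | α' < s.re} := fun s hs =>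
    (hRm s hs).fun_sub (MeromorphicAt.fun_sum fun j _ => hppm j s)
  have hHord : ∀ σ : ℝ, α ≤ σ → 0 ≤ meromorphicOrderAt H (σ : ℂ) := by
    intro σ hσ
    have hσre : α' < (σ : ℂ).re := by simpa using hα'.trans_le hσ
    by_cases hex : ∃ j ∈ Finset.Icc 1 N, σ = 1 / j
    · obtain ⟨j, hj, hσj⟩ := hex
      have h1 : 0 ≤ meromorphicOrderAt (fun s => R s - pp j s) (σ : ℂ) := by
        rw [hσj]; exact hc j hj
      have h2 : AnalyticAt ℂ (fun s => -∑ i ∈ (Finset.Icc 1 N).erase j, pp i s) (σ : ℂ) := by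
        refine (Finset.analyticAt_fun_sum _ fun i hi => hppan i _ fun h => ?_).neg
        obtain ⟨hij, hi⟩ := Finset.mem_erase.1 hi
        have h3 : σ = 1 / (i : ℝ) := by exact_mod_cast h
        rw [hσj] at h3
        have hi1 := hj1 i hi
        have hjj := hj1 j hj
        field_simp at h3
        exact hij (by exact_mod_cast h3)
      have h3 := meromorphicOrderAt_add ((hRm _ hσre).fun_sub (hppm j σ)) h2.meromorphicAt
      refine (le_min h1 h2.meromorphicOrderAt_nonneg).trans (h3.trans_eq ?_)
      congr 1
      funext s
      simp only [hH, Pi.add_apply, ← Finset.add_sum_erase _ _ hj]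
      ring
    · push Not at hex
      have h1 := meromorphicOrderAt_dirichletQuot_nonneg (a := a) (hα0.trans_le hσ) (hU _ hσre) hex
      have h2 : AnalyticAt ℂ (fun s => -∑ i ∈ Finset.Icc 1 N, pp i s) (σ : ℂ) :=
        (Finset.analyticAt_fun_sum _ fun i hi => hppan i _ fun h =>
          hex i hi (by exact_mod_cast h)).neg
      have h3 := meromorphicOrderAt_add (hRm _ hσre) h2.meromorphicAt
      refine (le_min h1 h2.meromorphicOrderAt_nonneg).trans (h3.trans_eq ?_)
      congr 1
  obtain ⟨m, hm, hRo⟩ := exists_meromorphicOrderAt_dirichletQuot_le (hU s₀ (hα'.trans_le hre))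
    hU0 him (N := N) (Finset.mem_Icc.2 ⟨hℓ, by omega⟩) ha hζ hζ'
  have hk : 1 ≤ (a ℓ).natAbs := by omega
  have hHo : meromorphicOrderAt H s₀ = m := by
    have h2 : AnalyticAt ℂ (fun s => -∑ i ∈ Finset.Icc 1 N, pp i s) s₀ :=
      (Finset.analyticAt_fun_sum _ fun i hi => hppan i _ fun h => him (by
        rw [h, Complex.ofReal_im])).neg
    have h3 : meromorphicOrderAt R s₀ <
        meromorphicOrderAt (fun s => -∑ i ∈ Finset.Icc 1 N, pp i s) s₀ := by
      refine lt_of_lt_of_le ?_ h2.meromorphicOrderAt_nonneg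
      rw [hR, hRo]
      exact_mod_cast (by omega : m < 0)
    rw [← hRo, ← hR, ← meromorphicOrderAt_add_eq_left_of_lt h2.meromorphicAt h3]
    congr 1
  refine ⟨c, ?_⟩
  intro e g
  have hem : Measurable e := by
    refine ((measurable_summatory f).comp Real.measurable_exp).sub ?_
    refine Finset.measurable_fun_sum _ fun j _ => ?_
    exact ((Polynomial.continuous _).measurable).mul (by fun_prop)
  have hbd : ∀ V : ℝ, ∃ K : ℝ, ∀ u, 0 < u → u ≤ V → |e u| ≤ K := by
    intro V
    have hcont : Continuous fun u : ℝ => ∑ j ∈ Finset.Icc 1 N,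
        (laplacePoly (c j) (a j).toNat).eval u * Real.exp (1 / j * u) :=
      continuous_finsetSum _ fun j _ => (Polynomial.continuous _).mul (by fun_prop)
    obtain ⟨K, hK⟩ := isCompact_Icc.exists_bound_of_continuousOn (s := Set.Icc 0 V)
      hcont.continuousOn
    refine ⟨Real.exp V + K, fun u hu hV => (abs_sub _ _).trans (add_le_add ?_ (hK u ⟨hu.le, hV⟩))⟩
    exact (abs_summatory_le hf (Real.exp_pos u).le).trans (Real.exp_le_exp.2 hV)
  have h_int : ∀ s : ℂ, 1 < s.re →
      IntegrableOn (fun u : ℝ => (e u : ℂ) * cexp (-s * u)) (Set.Ioi 0) ∧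
      ∫ u : ℝ in Set.Ioi 0, (e u : ℂ) * cexp (-s * u) = H s := by
    intro s hs
    obtain ⟨i1, v1⟩ := integral_summatory hf hs
    have hP : ∀ j ∈ Finset.Icc 1 N, _ := fun j hj =>
      integral_laplacePoly (c j) (a j).toNat (x := 1 / j) (s := s)
        (((div_le_one (by linarith [hj1 j hj])).2 (hj1 j hj)).trans_lt hs)
    have i2 := integrable_finsetSum (Finset.Icc 1 N) fun j hj => (hP j hj).1
    have hfun : (fun u : ℝ => (e u : ℂ) * cexp (-s * u)) = fun u : ℝ =>
        ((∑ n ∈ Finset.Icc 1 ⌊Real.exp u⌋₊, (f n : ℝ) : ℝ) : ℂ) * cexp (-s * u) -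
        ∑ j ∈ Finset.Icc 1 N, (((laplacePoly (c j) (a j).toNat).eval u *
          Real.exp (1 / j * u) : ℝ) : ℂ) * cexp (-s * u) := by
      funext u
      rw [← Finset.sum_mul, ← sub_mul]
      simp only [e]
      push_cast
      ring
    rw [hfun]
    refine ⟨i1.sub i2, ?_⟩
    rw [integral_sub i1 i2, v1, integral_finsetSum _ fun j hj => (hP j hj).1, hD s hs]
    simp only [hH, hR, dirichletQuot]
    rw [Finset.sum_congr rfl fun j hj => (hP j hj).2]
    rw [div_eq_inv_mul]
  refine ⟨exists_le_neg_of_pole hem hbd hα'0 hα' hα1 hHm h_int hHord him hre hk hm hHo, ?_⟩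
  refine exists_le_neg_of_pole (e := fun u => -e u) (H := -H) hem.neg
    (fun V => by simpa using hbd V) hα'0 hα' hα1 hHm.neg (fun s hs => ?_)
    (fun σ hσ => by rw [← meromorphicOrderAt_neg]; exact hHord σ hσ) him hre hk hm
    (by rw [← meromorphicOrderAt_neg]; exact hHo)
  obtain ⟨i1, v1⟩ := h_int s hs
  have hfun : (fun u : ℝ => ((-e u : ℝ) : ℂ) * cexp (-s * u)) = fun u : ℝ =>
      -((e u : ℂ) * cexp (-s * u)) := by
    funext u; push_cast; ring
  rw [hfun]
  exact ⟨i1.neg, by rw [integral_neg, v1, Pi.neg_apply]⟩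

end FakeMu

lemma FakeMu.exists_le_of_exp {E g : ℝ → ℝ} {c : ℝ}
    (h : ∀ u₀ : ℝ, ∃ u, u₀ ≤ u ∧ E (Real.exp u) ≤ -(c * g (Real.exp u))) (x₀ : ℝ) :
    ∃ x, x₀ ≤ x ∧ E x ≤ -(c * g x) := by
  obtain ⟨u, hu, h⟩ := h x₀
  exact ⟨Real.exp u, hu.trans ((by linarith : u ≤ u + 1).trans (Real.add_one_le_exp u)), h⟩

/-- general oscillation theorem.
Let `f` be a fake μ whose Dirichlet series factors for `Re s > 1` as
`D_f(s) = (∏_p (1 + Σ_{j ≥ 2ℓ+1} η_j p^{-js})) ∏_{j=1}^{2ℓ} ζ(js)^{a_j}` with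
`a_j ≥ 0` for `j ≤ ℓ-1`, `a_ℓ < 0`, and `|η_j| ≤ (Aj)^B`.  Then there are real
polynomials `P_1, …, P_{2ℓ}`, with `P_j = 0` when `a_j ≤ 0` and
`deg P_j ≤ a_j - 1` when `a_j ≥ 1`, such that
`E(x) = F_f(x) - Σ_{j=1}^{2ℓ} P_j(log x) x^{1/j}` satisfies
`E(x) = Ω_±(x^{1/(2ℓ)} (log x)^{|a_ℓ|-1})`. -/
theorem stmt_8 (f : ℕ → ℤ) (ε : ℕ → ℤ)
    (hf1 : f 1 = 1)
    (hmul : ∀ m n : ℕ, Nat.Coprime m n → f (m * n) = f m * f n)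
    (hεval : ∀ j : ℕ, 1 ≤ j → ε j = -1 ∨ ε j = 0 ∨ ε j = 1)
    (hfp : ∀ p : ℕ, Nat.Prime p → ∀ j : ℕ, 1 ≤ j → f (p ^ j) = ε j)
    (ℓ : ℕ) (hℓ : 1 ≤ ℓ)
    (a : ℕ → ℤ) (ha : ∀ j : ℕ, 1 ≤ j → j ≤ ℓ - 1 → 0 ≤ a j) (haℓ : a ℓ < 0)
    (η : ℕ → ℝ) (A B : ℝ) (hA : 0 < A) (hB : 0 < B)
    (hη : ∀ j : ℕ, 2 * ℓ + 1 ≤ j → |η j| ≤ (A * (j : ℝ)) ^ B)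
    (hfact : ∀ s : ℂ, 1 < s.re →
      ∑' n : ℕ, (f n : ℂ) / (n : ℂ) ^ s =
        (∏' p : Nat.Primes,
          (1 + ∑' j : ℕ, (η (j + (2 * ℓ + 1)) : ℂ) *
            ((p : ℕ) : ℂ) ^ (-(((j + (2 * ℓ + 1) : ℕ) : ℂ)) * s))) *
        ∏ j ∈ Finset.Icc 1 (2 * ℓ), riemannZeta ((j : ℂ) * s) ^ (a j)) :
    ∃ P : ℕ → Polynomial ℝ,
      (∀ j : ℕ, 1 ≤ j → j ≤ 2 * ℓ → a j ≤ 0 → P j = 0) ∧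
      (∀ j : ℕ, 1 ≤ j → j ≤ 2 * ℓ → 1 ≤ a j → (P j).natDegree ≤ (a j - 1).toNat) ∧
      OmegaPM
        (fun x : ℝ => (∑ n ∈ Finset.Icc 1 ⌊x⌋₊, (f n : ℝ)) -
          ∑ j ∈ Finset.Icc 1 (2 * ℓ), (P j).eval (Real.log x) * x ^ (1 / (j : ℝ)))
        (fun x : ℝ => x ^ (1 / (2 * ℓ : ℝ)) * Real.log x ^ ((a ℓ).natAbs - 1)) := by
  have hv : ∀ j : ℕ, |η (j + (2 * ℓ + 1))| ≤ (A * ((j + (2 * ℓ + 1) : ℕ) : ℝ)) ^ B := fun j =>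
    hη _ (Nat.le_add_left _ _)
  have hJ : 1 ≤ 2 * ℓ + 1 := by omega
  have hℓ' : (1 : ℝ) ≤ ℓ := by exact_mod_cast hℓ
  set U := FakeMu.eulerTail (fun j => η (j + (2 * ℓ + 1))) (2 * ℓ + 1) with hU
  have hα' : 1 / ((2 * ℓ + 1 : ℕ) : ℝ) < 1 / (2 * ℓ : ℝ) :=
    one_div_lt_one_div_of_lt (by positivity) (by push_cast; linarith)
  obtain ⟨s₀, him, hre, hζ, hζ', hU0⟩ := FakeMu.exists_good_zero hℓ
    (FakeMu.exists_card_eulerTail_zeros_le hA hJ hv hα')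
  obtain ⟨c, ⟨c₁, hc₁, h₁⟩, ⟨c₂, hc₂, h₂⟩⟩ := FakeMu.exists_laplace_oscillation
    (fun n hn => FakeMu.abs_le_one_of_multiplicative hf1 hmul hεval hfp hn) hℓ haℓ
    (by positivity) hα'
    (fun s hs => (FakeMu.differentiableOn_eulerTail hA hJ hv).analyticAt
      ((isOpen_lt continuous_const Complex.continuous_re).mem_nhds hs))
    (fun s hs => FakeMu.eulerTail_conj hA hJ hv hs) hfact him hre hζ hζ' hU0
  refine ⟨fun j => FakeMu.laplacePoly (c j) (a j).toNat, fun j _ _ haj => ?_, fun j _ _ haj => ?_,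
    ?_⟩
  · simp [FakeMu.laplacePoly, Int.toNat_of_nonpos haj]
  · refine (FakeMu.natDegree_laplacePoly_le _ _).trans ?_
    omega
  · have hexp : ∀ (u b : ℝ), Real.exp u ^ b = Real.exp (b * u) := fun u b => by
      rw [← Real.exp_mul, mul_comm]
    constructor
    · refine ⟨c₂, hc₂, fun x₀ => ?_⟩
      obtain ⟨x, hx, h⟩ := FakeMu.exists_le_of_exp (c := c₂)
        (E := fun x : ℝ => -((∑ n ∈ Finset.Icc 1 ⌊x⌋₊, (f n : ℝ)) -
          ∑ j ∈ Finset.Icc 1 (2 * ℓ),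
            (FakeMu.laplacePoly (c j) (a j).toNat).eval (Real.log x) * x ^ (1 / (j : ℝ))))
        (g := fun x : ℝ => x ^ (1 / (2 * ℓ : ℝ)) * Real.log x ^ ((a ℓ).natAbs - 1))
        (fun u₀ => by
          obtain ⟨u, hu, h⟩ := h₂ u₀
          refine ⟨u, hu, ?_⟩
          simp only [Real.log_exp, hexp]
          rwa [mul_comm (Real.exp _) (u ^ _)]) x₀
      exact ⟨x, hx, neg_le_neg_iff.1 h⟩
    · refine ⟨c₁, hc₁, FakeMu.exists_le_of_exp fun u₀ => ?_⟩
      obtain ⟨u, hu, h⟩ := h₁ u₀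
      refine ⟨u, hu, ?_⟩
      simp only [Real.log_exp, hexp]
      rwa [mul_comm (Real.exp _) (u ^ _)]
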